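/- arXiv:1912.03409 — 3 statements merged into one kernel-verified Lean document; each statement's English description precedes it below -/
import Mathlib

section
/- Suppose (H1), (H2) with some integer j > 0, (H3), (H4) hold, and at least one of (COM1) or (COM2) holds. Then for every q ∈ Q the restriction Π_q of the orthogonal projection Π to the amenable set 𝔄(q) is a homeomorphism of 𝔄(q) onto H⁻. -/
open MeasureTheory Set Bornology Filter Topology RealInnerProductSpace

noncomputable section

variable {Q H : Type*}

section Defs
variable [MetricSpace Q] [NormedAddCommGroup H] [InnerProductSpace ℝ H] [CompleteSpace H]

def IsFlow (ϑ : ℝ → Q → Q) : Prop :=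
  (∀ q, ϑ 0 q = q) ∧ (∀ t s q, ϑ (t + s) q = ϑ t (ϑ s q)) ∧
    Continuous fun p : ℝ × Q => ϑ p.1 p.2

def IsCocycle (ϑ : ℝ → Q → Q) (ψ : ℝ → Q → H → H) : Prop :=
  (∀ q u, ψ 0 q u = u) ∧
  (∀ t s : ℝ, 0 ≤ t → 0 ≤ s → ∀ q u, ψ (t + s) q u = ψ t (ϑ s q) (ψ s q u)) ∧
  ContinuousOn (fun p : ℝ × Q × H => ψ p.1 p.2.1 p.2.2) {p : ℝ × Q × H | 0 ≤ p.1}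

def IsCompleteTraj (ϑ : ℝ → Q → Q) (ψ : ℝ → Q → H → H) (q : Q) (u : ℝ → H) : Prop :=
  Continuous u ∧ ∀ t s : ℝ, 0 ≤ t → u (t + s) = ψ t (ϑ s q) (u s)

def IsAmenable (ν : ℝ) (u : ℝ → H) : Prop :=
  IntegrableOn (fun s : ℝ => Real.exp (2 * ν * s) * ‖u s‖ ^ 2) (Set.Iic (0:ℝ))

def amenSet (ϑ : ℝ → Q → Q) (ψ : ℝ → Q → H → H) (ν : ℝ) (q : Q) : Set H :=
  {u₀ | ∃ u : ℝ → H, IsCompleteTraj ϑ ψ q u ∧ IsAmenable ν u ∧ u 0 = u₀}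

structure HypH1 (P : H →L[ℝ] H) (Hplus Hminus : Submodule ℝ H) : Prop where
  selfAdj : IsSelfAdjoint P
  closed_plus : IsClosed (Hplus : Set H)
  orth : Hminus = Hplusᗮ
  inv_plus : ∀ u ∈ Hplus, P u ∈ Hplus
  inv_minus : ∀ u ∈ Hminus, P u ∈ Hminus
  pos : ∀ u ∈ Hplus, u ≠ 0 → (0:ℝ) < ⟪P u, u⟫
  neg : ∀ u ∈ Hminus, u ≠ 0 → ⟪P u, u⟫ < 0

def HypH2 (Hminus : Submodule ℝ H) (j : ℕ) : Prop :=
  FiniteDimensional ℝ Hminus ∧ Module.finrank ℝ Hminus = j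

def HypH3 (ψ : ℝ → Q → H → H) (P : H →L[ℝ] H) (δ ν : ℝ) : Prop :=
  0 < δ ∧ 0 < ν ∧ ∀ (q : Q) (u v : H) (l r : ℝ), 0 ≤ l → l ≤ r →
    Real.exp (2 * ν * r) * ⟪P (ψ r q u - ψ r q v), ψ r q u - ψ r q v⟫ -
      Real.exp (2 * ν * l) * ⟪P (ψ l q u - ψ l q v), ψ l q u - ψ l q v⟫ ≤
      -δ * ∫ s in l..r, Real.exp (2 * ν * s) * ‖ψ s q u - ψ s q v‖ ^ 2

def IsOrthProjOnto (Hminus : Submodule ℝ H) (Pi : H →L[ℝ] H) : Prop :=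
  (∀ u, Pi u ∈ Hminus) ∧ ∀ u, u - Pi u ∈ Hminusᗮ

def HypCOM2 (ψ : ℝ → Q → H → H) : Prop :=
  ∃ tc : ℝ, 0 < tc ∧ ∀ (q : Q) (s : Set H), IsBounded s → IsCompact (closure (ψ tc q '' s))

def HypCOM3 (ψ : ℝ → Q → H → H) : Prop :=
  ∀ (q : Q) (u₀ : H), IsBounded ((fun t => ψ t q u₀) '' Set.Ici (0:ℝ)) →
    IsCompact (closure ((fun t => ψ t q u₀) '' Set.Ici (0:ℝ)))

def LyapunovStable (ψ : ℝ → Q → H → H) (q : Q) (v : ℝ → H) : Prop :=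
  ∀ ε > 0, ∃ η > 0, ∀ u₀ : H, ‖u₀ - v 0‖ < η → ∀ t ≥ 0, ‖ψ t q u₀ - v t‖ < ε

end Defs

def circleFlow (σ : ℝ) : ℝ → AddCircle σ → AddCircle σ := fun t θ => θ + (t : AddCircle σ)

set_option linter.unusedSectionVars false

section TopoDegree

variable {E : Type*} [NormedAddCommGroup E] [InnerProductSpace ℝ E] [FiniteDimensional ℝ E]

/-- polynomial dependence of `det (1 + tA)` on `t`. -/
lemma topo_det_poly (A : E →L[ℝ] E) :
    ∃ p : Polynomial ℝ, p.natDegree ≤ Module.finrank ℝ E ∧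
      ∀ t : ℝ, p.eval t = (ContinuousLinearMap.id ℝ E + t • A).det := by
  classical
  let b := Module.finBasis ℝ E
  let M := LinearMap.toMatrix b b (A : E →ₗ[ℝ] E)
  refine ⟨Matrix.det ((Polynomial.X : Polynomial ℝ) • M.map Polynomial.C
    + (1 : Matrix _ _ ℝ).map Polynomial.C), ?_, ?_⟩
  · simpa using Polynomial.natDegree_det_X_add_C_le M 1
  · intro t
    rw [ContinuousLinearMap.det, ← LinearMap.det_toMatrix b, ← Polynomial.coe_evalRingHom,
      RingHom.map_det]
    congr 1
    have h1 : ((ContinuousLinearMap.id ℝ E + t • A : E →L[ℝ] E) : E →ₗ[ℝ] E)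
        = LinearMap.id + t • (A : E →ₗ[ℝ] E) := rfl
    have h2 : LinearMap.toMatrix b b (LinearMap.id + t • (A : E →ₗ[ℝ] E)) = 1 + t • M := by
      rw [map_add, map_smul, LinearMap.toMatrix_id]
    rw [h1, h2]
    ext i k
    by_cases hik : i = k
    · subst hik
      simp [M, Matrix.map_apply, add_comm]
      ring
    · simp [M, Matrix.map_apply, Matrix.one_apply_ne hik]
      ring

lemma topo_norm_poly (x w : E) (c : ℝ) (k : ℕ) :
    ∃ p : Polynomial ℝ, p.natDegree ≤ 2 * k ∧
      ∀ t : ℝ, p.eval t = (1 - ‖x + t • w‖ ^ 2 * c) ^ k := by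
  refine ⟨(Polynomial.C (1 - ‖x‖ ^ 2 * c) + Polynomial.C (-2 * ⟪x, w⟫ * c) * Polynomial.X
    + Polynomial.C (- ‖w‖ ^ 2 * c) * Polynomial.X ^ 2) ^ k, ?_, ?_⟩
  · rw [mul_comm 2 k]
    refine Polynomial.natDegree_pow_le_of_le k ?_
    compute_degree
  · intro t
    simp only [Polynomial.eval_pow, Polynomial.eval_add, Polynomial.eval_mul, Polynomial.eval_C,
      Polynomial.eval_X]
    congr 1
    rw [norm_add_sq_real, inner_smul_right, norm_smul, mul_pow, Real.norm_eq_abs, sq_abs]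
    ring

/-- Extrapolation from small nodes to `1`. -/
lemma topo_extrapolate (N : ℕ) (τ : ℝ) (hτ : 0 < τ) :
    ∃ (t : Fin (N + 1) → ℝ) (a : Fin (N + 1) → ℝ), (∀ i, 0 < t i ∧ t i ≤ τ) ∧ ∑ i, a i = 1 ∧
      ∀ p : Polynomial ℝ, p.natDegree ≤ N → p.eval 1 = ∑ i, a i * p.eval (t i) := by
  classical
  let t : Fin (N + 1) → ℝ := fun i => τ / ((i : ℕ) + 1)
  have hinj : Set.InjOn t (Finset.univ : Finset (Fin (N+1))) := by
    intro i _ k _ h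
    have h' : τ / ((i : ℕ) + 1 : ℝ) = τ / ((k : ℕ) + 1) := h
    have hi : (0:ℝ) < (i : ℕ) + 1 := by positivity
    have hk : (0:ℝ) < (k : ℕ) + 1 := by positivity
    rw [div_eq_div_iff hi.ne' hk.ne'] at h'
    have := mul_left_cancel₀ hτ.ne' h'
    have h3 : ((k : ℕ) : ℝ) = (i : ℕ) := by linarith
    exact Fin.ext (by exact_mod_cast h3.symm)
  have hp : ∀ p : Polynomial ℝ, p.natDegree ≤ N →
      p.eval 1 = ∑ i, (Lagrange.basis Finset.univ t i).eval 1 * p.eval (t i) := by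
    intro p hp
    have hd : p.degree < (Finset.univ : Finset (Fin (N+1))).card := by
      refine lt_of_le_of_lt Polynomial.degree_le_natDegree ?_
      rw [Finset.card_univ, Fintype.card_fin]
      exact_mod_cast Nat.lt_succ_of_le hp
    conv_lhs => rw [Lagrange.eq_interpolate hinj hd]
    rw [Lagrange.interpolate_apply, Polynomial.eval_finsetSum]
    refine Finset.sum_congr rfl fun i _ => ?_
    simp [mul_comm]
  refine ⟨t, fun i => (Lagrange.basis Finset.univ t i).eval 1, ?_, ?_, hp⟩
  · intro i
    have hi : (1:ℝ) ≤ (i : ℕ) + 1 := by simp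
    exact ⟨by positivity, div_le_self hτ.le hi⟩
  · have := hp 1 (by simp)
    simpa using this.symm

/-- Bijectivity on the ball of small perturbations of the identity. -/
lemma topo_small_bij {h : E → E} {L : NNReal} (hL : LipschitzWith L h) {R : ℝ}
    (hR : ∀ x, R < ‖x‖ → h x = 0) {t : ℝ} (ht : 0 ≤ t) (htL : t * L < 1) :
    Set.InjOn (fun x => x + t • h x) (Metric.closedBall 0 R) ∧
      (fun x => x + t • h x) '' (Metric.closedBall 0 R) = Metric.closedBall 0 R := by
  have hinj : Function.Injective (fun x => x + t • h x) := by
    intro x y hxy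
    have h1 : x - y = t • (h y - h x) := by
      have : x + t • h x = y + t • h y := hxy
      rw [smul_sub, sub_eq_sub_iff_add_eq_add, this, add_comm]
    have h2 : ‖x - y‖ ≤ t * L * ‖x - y‖ := by
      conv_lhs => rw [h1, norm_smul, Real.norm_of_nonneg ht]
      rw [mul_assoc]
      refine mul_le_mul_of_nonneg_left ?_ ht
      rw [norm_sub_rev x y]
      exact hL.norm_sub_le y x
    have h3 : ‖x - y‖ = 0 := by nlinarith [norm_nonneg (x - y)]
    exact sub_eq_zero.1 (norm_eq_zero.1 h3)
  have hsurj : Function.Surjective (fun x => x + t • h x) := by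
    intro y
    have hc : ContractingWith (Real.toNNReal t * L) (fun x => y - t • h x) := by
      refine ⟨by rw [← NNReal.coe_lt_coe]; simpa [Real.coe_toNNReal t ht] using htL, ?_⟩
      refine LipschitzWith.of_dist_le_mul fun a b => ?_
      rw [dist_eq_norm, dist_eq_norm]
      have : y - t • h a - (y - t • h b) = t • (h b - h a) := by rw [smul_sub]; abel
      rw [this, norm_smul, Real.norm_of_nonneg ht]
      rw [NNReal.coe_mul, Real.coe_toNNReal t ht, mul_assoc]
      refine mul_le_mul_of_nonneg_left ?_ ht
      rw [norm_sub_rev a b]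
      exact hL.norm_sub_le b a
    have hf := hc.fixedPoint_isFixedPt
    generalize ContractingWith.fixedPoint (fun x => y - t • h x) hc = z at hf
    have hz : y - t • h z = z := hf
    exact ⟨z, (sub_eq_iff_eq_add.1 hz).symm⟩
  refine ⟨hinj.injOn, ?_⟩
  ext y
  simp only [Set.mem_image, mem_closedBall_zero_iff]
  constructor
  · rintro ⟨x, hx, rfl⟩
    by_contra hcon
    push Not at hcon
    have h0 := hR _ hcon
    have : x + t • h x = x := hinj (by simp only; rw [h0, smul_zero, add_zero])
    rw [this] at hcon
    linarith
  · intro hy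
    obtain ⟨x, hx⟩ := hsurj y
    refine ⟨x, ?_, hx⟩
    by_contra hcon
    push Not at hcon
    have h0 := hR _ hcon
    simp only [h0, smul_zero, add_zero] at hx
    rw [hx] at hcon
    linarith

lemma topo_smooth {h : E → E} (hh : ContDiff ℝ 1 h) {R m : ℝ} (hRpos : 0 < R)
    (hR : ∀ x, R < ‖x‖ → h x = 0) (hm : 0 < m) (hlow : ∀ x, m ≤ ‖x + h x‖) : False := by
  borelize E
  let μ : Measure E := Measure.addHaar
  have hcs : HasCompactSupport h := by
    refine HasCompactSupport.intro (isCompact_closedBall 0 R) fun x hx => hR x ?_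
    simpa using hx
  obtain ⟨L, hL⟩ := ContDiff.lipschitzWith_of_hasCompactSupport hcs hh one_ne_zero
  set B := Metric.closedBall (0 : E) R with hB
  have hBc : IsCompact B := isCompact_closedBall 0 R
  have hcont := hh.continuous
  have hdcont : Continuous (fderiv ℝ h) := hh.continuous_fderiv one_ne_zero
  have hdiff : Differentiable ℝ h := hh.differentiable one_ne_zero
  -- bound M
  obtain ⟨M0, hM0⟩ := hBc.exists_bound_of_continuousOn (f := fun x => x + h x)
    (by fun_prop)
  set M := max M0 (max R m) with hM
  have hMpos : 0 < M := lt_of_lt_of_le hRpos (le_max_of_le_right (le_max_left _ _))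
  have hMR : R ≤ M := le_max_of_le_right (le_max_left _ _)
  have hMm : m ≤ M := le_max_of_le_right (le_max_right _ _)
  have hMb : ∀ x ∈ B, ‖x + h x‖ ≤ M := fun x hx => (hM0 x hx).trans (le_max_left _ _)
  obtain ⟨D, hD⟩ := hBc.exists_bound_of_continuousOn
    (f := fun x => (ContinuousLinearMap.id ℝ E + (1:ℝ) • fderiv ℝ h x).det)
    (by
      refine Continuous.continuousOn ?_
      exact ContinuousLinearMap.continuous_det.comp (by fun_prop))
  -- small t
  have hdetpos : ∃ ε > 0, ∀ A : E →L[ℝ] E, ‖A‖ < ε →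
      0 < (ContinuousLinearMap.id ℝ E + A).det := by
    have hc : Continuous fun A : E →L[ℝ] E => (ContinuousLinearMap.id ℝ E + A).det :=
      ContinuousLinearMap.continuous_det.comp (by fun_prop)
    have h0 : (0:ℝ) < (ContinuousLinearMap.id ℝ E + (0 : E →L[ℝ] E)).det := by
      simp [ContinuousLinearMap.det]
    have := hc.continuousAt.eventually (lt_mem_nhds h0)
    obtain ⟨ε, hε, h⟩ := Metric.eventually_nhds_iff.1 this
    exact ⟨ε, hε, fun A hA => h (by simpa using hA)⟩
  obtain ⟨ε, hε, hdet⟩ := hdetpos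
  obtain ⟨τ, hτ, hτL, hτε⟩ : ∃ τ : ℝ, 0 < τ ∧ τ * L < 1 ∧ τ * L < ε := by
    refine ⟨min 1 ε / (L + 1), by positivity, ?_, ?_⟩
    · have : min 1 ε / (L + 1) * (L:ℝ) < min 1 ε := by
        rw [div_mul_eq_mul_div, div_lt_iff₀ (by positivity)]
        have : 0 < min 1 ε := by positivity
        nlinarith
      exact this.trans_le (min_le_left _ _)
    · have : min 1 ε / (L + 1) * (L:ℝ) < min 1 ε := by
        rw [div_mul_eq_mul_div, div_lt_iff₀ (by positivity)]
        have : 0 < min 1 ε := by positivity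
        nlinarith
      exact this.trans_le (min_le_right _ _)
  let φ : ℕ → E → ℝ := fun k y => (1 - ‖y‖ ^ 2 * (M ^ 2)⁻¹) ^ k
  let F : ℕ → ℝ → E → ℝ := fun k t x =>
    (ContinuousLinearMap.id ℝ E + t • fderiv ℝ h x).det * φ k (x + t • h x)
  have hFc : ∀ k t, Continuous (F k t) := by
    intro k t
    refine Continuous.mul ?_ ?_
    · exact ContinuousLinearMap.continuous_det.comp (by fun_prop)
    · simp only [φ]; fun_prop
  have hFi : ∀ k t, IntegrableOn (F k t) B μ := fun k t =>
    (hFc k t).continuousOn.integrableOn_compact hBc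
  have hsmall : ∀ k t, 0 < t → t ≤ τ → ∫ x in B, F k t x ∂μ = ∫ x in B, φ k x ∂μ := by
    intro k t ht0 htτ
    have htL : t * L < 1 := (mul_le_mul_of_nonneg_right htτ L.2).trans_lt hτL
    obtain ⟨hi, himg⟩ := topo_small_bij hL hR ht0.le htL
    have := integral_image_eq_integral_abs_det_fderiv_smul μ (s := B)
      (f := fun x => x + t • h x)
      (f' := fun x => ContinuousLinearMap.id ℝ E + t • fderiv ℝ h x)
      hBc.measurableSet (fun x _ => by
        have h1 := (hdiff x).hasFDerivAt
        exact ((hasFDerivAt_id x).add (h1.const_smul t)).hasFDerivWithinAt) hi (φ k)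
    rw [himg] at this
    rw [this]
    refine integral_congr_ae (Eventually.of_forall fun x => ?_)
    have hn : ‖t • fderiv ℝ h x‖ < ε := by
      rw [norm_smul, Real.norm_of_nonneg ht0.le]
      have h1 : ‖fderiv ℝ h x‖ ≤ L := norm_fderiv_le_of_lipschitz ℝ hL
      calc t * ‖fderiv ℝ h x‖ ≤ τ * L := by gcongr
        _ < ε := hτε
    simp only [F, smul_eq_mul]
    rw [abs_of_pos (hdet _ hn)]
  have hone : ∀ k, ∫ x in B, F k 1 x ∂μ = ∫ x in B, φ k x ∂μ := by
    intro k
    obtain ⟨t, a, ht, ha, hp⟩ := topo_extrapolate (Module.finrank ℝ E + 2 * k) τ hτ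
    have hx : ∀ x, F k 1 x = ∑ i, a i * F k (t i) x := by
      intro x
      obtain ⟨p, hpd, hpe⟩ := topo_det_poly (fderiv ℝ h x)
      obtain ⟨r, hrd, hre⟩ := topo_norm_poly x (h x) (M ^ 2)⁻¹ k
      have := hp (p * r) (Polynomial.natDegree_mul_le.trans (by omega))
      simpa only [Polynomial.eval_mul, hpe, hre] using this
    simp_rw [hx]
    rw [integral_finsetSum _ (fun i _ => (hFi k (t i)).const_mul (a i))]
    simp_rw [integral_const_mul, fun i => hsmall k (t i) (ht i).1 (ht i).2]
    rw [← Finset.sum_mul, ha, one_mul]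
  -- estimates
  set A := 1 - m ^ 2 * (M ^ 2)⁻¹ with hA
  set b := 1 - (m / 2) ^ 2 * (M ^ 2)⁻¹ with hb
  have hMi : 0 < (M ^ 2)⁻¹ := by positivity
  have hMM : M ^ 2 * (M ^ 2)⁻¹ = 1 := by field_simp
  have hA0 : 0 ≤ A := by
    have : m ^ 2 * (M ^ 2)⁻¹ ≤ M ^ 2 * (M ^ 2)⁻¹ := by gcongr
    rw [hA]; linarith
  have hAb : A < b := by
    rw [hA, hb]
    have : 0 < m ^ 2 * (M ^ 2)⁻¹ := by positivity
    have h2 : (m / 2) ^ 2 * (M ^ 2)⁻¹ = (m ^ 2 * (M ^ 2)⁻¹) / 4 := by ring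
    rw [h2]; linarith
  have hb0 : 0 < b := hA0.trans_lt hAb
  set ρ := min (m / 2) R with hρ
  have hρ0 : 0 < ρ := by positivity
  have hupper : ∀ k, ∫ x in B, F k 1 x ∂μ ≤ D * A ^ k * μ.real B := by
    intro k
    refine (Real.le_norm_self _).trans ?_
    refine norm_setIntegral_le_of_norm_le_const hBc.measure_lt_top fun x hx => ?_
    simp only [F, φ, norm_mul, norm_pow, one_smul]
    have h1 : ‖x + h x‖ ^ 2 * (M ^ 2)⁻¹ ≤ M ^ 2 * (M ^ 2)⁻¹ := by
      gcongr; exact hMb x hx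
    have h2 : m ^ 2 * (M ^ 2)⁻¹ ≤ ‖x + h x‖ ^ 2 * (M ^ 2)⁻¹ := by
      gcongr; exact hlow x
    have h3 := hD x hx
    rw [one_smul] at h3
    have h4 : ‖1 - ‖x + h x‖ ^ 2 * (M ^ 2)⁻¹‖ ≤ A := by
      rw [Real.norm_of_nonneg (by linarith)]; rw [hA]; linarith
    have h5 : 0 ≤ D := (norm_nonneg _).trans h3
    gcongr
  have hlower : ∀ k, b ^ k * μ.real (Metric.closedBall 0 ρ) ≤ ∫ x in B, φ k x ∂μ := by
    intro k
    have hφc : Continuous (φ k) := by simp only [φ]; fun_prop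
    have hsub : Metric.closedBall (0:E) ρ ⊆ B := Metric.closedBall_subset_closedBall (min_le_right _ _)
    calc b ^ k * μ.real (Metric.closedBall 0 ρ) = ∫ x in Metric.closedBall 0 ρ, b ^ k ∂μ := by
          rw [setIntegral_const, smul_eq_mul, mul_comm]
      _ ≤ ∫ x in Metric.closedBall 0 ρ, φ k x ∂μ := by
          refine setIntegral_mono_on (continuous_const.continuousOn.integrableOn_compact
            (isCompact_closedBall _ _)) (hφc.continuousOn.integrableOn_compact
            (isCompact_closedBall _ _)) measurableSet_closedBall fun x hx => ?_
          have hx' : ‖x‖ ≤ m / 2 := (mem_closedBall_zero_iff.1 hx).trans (min_le_left _ _)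
          simp only [φ]
          have : ‖x‖ ^ 2 * (M ^ 2)⁻¹ ≤ (m / 2) ^ 2 * (M ^ 2)⁻¹ := by gcongr
          gcongr
          rw [hb]; linarith
      _ ≤ ∫ x in B, φ k x ∂μ := by
          refine setIntegral_mono_set (hφc.continuousOn.integrableOn_compact hBc) ?_
            (LE.le.eventuallyLE hsub)
          refine (ae_restrict_iff' hBc.measurableSet).2 (Eventually.of_forall fun x hx => ?_)
          have hx' : ‖x‖ ≤ M := (mem_closedBall_zero_iff.1 hx).trans hMR
          simp only [φ, Pi.zero_apply]
          have : ‖x‖ ^ 2 * (M ^ 2)⁻¹ ≤ M ^ 2 * (M ^ 2)⁻¹ := by gcongr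
          refine pow_nonneg (by linarith) k
  have hvol : 0 < μ.real (Metric.closedBall 0 ρ) := by
    refine ENNReal.toReal_pos ?_ (isCompact_closedBall _ _).measure_lt_top.ne
    exact (Metric.measure_closedBall_pos μ 0 hρ0).ne'
  have hfin : ∀ k : ℕ, μ.real (Metric.closedBall 0 ρ) ≤ D * μ.real B * (A / b) ^ k := by
    intro k
    have := (hlower k).trans ((hone k).symm.le.trans (hupper k))
    rw [div_pow, ← mul_div_assoc, le_div_iff₀ (by positivity)]
    linarith
  have hlim : Tendsto (fun k : ℕ => D * μ.real B * (A / b) ^ k) atTop (𝓝 (D * μ.real B * 0)) :=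
    (tendsto_pow_atTop_nhds_zero_of_lt_one (by positivity) ((div_lt_one hb0).2 hAb)).const_mul _
  rw [mul_zero] at hlim
  have := ge_of_tendsto' hlim hfin
  linarith

lemma topo_zero {h : E → E} (hh : Continuous h) {R : ℝ} (hRpos : 0 < R)
    (hR : ∀ x, R < ‖x‖ → h x = 0) : ∃ x, x + h x = 0 := by
  by_contra hcon
  push Not at hcon
  have hcs : HasCompactSupport h := by
    refine HasCompactSupport.intro (isCompact_closedBall 0 R) fun x hx => hR x ?_
    simpa using hx
  obtain ⟨m, hm, hlow⟩ : ∃ m > 0, ∀ x, m ≤ ‖x + h x‖ := by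
    obtain ⟨x0, hx0, hmin⟩ := (isCompact_closedBall (0:E) R).exists_isMinOn
      ⟨0, by simp [hRpos.le]⟩ (f := fun x => ‖x + h x‖) (by fun_prop)
    refine ⟨min R ‖x0 + h x0‖, lt_min hRpos (norm_pos_iff.2 (hcon x0)), fun x => ?_⟩
    by_cases hx : ‖x‖ ≤ R
    · exact (min_le_right _ _).trans (hmin (mem_closedBall_zero_iff.2 hx))
    · push Not at hx
      rw [hR x hx, add_zero]
      exact (min_le_left _ _).trans hx.le
  have huc : UniformContinuous h := hcs.uniformContinuous_of_continuous hh
  obtain ⟨ε, hε, hε'⟩ := Metric.uniformContinuous_iff.mp huc (m / 2) (half_pos hm)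
  obtain ⟨g, hg, hgd⟩ := hh.exists_contDiff_dist_le_of_forall_mem_ball_dist_le hε
  refine topo_smooth (h := g) (hg.of_le (by exact_mod_cast le_top)) (R := R + ε) (m := m / 2)
    (by positivity) ?_ (half_pos hm) ?_
  · intro x hx
    have h0 : h x = 0 := hR x (by linarith)
    have := hgd x 0 (fun y hy => by
      have : h y = 0 := hR y (by
        have h1 : ‖x - y‖ < ε := by rw [← dist_eq_norm, dist_comm]; exact hy
        have h2 := norm_sub_norm_le x y
        linarith)
      rw [this, h0, dist_self])
    rw [h0] at this
    exact dist_le_zero.1 this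
  · intro x
    have h1 := hgd x (m / 2) (fun y hy => (hε' hy).le)
    rw [dist_eq_norm] at h1
    have h2 := hlow x
    have h3 : x + h x = (x + g x) - (g x - h x) := by abel
    rw [h3] at h2
    have := norm_sub_le (x + g x) (g x - h x)
    linarith

/-- A homotopy of the identity through uniformly coercive maps ends in a surjective map. -/
lemma topo_surj {f : ℝ → E → E} (hf : Continuous fun p : ℝ × E => f p.1 p.2)
    (h0 : ∀ x, f 0 x = x) {c : ℝ} (hc : 0 < c)
    (hexp : ∀ t x, 0 ≤ t → t ≤ 1 → c * ‖x‖ ≤ ‖f t x‖) (y : E) : ∃ x, f 1 x = y := by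
  set R := ‖y‖ / c + 1 with hRdef
  have hRpos : 0 < R := by positivity
  have hcR : ‖y‖ < c * R := by
    rw [hRdef, mul_add, mul_div_cancel₀ _ hc.ne']; linarith
  let τ : E → ℝ := fun x => max 0 (min 1 (2 - ‖x‖ / R))
  have hτc : Continuous τ := by simp only [τ]; fun_prop
  have hτ0 : ∀ x, 0 ≤ τ x := fun x => le_max_left _ _
  have hτ1 : ∀ x, τ x ≤ 1 := fun x => max_le zero_le_one (min_le_left _ _)
  obtain ⟨x, hx⟩ := topo_zero (h := fun x => f (τ x) x - τ x • y - x)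
    (by
      have : Continuous fun x => f (τ x) x := hf.comp (hτc.prodMk continuous_id)
      fun_prop) (R := 2 * R) (by positivity)
    (by
      intro x hx
      have : τ x = 0 := by
        have : 2 < ‖x‖ / R := by rwa [lt_div_iff₀ hRpos]
        simp only [τ]
        rw [max_eq_left]
        exact (min_le_right _ _).trans (by linarith)
      simp only [this, h0, zero_smul, sub_zero, sub_self])
  have hx' : f (τ x) x = τ x • y := by
    have : x + (f (τ x) x - τ x • y - x) = f (τ x) x - τ x • y := by abel
    rw [this] at hx
    exact sub_eq_zero.1 hx
  have h1 : ‖x‖ ≤ R := by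
    by_contra hcon
    push Not at hcon
    have h2 := hexp (τ x) x (hτ0 x) (hτ1 x)
    rw [hx', norm_smul, Real.norm_of_nonneg (hτ0 x)] at h2
    have h3 : τ x * ‖y‖ ≤ ‖y‖ := mul_le_of_le_one_left (norm_nonneg _) (hτ1 x)
    have h4 : c * R < c * ‖x‖ := by gcongr
    linarith
  have h2 : τ x = 1 := by
    have : ‖x‖ / R ≤ 1 := by rwa [div_le_one hRpos]
    simp only [τ]
    rw [min_eq_left (by linarith), max_eq_right zero_le_one]
  rw [h2, one_smul] at hx'
  exact ⟨x, hx'⟩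

end TopoDegree

section Dyn

variable {Q H : Type*} [MetricSpace Q] [NormedAddCommGroup H] [InnerProductSpace ℝ H]
  [CompleteSpace H]

/-- trajectories on a half line `[l, ∞)` -/
def IsTrajFrom (ϑ : ℝ → Q → Q) (ψ : ℝ → Q → H → H) (q : Q) (l : ℝ) (a : ℝ → H) : Prop :=
  Continuous a ∧ ∀ t s : ℝ, 0 ≤ t → l ≤ s → a (t + s) = ψ t (ϑ s q) (a s)

variable {ϑ : ℝ → Q → Q} {ψ : ℝ → Q → H → H} {P Pi : H →L[ℝ] H} {δ ν : ℝ} {q : Q}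

lemma IsCompleteTraj.trajFrom {u : ℝ → H} (hu : IsCompleteTraj ϑ ψ q u) (l : ℝ) :
    IsTrajFrom ϑ ψ q l u := ⟨hu.1, fun t s ht _ => hu.2 t s ht⟩

lemma IsTrajFrom.mono {a : ℝ → H} {l l' : ℝ} (ha : IsTrajFrom ϑ ψ q l a) (h : l ≤ l') :
    IsTrajFrom ϑ ψ q l' a := ⟨ha.1, fun t s ht hs => ha.2 t s ht (h.trans hs)⟩

lemma cont_psi (hcoc : IsCocycle ϑ ψ) {X : Type*} [TopologicalSpace X] {f : X → ℝ} {g : X → Q}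
    {k : X → H} (hf : Continuous f) (hg : Continuous g) (hk : Continuous k) (h0 : ∀ x, 0 ≤ f x) :
    Continuous fun x => ψ (f x) (g x) (k x) :=
  hcoc.2.2.comp_continuous (f := fun x => (f x, g x, k x)) (by fun_prop) h0

lemma trajFrom_mk (hflow : IsFlow ϑ) (hcoc : IsCocycle ϑ ψ) (T : ℝ) (x : H) :
    IsTrajFrom ϑ ψ q (-T) (fun s => ψ (max (s + T) 0) (ϑ (-T) q) x) := by
  refine ⟨cont_psi hcoc (by fun_prop) continuous_const continuous_const
    fun _ => le_max_right _ _, ?_⟩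
  intro t s ht hs
  simp only
  rw [max_eq_left (by linarith), max_eq_left (by linarith), add_assoc,
    hcoc.2.1 t (s + T) ht (by linarith), ← hflow.2.1]
  congr 2
  ring

lemma energy (h3 : HypH3 ψ P δ ν) {a b : ℝ → H} {l s r : ℝ} (ha : IsTrajFrom ϑ ψ q l a)
    (hb : IsTrajFrom ϑ ψ q l b) (hls : l ≤ s) (hsr : s ≤ r) :
    Real.exp (2 * ν * r) * ⟪P (a r - b r), a r - b r⟫ -
      Real.exp (2 * ν * s) * ⟪P (a s - b s), a s - b s⟫ ≤
      -(δ * ∫ τ in s..r, Real.exp (2 * ν * τ) * ‖a τ - b τ‖ ^ 2) := by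
  have h := h3.2.2 (ϑ s q) (a s) (b s) 0 (r - s) le_rfl (sub_nonneg.2 hsr)
  rw [← ha.2 (r - s) s (sub_nonneg.2 hsr) hls, ← hb.2 (r - s) s (sub_nonneg.2 hsr) hls,
    ← ha.2 0 s le_rfl hls, ← hb.2 0 s le_rfl hls, zero_add, sub_add_cancel, mul_zero,
    Real.exp_zero, one_mul] at h
  have hint : Real.exp (2 * ν * s) *
      (∫ τ in (0:ℝ)..(r - s), Real.exp (2 * ν * τ) * ‖ψ τ (ϑ s q) (a s) - ψ τ (ϑ s q) (b s)‖ ^ 2)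
      = ∫ τ in s..r, Real.exp (2 * ν * τ) * ‖a τ - b τ‖ ^ 2 := by
    have h1 := intervalIntegral.integral_comp_add_right (a := 0) (b := r - s)
      (fun τ => Real.exp (2 * ν * τ) * ‖a τ - b τ‖ ^ 2) s
    rw [zero_add, sub_add_cancel] at h1
    rw [← h1, ← intervalIntegral.integral_const_mul]
    refine intervalIntegral.integral_congr fun τ hτ => ?_
    rw [Set.uIcc_of_le (sub_nonneg.2 hsr)] at hτ
    rw [ha.2 τ s hτ.1 hls, hb.2 τ s hτ.1 hls, ← mul_assoc, ← Real.exp_add]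
    congr 2
    ring
  have hr : Real.exp (2 * ν * r) = Real.exp (2 * ν * s) * Real.exp (2 * ν * (r - s)) := by
    rw [← Real.exp_add]; congr 1; ring
  rw [← hint, hr]
  have := mul_le_mul_of_nonneg_left h (Real.exp_pos (2 * ν * s)).le
  linarith

lemma form_facts {Hplus Hminus : Submodule ℝ H} (h1 : HypH1 P Hplus Hminus)
    (hfd : FiniteDimensional ℝ Hminus) (hPi : IsOrthProjOnto Hminus Pi) :
    ∃ K c : ℝ, 0 < K ∧ 0 < c ∧ (∀ u, |⟪P u, u⟫| ≤ K * ‖u‖ ^ 2) ∧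
      (∀ u, -⟪P u, u⟫ ≤ K * ‖Pi u‖ ^ 2) ∧ (∀ x ∈ Hminus, c * ‖x‖ ^ 2 ≤ -⟪P x, x⟫) ∧
      (∀ x ∈ Hminus, Pi x = x) := by
  have hK : ∀ u, |⟪P u, u⟫| ≤ (‖P‖ + 1) * ‖u‖ ^ 2 := by
    intro u
    calc |⟪P u, u⟫| ≤ ‖P u‖ * ‖u‖ := abs_real_inner_le_norm _ _
      _ ≤ ‖P‖ * ‖u‖ * ‖u‖ := by gcongr; exact P.le_opNorm u
      _ ≤ (‖P‖ + 1) * ‖u‖ ^ 2 := by nlinarith [sq_nonneg ‖u‖]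
  have hperp : ∀ u ∈ Hminusᗮ, u ∈ Hplus := by
    intro u hu
    have : CompleteSpace Hplus := h1.closed_plus.completeSpace_coe
    rwa [h1.orth, Submodule.orthogonal_orthogonal] at hu
  have hsplit : ∀ u, -⟪P u, u⟫ ≤ -⟪P (Pi u), Pi u⟫ := by
    intro u
    obtain ⟨x, hx⟩ : ∃ x, x = Pi u := ⟨_, rfl⟩
    obtain ⟨z, hz⟩ : ∃ z, z = u - Pi u := ⟨_, rfl⟩
    have hxm : x ∈ Hminus := hx ▸ hPi.1 u
    have hzp : z ∈ Hminusᗮ := hz ▸ hPi.2 u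
    have hzp' := hperp z hzp
    have hu : u = x + z := by rw [hx, hz]; abel
    have e1 : ⟪P x, z⟫ = 0 := Submodule.inner_right_of_mem_orthogonal (h1.inv_minus x hxm) hzp
    have e2 : ⟪P z, x⟫ = 0 := by
      have hxm' : x ∈ Hplusᗮ := h1.orth ▸ hxm
      exact Submodule.inner_right_of_mem_orthogonal (h1.inv_plus z hzp') hxm'
    have e3 : 0 ≤ ⟪P z, z⟫ := by
      by_cases h0 : z = 0
      · simp [h0]
      · exact (h1.pos z hzp' h0).le
    rw [← hx, hu, map_add, inner_add_left, inner_add_right, inner_add_right, e1, e2]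
    linarith
  obtain ⟨c, hc, hcb⟩ : ∃ c > 0, ∀ x ∈ Hminus, c * ‖x‖ ^ 2 ≤ -⟪P x, x⟫ := by
    have hcont : Continuous fun x : Hminus => -⟪P (x : H), (x : H)⟫ := by fun_prop
    rcases subsingleton_or_nontrivial Hminus with hs | hs
    · refine ⟨1, one_pos, fun x hx => ?_⟩
      have : (⟨x, hx⟩ : Hminus) = 0 := Subsingleton.elim _ _
      have h0 : x = 0 := congrArg Subtype.val this
      simp [h0]
    · obtain ⟨x0, hx0, hmin⟩ := (isCompact_sphere (0 : Hminus) 1).exists_isMinOn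
        (NormedSpace.sphere_nonempty.2 zero_le_one) hcont.continuousOn
      have hx0n : (x0 : H) ≠ 0 := by
        intro h
        have h' : x0 = 0 := Subtype.ext h
        rw [h'] at hx0
        simp at hx0
      refine ⟨-⟪P (x0 : H), (x0 : H)⟫, neg_pos.2 (h1.neg x0 x0.2 hx0n), fun x hx => ?_⟩
      by_cases h0 : x = 0
      · simp [h0]
      have hn : 0 < ‖x‖ := norm_pos_iff.2 h0
      have hy : ‖x‖⁻¹ • (⟨x, hx⟩ : Hminus) ∈ Metric.sphere (0 : Hminus) 1 := by
        rw [mem_sphere_zero_iff_norm, norm_smul, norm_inv, norm_norm, Submodule.coe_norm]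
        exact inv_mul_cancel₀ hn.ne'
      have h2 : -⟪P (x0 : H), (x0 : H)⟫ ≤ -⟪P (‖x‖⁻¹ • x), (‖x‖⁻¹ • x)⟫ := hmin hy
      rw [map_smul, inner_smul_left, inner_smul_right] at h2
      simp only [conj_trivial] at h2
      have h3 := mul_le_mul_of_nonneg_right h2 (sq_nonneg ‖x‖)
      have h4 : -(‖x‖⁻¹ * (‖x‖⁻¹ * ⟪P x, x⟫)) * ‖x‖ ^ 2 = -⟪P x, x⟫ := by
        field_simp
      rw [h4] at h3
      exact h3
  refine ⟨‖P‖ + 1, c, by positivity, hc, hK, fun u => ?_, hcb, ?_⟩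
  · exact (hsplit u).trans ((neg_le_abs _).trans (hK (Pi u)))
  · intro x hx
    have h2 : x - Pi x ∈ Hminus := Hminus.sub_mem hx (hPi.1 x)
    have h3 := Submodule.inner_right_of_mem_orthogonal h2 (hPi.2 x)
    exact (sub_eq_zero.1 (inner_self_eq_zero.1 h3)).symm

lemma exists_le_of_integral {g : ℝ → ℝ} (hg : Continuous g) {a b C : ℝ} (hab : a < b)
    (h : ∫ x in a..b, g x ≤ C) : ∃ s, a ≤ s ∧ s ≤ b ∧ g s ≤ C / (b - a) := by
  by_contra hcon
  push Not at hcon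
  have h1 := intervalIntegral.integral_lt_integral_of_continuousOn_of_le_of_exists_lt
    (f := fun _ => C / (b - a)) (g := g) hab continuousOn_const hg.continuousOn
    (fun x hx => (hcon x hx.1.le hx.2).le) ⟨a, ⟨le_rfl, hab.le⟩, hcon a le_rfl hab.le⟩
  rw [intervalIntegral.integral_const, smul_eq_mul, mul_div_cancel₀ _ (sub_pos.2 hab).ne'] at h1
  linarith

lemma integral_mono_left {g : ℝ → ℝ} (hg : Continuous g) (h0 : ∀ x, 0 ≤ g x) {a a' b b' : ℝ}
    (ha : a ≤ a') (hab : a' ≤ b') (hb : b' ≤ b) :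
    ∫ x in a'..b', g x ≤ ∫ x in a..b, g x :=
  intervalIntegral.integral_mono_interval ha hab hb
    (Eventually.of_forall fun x => h0 x) (hg.intervalIntegrable _ _)

lemma cont_weight {w : ℝ → H} (hw : Continuous w) :
    Continuous fun s => Real.exp (2 * ν * s) * ‖w s‖ ^ 2 := by fun_prop

lemma weight_nonneg (w : ℝ → H) (s : ℝ) : 0 ≤ Real.exp (2 * ν * s) * ‖w s‖ ^ 2 := by positivity

/-- key estimate -/
lemma pair_est (h3 : HypH3 ψ P δ ν) {K : ℝ} (hK0 : 0 < K) (hK : ∀ u, |⟪P u, u⟫| ≤ K * ‖u‖ ^ 2)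
    (hPiK : ∀ u, -⟪P u, u⟫ ≤ K * ‖Pi u‖ ^ 2) {a b : ℝ → H} {A C : ℝ} (hA : 0 < A)
    (ha : IsTrajFrom ϑ ψ q (-(2 * A)) a) (hb : IsTrajFrom ϑ ψ q (-(2 * A)) b)
    (hC : ∫ s in (-(2 * A))..0, Real.exp (2 * ν * s) * ‖a s - b s‖ ^ 2 ≤ C) :
    δ * ∫ s in (-A)..0, Real.exp (2 * ν * s) * ‖a s - b s‖ ^ 2 ≤
      K * (C / A) + K * ‖Pi (a 0 - b 0)‖ ^ 2 := by
  have hc : Continuous fun s => Real.exp (2 * ν * s) * ‖a s - b s‖ ^ 2 :=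
    cont_weight (ha.1.sub hb.1)
  have h0 := weight_nonneg (ν := ν) (fun s => a s - b s)
  have hI : ∫ s in (-(2 * A))..(-A), Real.exp (2 * ν * s) * ‖a s - b s‖ ^ 2 ≤ C :=
    (integral_mono_left hc h0 le_rfl (by linarith) (by linarith)).trans hC
  obtain ⟨s, hs1, hs2, hs⟩ := exists_le_of_integral hc (by linarith) hI
  have hAA : -A - -(2 * A) = A := by ring
  rw [hAA] at hs
  have he := energy h3 ha hb hs1 (show s ≤ 0 by linarith)
  rw [mul_zero, Real.exp_zero, one_mul] at he
  have h1 := hPiK (a 0 - b 0)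
  have h2 : Real.exp (2 * ν * s) * ⟪P (a s - b s), a s - b s⟫ ≤ K * (C / A) := by
    calc _ ≤ Real.exp (2 * ν * s) * (K * ‖a s - b s‖ ^ 2) := by
          gcongr; exact (le_abs_self _).trans (hK _)
      _ = K * (Real.exp (2 * ν * s) * ‖a s - b s‖ ^ 2) := by ring
      _ ≤ K * (C / A) := by gcongr
  have h4 := mul_le_mul_of_nonneg_left (integral_mono_left hc h0 hs2 (by linarith : -A ≤ 0) le_rfl)
    h3.1.le
  linarith

lemma amen_est (h3 : HypH3 ψ P δ ν) {K : ℝ} (hK0 : 0 < K) (hK : ∀ u, |⟪P u, u⟫| ≤ K * ‖u‖ ^ 2)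
    (hPiK : ∀ u, -⟪P u, u⟫ ≤ K * ‖Pi u‖ ^ 2) {u v : ℝ → H}
    (hu : IsCompleteTraj ϑ ψ q u) (hv : IsCompleteTraj ϑ ψ q v)
    (hua : IsAmenable ν u) (hva : IsAmenable ν v) :
    δ * ∫ s in (-1)..0, Real.exp (2 * ν * s) * ‖u s - v s‖ ^ 2 ≤ K * ‖Pi (u 0 - v 0)‖ ^ 2 := by
  have hc : Continuous fun s => Real.exp (2 * ν * s) * ‖u s - v s‖ ^ 2 :=
    cont_weight (hu.1.sub hv.1)
  have h0 := weight_nonneg (ν := ν) (fun s => u s - v s)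
  have hint : IntegrableOn (fun s => Real.exp (2 * ν * s) * ‖u s - v s‖ ^ 2) (Set.Iic 0) := by
    refine ((hua.const_mul 2).add (hva.const_mul 2)).mono' hc.aestronglyMeasurable
      (Eventually.of_forall fun s => ?_)
    rw [Real.norm_of_nonneg (h0 s)]
    have h1 : ‖u s - v s‖ ^ 2 ≤ 2 * ‖u s‖ ^ 2 + 2 * ‖v s‖ ^ 2 := by
      have := norm_sub_le (u s) (v s)
      nlinarith [norm_nonneg (u s - v s), sq_nonneg (‖u s‖ - ‖v s‖)]
    have h2 := mul_le_mul_of_nonneg_left h1 (Real.exp_pos (2 * ν * s)).le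
    refine h2.trans (le_of_eq ?_)
    change _ = 2 * (Real.exp (2 * ν * s) * ‖u s‖ ^ 2) + 2 * (Real.exp (2 * ν * s) * ‖v s‖ ^ 2)
    ring
  set C := ∫ s in Set.Iic 0, Real.exp (2 * ν * s) * ‖u s - v s‖ ^ 2
  have hC : ∀ A : ℝ, 0 ≤ A →
      ∫ s in (-A)..0, Real.exp (2 * ν * s) * ‖u s - v s‖ ^ 2 ≤ C := by
    intro A hA
    rw [intervalIntegral.integral_of_le (by linarith)]
    exact setIntegral_mono_set hint (Eventually.of_forall h0)
      (LE.le.eventuallyLE (fun x hx => hx.2))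
  have hlim : Tendsto (fun A : ℝ => K * (C / A) + K * ‖Pi (u 0 - v 0)‖ ^ 2) atTop
      (𝓝 (K * 0 + K * ‖Pi (u 0 - v 0)‖ ^ 2)) :=
    ((tendsto_const_nhds.div_atTop tendsto_id).const_mul K).add tendsto_const_nhds
  rw [mul_zero, zero_add] at hlim
  refine ge_of_tendsto hlim ?_
  filter_upwards [eventually_ge_atTop 1] with A hA
  refine le_trans ?_ (pair_est h3 hK0 hK hPiK (by linarith : 0 < A) (hu.trajFrom _) (hv.trajFrom _)
    (hC (2 * A) (by linarith)))
  exact mul_le_mul_of_nonneg_left (integral_mono_left hc h0 (by linarith) (by linarith) le_rfl)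
    h3.1.le

lemma inv_cont (hflow : IsFlow ϑ) (hcoc : IsCocycle ϑ ψ)
    (h3 : HypH3 ψ P δ ν) {K : ℝ} (hK0 : 0 < K) (hK : ∀ u, |⟪P u, u⟫| ≤ K * ‖u‖ ^ 2)
    (hPiK : ∀ u, -⟪P u, u⟫ ≤ K * ‖Pi u‖ ^ 2) {v : ℝ → H}
    (hv : IsCompleteTraj ϑ ψ q v) (hva : IsAmenable ν v) {ε : ℝ} (hε : 0 < ε) :
    ∃ η > 0, ∀ u : ℝ → H, IsCompleteTraj ϑ ψ q u → IsAmenable ν u →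
      ‖Pi (u 0) - Pi (v 0)‖ < η → ‖u 0 - v 0‖ < ε := by
  let F : ℝ × H → H := fun p => ψ (max (-p.1) 0) (ϑ p.1 q) (v p.1 + p.2)
  have hvc := hv.1
  have hF : Continuous F := by
    refine cont_psi hcoc (by fun_prop) ?_ (by fun_prop) fun _ => le_max_right _ _
    exact hflow.2.2.comp (f := fun p : ℝ × H => (p.1, q)) (by fun_prop)
  have hFu : ∀ (u : ℝ → H), IsCompleteTraj ϑ ψ q u → ∀ s ≤ 0, F (s, u s - v s) = u 0 := by
    intro u hu s hs
    have := hu.2 (-s) s (by linarith)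
    simp only [F]
    rw [max_eq_left (by linarith), add_sub_cancel, ← this, neg_add_cancel]
  obtain ⟨U, W, hU, hW, hsU, hsW, hUW⟩ := generalized_tube_lemma
    (isCompact_Icc (a := (-1:ℝ)) (b := 0)) (isCompact_singleton (x := (0:H)))
    (n := {p | dist (F p) (v 0) < ε}) (isOpen_lt (by fun_prop) continuous_const) (by
      rintro ⟨s, x⟩ ⟨hs, hx⟩
      have hx' : x = 0 := hx
      have := hFu v hv s hs.2
      rw [sub_self] at this
      subst hx'
      simp only [Set.mem_ofPred_eq]
      rw [this, dist_self]
      exact hε)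
  obtain ⟨η₁, hη₁, hball⟩ := Metric.isOpen_iff.1 hW 0 (hsW rfl)
  have hδ := h3.1
  have hν := h3.2.1
  refine ⟨Real.sqrt (δ * Real.exp (-(2 * ν)) / K) * η₁, by positivity, ?_⟩
  intro u hu hua hclose
  have hest := amen_est h3 hK0 hK hPiK hu hv hua hva
  rw [map_sub] at hest
  have hc : Continuous fun s => Real.exp (2 * ν * s) * ‖u s - v s‖ ^ 2 :=
    cont_weight (hu.1.sub hv.1)
  obtain ⟨s, hs1, hs2, hs⟩ := exists_le_of_integral (b := 0) (a := -1) hc (by norm_num) le_rfl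
  rw [sub_neg_eq_add, zero_add, div_one] at hs
  have h1 : ‖Pi (u 0) - Pi (v 0)‖ ^ 2 < δ * Real.exp (-(2 * ν)) / K * η₁ ^ 2 := by
    have := pow_lt_pow_left₀ hclose (norm_nonneg _) two_ne_zero
    rwa [mul_pow, Real.sq_sqrt (by positivity)] at this
  have h2 : K * ‖Pi (u 0) - Pi (v 0)‖ ^ 2 < δ * (Real.exp (-(2 * ν)) * η₁ ^ 2) := by
    have := mul_lt_mul_of_pos_left h1 hK0
    have e : K * (δ * Real.exp (-(2 * ν)) / K * η₁ ^ 2) = δ * (Real.exp (-(2 * ν)) * η₁ ^ 2) := by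
      field_simp
    rwa [e] at this
  have h4 := mul_le_mul_of_nonneg_left hs hδ.le
  have h5 : Real.exp (2 * ν * s) * ‖u s - v s‖ ^ 2 < Real.exp (-(2 * ν)) * η₁ ^ 2 := by
    refine lt_of_mul_lt_mul_left ?_ hδ.le
    linarith
  have h6 : Real.exp (-(2 * ν)) ≤ Real.exp (2 * ν * s) := by
    apply Real.exp_le_exp.2; nlinarith
  have h7 : ‖u s - v s‖ ^ 2 < η₁ ^ 2 := by
    refine lt_of_mul_lt_mul_left (a := Real.exp (-(2 * ν))) ?_ (Real.exp_pos _).le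
    refine lt_of_le_of_lt ?_ h5
    gcongr
  have h8 : ‖u s - v s‖ < η₁ := lt_of_pow_lt_pow_left₀ 2 hη₁.le h7
  have h9 := hUW (Set.mk_mem_prod (hsU ⟨hs1, hs2⟩) (hball (mem_ball_zero_iff.2 h8)))
  simp only [Set.mem_ofPred_eq] at h9
  rwa [hFu u hu s hs2, dist_eq_norm] at h9

lemma approx_exists (hflow : IsFlow ϑ) (hcoc : IsCocycle ϑ ψ)
    (h3 : HypH3 ψ P δ ν) {Hminus : Submodule ℝ H} (hfd : FiniteDimensional ℝ Hminus)
    (hPi : IsOrthProjOnto Hminus Pi) {K c : ℝ} (hK0 : 0 < K) (hc0 : 0 < c)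
    (hPiK : ∀ u, -⟪P u, u⟫ ≤ K * ‖Pi u‖ ^ 2)
    (hcb : ∀ x ∈ Hminus, c * ‖x‖ ^ 2 ≤ -⟪P x, x⟫) (hid : ∀ x ∈ Hminus, Pi x = x) {v : ℝ → H}
    (hv : IsCompleteTraj ϑ ψ q v) {T : ℝ} (hT : 0 < T) {y : H} (hy : y ∈ Hminus) :
    ∃ a, IsTrajFrom ϑ ψ q (-T) a ∧ Pi (a 0) = y ∧
      δ * ∫ s in (-T)..0, Real.exp (2 * ν * s) * ‖a s - v s‖ ^ 2 ≤
        K * ‖y - Pi (v 0)‖ ^ 2 := by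
  let a : H → ℝ → H := fun x s => ψ (max (s + T) 0) (ϑ (-T) q) (v (-T) + x)
  have haT : ∀ x, IsTrajFrom ϑ ψ q (-T) (a x) := fun x => trajFrom_mk hflow hcoc T _
  have ha0 : ∀ x, a x (-T) = v (-T) + x := by
    intro x; simp only [a]
    rw [neg_add_cancel, max_self, hcoc.1]
  let f : ℝ → Hminus → Hminus := fun t x =>
    ⟨Pi (a x (t * T - T) - v (t * T - T)), hPi.1 _⟩
  have hvc := hv.1
  have hν := h3.2.1
  obtain ⟨x, hx⟩ := topo_surj (f := f) (c := Real.sqrt (Real.exp (-(2 * ν * T)) * c / K))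
    (by
      refine Continuous.subtype_mk (Pi.continuous.comp (Continuous.sub ?_ (by fun_prop))) _
      refine cont_psi hcoc (by fun_prop) (by fun_prop) (by fun_prop) fun _ => le_max_right _ _)
    (by
      intro x
      apply Subtype.ext
      simp only [f, zero_mul, zero_sub]
      rw [ha0, add_sub_cancel_left, hid _ x.2])
    (by positivity)
    (by
      intro t x ht0 ht1
      have hs : t * T - T ≤ 0 := by nlinarith
      have hs' : -T ≤ t * T - T := by nlinarith
      have he := energy h3 (haT x) (hv.trajFrom (-T)) le_rfl hs'
      have hpos : 0 ≤ ∫ τ in (-T)..(t * T - T), Real.exp (2 * ν * τ) * ‖a x τ - v τ‖ ^ 2 :=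
        intervalIntegral.integral_nonneg hs' fun s _ => weight_nonneg (fun s => a x s - v s) s
      have hpos' := mul_nonneg h3.1.le hpos
      rw [ha0, add_sub_cancel_left] at he
      have h1 := mul_le_mul_of_nonneg_left (hcb x x.2) (Real.exp_pos (2 * ν * -T)).le
      have h2 := hPiK (a x (t * T - T) - v (t * T - T))
      have h4 : Real.exp (2 * ν * (t * T - T)) ≤ 1 := Real.exp_le_one_iff.2 (by nlinarith)
      have h5 := mul_le_mul_of_nonneg_left h2 (Real.exp_pos (2 * ν * (t * T - T))).le
      have h6 : Real.exp (2 * ν * (t * T - T)) * (K * ‖Pi (a x (t * T - T) - v (t * T - T))‖ ^ 2)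
          ≤ K * ‖Pi (a x (t * T - T) - v (t * T - T))‖ ^ 2 :=
        mul_le_of_le_one_left (by positivity) h4
      have h7 : Real.exp (-(2 * ν * T)) * c / K * ‖x‖ ^ 2 ≤ ‖f t x‖ ^ 2 := by
        rw [div_mul_eq_mul_div, div_le_iff₀ hK0]
        have e1 : ‖f t x‖ = ‖Pi (a x (t * T - T) - v (t * T - T))‖ := rfl
        have e2 : ‖x‖ = ‖(x : H)‖ := rfl
        have e3 : 2 * ν * -T = -(2 * ν * T) := by ring
        rw [e1, e2]
        rw [e3] at h1 he
        linarith
      refine le_of_sq_le_sq ?_ (norm_nonneg _)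
      rwa [mul_pow, Real.sq_sqrt (by positivity)])
    ⟨y - Pi (v 0), Hminus.sub_mem hy (hPi.1 _)⟩
  have hx' : Pi (a x 0 - v 0) = y - Pi (v 0) := by
    have := congrArg Subtype.val hx
    simpa only [f, one_mul, sub_self] using this
  refine ⟨a x, haT x, ?_, ?_⟩
  · rw [map_sub] at hx'
    exact sub_left_injective hx'
  · have he := energy h3 (haT x) (hv.trajFrom (-T)) le_rfl (show -T ≤ 0 by linarith)
    rw [ha0, add_sub_cancel_left, mul_zero, Real.exp_zero, one_mul] at he
    have h1 := mul_le_mul_of_nonneg_left (hcb x x.2) (Real.exp_pos (2 * ν * -T)).le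
    have h2 := hPiK (a x 0 - v 0)
    rw [hx'] at h2
    have h4 : 0 ≤ Real.exp (2 * ν * -T) * (c * ‖(x : H)‖ ^ 2) := by positivity
    linarith

lemma cauchy_point {a : ℕ → ℝ → H} (ha : ∀ k, Continuous (a k)) {x y D : ℝ} (hxy : x < y)
    (hD : 0 ≤ D) {N0 : ℕ} (hb : ∀ N k l, N0 ≤ N → N ≤ k → N ≤ l →
      ∫ s in x..y, ‖a k s - a l s‖ ^ 2 ≤ D / 16 ^ N) :
    ∃ s, x ≤ s ∧ s ≤ y ∧ ∃ z, Tendsto (fun k => a k s) atTop (𝓝 z) := by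
  have hae := MeasureTheory.Lp.ae_tendsto_of_cauchy_eLpNorm (p := 2) (μ := volume.restrict (Set.Ioc x y))
    (f := fun n => a (n + N0)) (B := fun N => ENNReal.ofReal ((D + 1) / 4 ^ N))
    (fun n => (ha _).aestronglyMeasurable) (by norm_num)
    (by
      refine Summable.tsum_ofReal_ne_top ?_
      have := (summable_geometric_of_lt_one (r := (1/4 : ℝ)) (by norm_num) (by norm_num)).mul_left
        (D + 1)
      refine this.congr fun n => ?_
      rw [div_pow, one_pow, mul_one_div])
    (by
      intro N n m hn hm
      have h1 := hb (N + N0) (n + N0) (m + N0) (by omega) (by omega) (by omega)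
      have hc : Continuous fun s => ‖a (n + N0) s - a (m + N0) s‖ ^ 2 := by
        have h1 := ha (n + N0)
        have h2 := ha (m + N0)
        fun_prop
      have h2 := eLpNorm_nnreal_pow_eq_lintegral (μ := volume.restrict (Set.Ioc x y))
        (f := a (n + N0) - a (m + N0)) (p := 2) two_ne_zero
      have h3 : ∫⁻ s in Set.Ioc x y, ‖(a (n + N0) - a (m + N0)) s‖ₑ ^ (((2 : NNReal) : ℝ))
          = ENNReal.ofReal (∫ s in x..y, ‖a (n + N0) s - a (m + N0) s‖ ^ 2) := by
        rw [intervalIntegral.integral_of_le hxy.le, ofReal_integral_eq_lintegral_ofReal]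
        · refine lintegral_congr fun s => ?_
          rw [NNReal.coe_ofNat, ENNReal.rpow_ofNat, Pi.sub_apply, ENNReal.ofReal_pow (norm_nonneg _),
            ofReal_norm]
        · exact (hc.integrableOn_Icc (a := x) (b := y)).mono_set Set.Ioc_subset_Icc_self
        · exact Eventually.of_forall fun s => sq_nonneg _
      rw [h3, NNReal.coe_ofNat, ENNReal.rpow_ofNat] at h2
      refine lt_of_pow_lt_pow_left' 2 ?_
      change eLpNorm (a (n + N0) - a (m + N0)) ((2 : NNReal) : ENNReal) _ ^ 2 < _
      rw [h2, ← ENNReal.ofReal_pow (by positivity)]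
      refine (ENNReal.ofReal_lt_ofReal_iff (by positivity)).2 (h1.trans_lt ?_)
      rw [div_pow, ← pow_mul, mul_comm N 2, pow_mul]
      norm_num only
      have h16 : (16:ℝ) ^ N ≤ 16 ^ (N + N0) := pow_le_pow_right₀ (by norm_num) (by omega)
      calc D / 16 ^ (N + N0) ≤ D / 16 ^ N := by gcongr
        _ < (D + 1) ^ 2 / 16 ^ N := by gcongr; nlinarith)
  have hne : (volume.restrict (Set.Ioc x y)) ≠ 0 := by
    rw [Ne, Measure.restrict_eq_zero, Real.volume_Ioc]
    simp [hxy]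
  have : NeBot (ae (volume.restrict (Set.Ioc x y))) := ae_neBot.2 hne
  obtain ⟨s, ⟨z, hz⟩, hs⟩ := (hae.and (ae_restrict_mem measurableSet_Ioc)).exists
  exact ⟨s, hs.1.le, hs.2, z, (tendsto_add_atTop_iff_nat (f := fun k => a k s) N0).1 hz⟩

lemma amen_limit {g : ℕ → ℝ → ℝ} {G : ℝ → ℝ} (hg : ∀ k, Continuous (g k)) (hG : Continuous G)
    (h0 : ∀ k s, 0 ≤ g k s) (hlim : ∀ s, Tendsto (fun k => g k s) atTop (𝓝 (G s)))
    {T : ℕ → ℝ} (hT : Tendsto T atTop atTop) (hT0 : ∀ k, 0 ≤ T k) {C : ℝ}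
    (hC : ∀ k, ∫ s in (-T k)..0, g k s ≤ C) : IntegrableOn G (Set.Iic 0) := by
  have hG0 : ∀ s, 0 ≤ G s := fun s => ge_of_tendsto' (hlim s) fun k => h0 k s
  refine ⟨hG.aestronglyMeasurable, ?_⟩
  rw [hasFiniteIntegral_iff_ofReal (Eventually.of_forall hG0)]
  let F : ℕ → ℝ → ENNReal := fun k => (Set.Ioc (-T k) 0).indicator fun s => ENNReal.ofReal (g k s)
  have hFm : ∀ k, Measurable (F k) := fun k =>
    ((hg k).measurable.ennreal_ofReal).indicator measurableSet_Ioc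
  have hFl : ∀ s ∈ Set.Iic (0:ℝ), ENNReal.ofReal (G s) = liminf (fun k => F k s) atTop := by
    intro s hs
    refine (Tendsto.liminf_eq ?_).symm
    refine (ENNReal.tendsto_ofReal (hlim s)).congr' ?_
    filter_upwards [hT.eventually_gt_atTop (-s)] with k hk
    exact (Set.indicator_of_mem (s := Set.Ioc (-T k) 0) (show s ∈ Set.Ioc (-T k) 0 from ⟨by linarith, hs⟩)
      (fun s => ENNReal.ofReal (g k s))).symm
  rw [setLIntegral_congr_fun measurableSet_Iic hFl]
  refine (lintegral_liminf_le hFm).trans_lt ?_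
  refine lt_of_le_of_lt ?_ (ENNReal.ofReal_lt_top (r := C))
  refine liminf_le_of_le (by isBoundedDefault) fun b hb => ?_
  obtain ⟨k, hk⟩ := hb.exists
  refine hk.trans ?_
  calc ∫⁻ s in Set.Iic 0, F k s ≤ ∫⁻ s, F k s := setLIntegral_le_lintegral _ _
    _ = ∫⁻ s in Set.Ioc (-T k) 0, ENNReal.ofReal (g k s) := lintegral_indicator measurableSet_Ioc _
    _ = ENNReal.ofReal (∫ s in (-T k)..0, g k s) := by
        rw [intervalIntegral.integral_of_le (by linarith [hT0 k]),
          ofReal_integral_eq_lintegral_ofReal]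
        · exact ((hg k).integrableOn_Icc (a := -T k) (b := 0)).mono_set Set.Ioc_subset_Icc_self
        · exact Eventually.of_forall fun s => h0 k s
    _ ≤ ENNReal.ofReal C := ENNReal.ofReal_le_ofReal (hC k)

lemma sq_norm_sub_le (x y : H) : ‖x - y‖ ^ 2 ≤ 2 * ‖x‖ ^ 2 + 2 * ‖y‖ ^ 2 := by
  have := norm_sub_le x y
  nlinarith [norm_nonneg (x - y), sq_nonneg (‖x‖ - ‖y‖)]

lemma amen_surj (hflow : IsFlow ϑ) (hcoc : IsCocycle ϑ ψ)
    (h3 : HypH3 ψ P δ ν) {Hminus : Submodule ℝ H} (hfd : FiniteDimensional ℝ Hminus)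
    (hPi : IsOrthProjOnto Hminus Pi) {K c : ℝ} (hK0 : 0 < K) (hc0 : 0 < c)
    (hK : ∀ u, |⟪P u, u⟫| ≤ K * ‖u‖ ^ 2)
    (hPiK : ∀ u, -⟪P u, u⟫ ≤ K * ‖Pi u‖ ^ 2)
    (hcb : ∀ x ∈ Hminus, c * ‖x‖ ^ 2 ≤ -⟪P x, x⟫) (hid : ∀ x ∈ Hminus, Pi x = x) {v : ℝ → H}
    (hv : IsCompleteTraj ϑ ψ q v) (hva : IsAmenable ν v) {y : H} (hy : y ∈ Hminus) :
    ∃ u, IsCompleteTraj ϑ ψ q u ∧ IsAmenable ν u ∧ Pi (u 0) = y := by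
  have hδ := h3.1
  have hν := h3.2.1
  have hvc := hv.1
  let T : ℕ → ℝ := fun k => 2 * 16 ^ k
  have hTpos : ∀ k, 0 < T k := fun k => by simp only [T]; positivity
  have hTmono : ∀ k l, k ≤ l → T k ≤ T l := fun k l hkl => by
    simp only [T]
    have : (16:ℝ) ^ k ≤ 16 ^ l := pow_le_pow_right₀ (by norm_num) hkl
    linarith
  have hTlim : Tendsto T atTop atTop :=
    (tendsto_pow_atTop_atTop_of_one_lt (by norm_num)).const_mul_atTop (by norm_num)
  choose a haT haPi haE using fun k => approx_exists (q := q) hflow hcoc h3 hfd hPi hK0 hc0 hPiK hcb hid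
    hv (hTpos k) hy
  set C₁ := K * ‖y - Pi (v 0)‖ ^ 2 / δ with hC₁
  have hC₁0 : 0 ≤ C₁ := by positivity
  have haC : ∀ k, ∫ s in (-T k)..0, Real.exp (2 * ν * s) * ‖a k s - v s‖ ^ 2 ≤ C₁ := by
    intro k
    rw [hC₁, le_div_iff₀ hδ, mul_comm]
    exact haE k
  have hwc : ∀ k, Continuous fun s => Real.exp (2 * ν * s) * ‖a k s - v s‖ ^ 2 := fun k =>
    cont_weight ((haT k).1.sub hvc)
  have hdc : ∀ k l, Continuous fun s => Real.exp (2 * ν * s) * ‖a k s - a l s‖ ^ 2 := fun k l =>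
    cont_weight ((haT k).1.sub (haT l).1)
  have hcauchy : ∀ N k l, N ≤ k → N ≤ l →
      δ * ∫ s in (-(16:ℝ) ^ N)..0, Real.exp (2 * ν * s) * ‖a k s - a l s‖ ^ 2 ≤
        K * (4 * C₁ / 16 ^ N) := by
    intro N k l hk hl
    have hTN : -(2 * (16:ℝ) ^ N) ≤ 0 := by have := hTpos N; simp only [T] at this; linarith
    have hbk : ∀ k, N ≤ k →
        ∫ s in (-(2 * (16:ℝ) ^ N))..0, Real.exp (2 * ν * s) * ‖a k s - v s‖ ^ 2 ≤ C₁ := by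
      intro k hk
      refine (integral_mono_left (hwc k) (weight_nonneg fun s => a k s - v s)
        (neg_le_neg (hTmono N k hk)) hTN le_rfl).trans (haC k)
    have h := pair_est h3 hK0 hK hPiK (A := 16 ^ N) (C := 4 * C₁) (by positivity)
      ((haT k).mono (neg_le_neg (hTmono N k hk))) ((haT l).mono (neg_le_neg (hTmono N l hl)))
      (by
        calc ∫ s in (-(2 * (16:ℝ) ^ N))..0, Real.exp (2 * ν * s) * ‖a k s - a l s‖ ^ 2
            ≤ ∫ s in (-(2 * (16:ℝ) ^ N))..0,
                (2 * (Real.exp (2 * ν * s) * ‖a k s - v s‖ ^ 2) +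
                  2 * (Real.exp (2 * ν * s) * ‖a l s - v s‖ ^ 2)) := by
              refine intervalIntegral.integral_mono_on hTN ((hdc k l).intervalIntegrable _ _)
                ((((hwc k).const_mul 2).add ((hwc l).const_mul 2)).intervalIntegrable _ _)
                fun s _ => ?_
              have h1 := sq_norm_sub_le (a k s - v s) (a l s - v s)
              rw [sub_sub_sub_cancel_right] at h1
              have h2 := mul_le_mul_of_nonneg_left h1 (Real.exp_pos (2 * ν * s)).le
              linarith
          _ ≤ 4 * C₁ := by
              rw [intervalIntegral.integral_add (((hwc k).const_mul 2).intervalIntegrable _ _)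
                (((hwc l).const_mul 2).intervalIntegrable _ _),
                intervalIntegral.integral_const_mul, intervalIntegral.integral_const_mul]
              linarith [hbk k hk, hbk l hl])
    have h0 : Pi (a k 0 - a l 0) = 0 := by rw [map_sub, haPi, haPi, sub_self]
    rw [h0] at h
    simpa using h
  -- convergence at arbitrarily negative times
  have hpt : ∀ m : ℕ, ∃ s, s ≤ -(m:ℝ) ∧ ∃ z, Tendsto (fun k => a k s) atTop (𝓝 z) := by
    intro m
    obtain ⟨N0, hN0⟩ : ∃ N0 : ℕ, ∀ N, N0 ≤ N → (m:ℝ) + 1 ≤ 16 ^ N := by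
      have := (tendsto_pow_atTop_atTop_of_one_lt (r := (16:ℝ)) (by norm_num)).eventually_ge_atTop
        ((m:ℝ) + 1)
      exact eventually_atTop.1 this
    obtain ⟨s, hs1, hs2, hz⟩ := cauchy_point (a := a) (fun k => (haT k).1) (x := -(m:ℝ) - 1)
      (y := -(m:ℝ)) (D := Real.exp (2 * ν * (m + 1)) * (K * (4 * C₁) / δ)) (by linarith)
      (by positivity) (N0 := N0) (by
        intro N k l hN hk hl
        have h1 := hcauchy N k l hk hl
        have hm := hN0 N hN
        have hm0 : (0:ℝ) ≤ m := Nat.cast_nonneg m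
        have h2 : ∫ s in (-(m:ℝ) - 1)..(-(m:ℝ)), Real.exp (2 * ν * s) * ‖a k s - a l s‖ ^ 2 ≤
            K * (4 * C₁ / 16 ^ N) / δ := by
          rw [le_div_iff₀ hδ, mul_comm]
          refine le_trans (mul_le_mul_of_nonneg_left ?_ hδ.le) h1
          exact integral_mono_left (hdc k l) (weight_nonneg fun s => a k s - a l s)
            (by linarith) (by linarith) (by linarith)
        calc ∫ s in (-(m:ℝ) - 1)..(-(m:ℝ)), ‖a k s - a l s‖ ^ 2
            ≤ ∫ s in (-(m:ℝ) - 1)..(-(m:ℝ)), Real.exp (2 * ν * (m + 1)) *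
                (Real.exp (2 * ν * s) * ‖a k s - a l s‖ ^ 2) := by
              refine intervalIntegral.integral_mono_on (by linarith)
                (Continuous.intervalIntegrable ?_ _ _)
                (((hdc k l).const_mul _).intervalIntegrable _ _) fun s hs => ?_
              · have h1 := (haT k).1
                have h2 := (haT l).1
                fun_prop
              · rw [← mul_assoc, ← Real.exp_add]
                refine le_mul_of_one_le_left (sq_nonneg _) (Real.one_le_exp ?_)
                nlinarith [hs.1]
          _ = Real.exp (2 * ν * (m + 1)) * ∫ s in (-(m:ℝ) - 1)..(-(m:ℝ)),
                (Real.exp (2 * ν * s) * ‖a k s - a l s‖ ^ 2) :=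
              intervalIntegral.integral_const_mul _ _
          _ ≤ Real.exp (2 * ν * (m + 1)) * (K * (4 * C₁ / 16 ^ N) / δ) := by gcongr
          _ = _ := by ring)
    exact ⟨s, hs2, hz⟩
  have hev : ∀ s : ℝ, ∀ᶠ k in atTop, -T k ≤ s := fun s => by
    filter_upwards [hTlim.eventually_ge_atTop (-s)] with k hk
    linarith
  have hstep : ∀ s t : ℝ, 0 ≤ t → ∀ z, Tendsto (fun k => a k s) atTop (𝓝 z) →
      Tendsto (fun k => a k (t + s)) atTop (𝓝 (ψ t (ϑ s q) z)) := by
    intro s t ht z hz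
    have hc : Continuous fun x => ψ t (ϑ s q) x :=
      cont_psi hcoc continuous_const continuous_const continuous_id fun _ => ht
    refine ((hc.tendsto z).comp hz).congr' ?_
    filter_upwards [hev s] with k hk
    exact ((haT k).2 t s ht hk).symm
  have hex : ∀ t : ℝ, ∃ z, Tendsto (fun k => a k t) atTop (𝓝 z) := by
    intro t
    obtain ⟨m, hm⟩ := exists_nat_ge (-t)
    obtain ⟨s, hs, z, hz⟩ := hpt m
    have := hstep s (t - s) (by linarith) z hz
    rw [sub_add_cancel] at this
    exact ⟨_, this⟩
  choose u hu using hex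
  have hutraj : ∀ t s : ℝ, 0 ≤ t → u (t + s) = ψ t (ϑ s q) (u s) := fun t s ht =>
    tendsto_nhds_unique (hu (t + s)) (hstep s t ht (u s) (hu s))
  have huc : Continuous u := by
    rw [continuous_iff_continuousAt]
    intro t₀
    have hc : Continuous fun t => ψ (max (t - (t₀ - 1)) 0) (ϑ (t₀ - 1) q) (u (t₀ - 1)) :=
      cont_psi hcoc (by fun_prop) continuous_const continuous_const fun _ => le_max_right _ _
    refine hc.continuousAt.congr ?_
    filter_upwards [lt_mem_nhds (show t₀ - 1 < t₀ by linarith)] with t ht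
    rw [max_eq_left (by linarith), ← hutraj _ _ (by linarith), sub_add_cancel]
  refine ⟨u, ⟨huc, hutraj⟩, ?_, ?_⟩
  · have hw : IntegrableOn (fun s => Real.exp (2 * ν * s) * ‖u s - v s‖ ^ 2) (Set.Iic 0) := by
      refine amen_limit hwc (cont_weight (huc.sub hvc)) (fun k => weight_nonneg fun s => a k s - v s)
        (fun s => ?_) hTlim (fun k => (hTpos k).le) haC
      exact (((hu s).sub_const (v s)).norm.pow 2).const_mul _
    refine ((hw.const_mul 2).add (hva.const_mul 2)).mono' (cont_weight huc).aestronglyMeasurable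
      (Eventually.of_forall fun s => ?_)
    rw [Real.norm_of_nonneg (weight_nonneg u s)]
    have h1 := sq_norm_sub_le (u s - v s) (-v s)
    rw [sub_neg_eq_add, sub_add_cancel, norm_neg] at h1
    have h2 := mul_le_mul_of_nonneg_left h1 (Real.exp_pos (2 * ν * s)).le
    refine h2.trans (le_of_eq ?_)
    change _ = 2 * (Real.exp (2 * ν * s) * ‖u s - v s‖ ^ 2) +
      2 * (Real.exp (2 * ν * s) * ‖v s‖ ^ 2)
    ring
  · have h1 := (Pi.continuous.tendsto (u 0)).comp (hu 0)
    refine tendsto_nhds_unique h1 ?_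
    refine tendsto_const_nhds.congr fun k => ?_
    exact (haPi k).symm

end Dyn

/-- Theorem 1 (non-local reduction principle): under (H1)–(H4) and (COM1) or (COM2),
the orthogonal projection onto `H⁻` restricts to a homeomorphism of each amenable set
`𝔄(q)` onto `H⁻`. -/
theorem smith_reduction_principle
    {Q H : Type*} [MetricSpace Q] [NormedAddCommGroup H] [InnerProductSpace ℝ H]
    [CompleteSpace H] [TopologicalSpace.SeparableSpace H]
    (ϑ : ℝ → Q → Q) (ψ : ℝ → Q → H → H)
    (hflow : IsFlow ϑ) (hcoc : IsCocycle ϑ ψ)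
    (P : H →L[ℝ] H) (Hplus Hminus : Submodule ℝ H)
    (h1 : HypH1 P Hplus Hminus)
    (j : ℕ) (hj : 0 < j) (h2 : HypH2 Hminus j)
    (δ ν : ℝ) (h3 : HypH3 ψ P δ ν)
    (h4 : ∀ q : Q, (amenSet ϑ ψ ν q).Nonempty)
    (hcom : IsCompactOperator (⇑P) ∨ HypCOM2 ψ)
    (Pi : H →L[ℝ] H) (hPi : IsOrthProjOnto Hminus Pi) :
    ∀ q : Q, ∃ e : ↥(amenSet ϑ ψ ν q) ≃ₜ ↥Hminus,
      ∀ x : ↥(amenSet ϑ ψ ν q), (e x : H) = Pi (x : H) := by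
  obtain ⟨hfd, -⟩ := h2
  obtain ⟨K, c, hK0, hc0, hK, hPiK, hcb, hid⟩ := form_facts h1 hfd hPi
  intro q
  let f : ↥(amenSet ϑ ψ ν q) → ↥Hminus := fun x => ⟨Pi x, hPi.1 _⟩
  have hfc : Continuous f :=
    Continuous.subtype_mk (Pi.continuous.comp continuous_subtype_val) _
  have hinv : ∀ x : ↥(amenSet ϑ ψ ν q), ∀ ε > 0, ∃ η > 0, ∀ z : ↥(amenSet ϑ ψ ν q),
      dist (f z) (f x) < η → dist z x < ε := by
    rintro ⟨x, v, hv, hva, rfl⟩ ε hε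
    obtain ⟨η, hη, h⟩ := inv_cont hflow hcoc h3 hK0 hK hPiK hv hva hε
    refine ⟨η, hη, ?_⟩
    rintro ⟨z, u, hu, hua, rfl⟩ hd
    rw [Subtype.dist_eq, dist_eq_norm] at hd ⊢
    exact h u hu hua hd
  have hbij : Function.Bijective f := by
    constructor
    · intro x z hxz
      refine dist_le_zero.1 (le_of_forall_pos_le_add fun ε hε => ?_)
      obtain ⟨η, hη, h⟩ := hinv z ε hε
      rw [zero_add]
      exact (h x (by rw [hxz, dist_self]; exact hη)).le
    · rintro ⟨y, hy⟩
      obtain ⟨_, v, hv, hva, -⟩ := h4 q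
      obtain ⟨u, hu, hua, huy⟩ := amen_surj hflow hcoc h3 hfd hPi hK0 hc0 hK hPiK hcb hid hv hva hy
      exact ⟨⟨u 0, u, hu, hua, rfl⟩, Subtype.ext huy⟩
  refine ⟨⟨Equiv.ofBijective f hbij, hfc, ?_⟩, fun x => rfl⟩
  refine Metric.continuous_iff.2 fun b ε hε => ?_
  obtain ⟨η, hη, h⟩ := hinv ((Equiv.ofBijective f hbij).symm b) ε hε
  refine ⟨η, hη, fun a ha => h _ ?_⟩
  have e : ∀ b, f ((Equiv.ofBijective f hbij).symm b) = b :=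
    fun b => (Equiv.ofBijective f hbij).apply_symm_apply b
  change dist (f ((Equiv.ofBijective f hbij).symm a)) (f ((Equiv.ofBijective f hbij).symm b)) < η
  rw [e, e]
  exact ha
end
end

section
/- Suppose the cocycle (ψ,ϑ) is σ-periodic and (H1), (H2) with j = 2, (H3) and at least one of (COM1) or (COM2) hold. If there exists a semi-trajectory u(t) = ψ^t(q,u₀), t ≥ 0, with bounded image, then there exists a σ-periodic trajectory of the cocycle. -/
open MeasureTheory Set Bornology Filter Topology RealInnerProductSpace

noncomputable section

variable {Q H : Type*}

namespace PlaneBrouwer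

lemma exp_lift {A : Type*} [TopologicalSpace A] (F : C(unitInterval × A, ℂ))
    (hF : ∀ p, F p ≠ 0) (l0 : C(A, ℂ)) (h0 : ∀ a, Complex.exp (l0 a) = F (0, a)) :
    ∃ L : C(unitInterval × A, ℂ), (∀ p, Complex.exp (L p) = F p) ∧ ∀ a, L (0, a) = l0 a := by
  let F' : C(unitInterval × A, {z : ℂ // z ≠ 0}) :=
    ⟨fun p => ⟨F p, hF p⟩, F.continuous.subtype_mk _⟩
  have H0 : ∀ a, F' (0, a) = (⟨_, (l0 a).exp_ne_zero⟩ : {z : ℂ // z ≠ 0}) := by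
    intro a
    apply Subtype.ext
    exact (h0 a).symm
  refine ⟨Complex.isCoveringMap_exp.liftHomotopy F' l0 H0, ?_, ?_⟩
  · intro p
    have := congr_fun (Complex.isCoveringMap_exp.liftHomotopy_lifts F' l0 H0) p
    exact congrArg Subtype.val this
  · exact Complex.isCoveringMap_exp.liftHomotopy_zero F' l0 H0

lemma exp_const {A : Type*} [TopologicalSpace A] [PreconnectedSpace A] {c : A → ℂ}
    (hc : Continuous c) (h : ∀ a, Complex.exp (c a) = 1) (a b : A) : c a = c b := by
  refine Complex.isCoveringMap_exp.const_of_comp hc ?_ a b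
  intro a b
  apply Subtype.ext
  simp [h]

lemma exists_log (g : ℂ → ℂ) (hg : Continuous g) (h0 : ∀ x, g x ≠ 0) :
    ∃ θ : ℂ → ℂ, Continuous θ ∧ ∀ x, Complex.exp (θ x) = g x := by
  obtain ⟨L, hL, -⟩ := exp_lift (A := ℂ) ⟨fun p => g ((p.1 : ℝ) • p.2), by fun_prop⟩
    (fun p => h0 _) (ContinuousMap.const _ (Complex.log (g 0)))
    (by intro a; simp [Complex.exp_log (h0 0)])
  refine ⟨fun x => L (1, x), by fun_prop, fun x => ?_⟩
  rw [hL]; simp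

/-- orientation preserving injections of the plane -/
def OP (f : ℂ → ℂ) : Prop :=
  ∃ L : ℂ → ℂ → ℂ, ContinuousOn (fun p : ℂ × ℂ => L p.1 p.2) {p | p.1 ≠ p.2} ∧
    (∀ x y, x ≠ y → Complex.exp (L x y) * (x - y) = f x - f y) ∧
    ∀ x y, x ≠ y → L x y = L y x

lemma OP.inj {f : ℂ → ℂ} (h : OP f) : Function.Injective f := by
  obtain ⟨L, -, h2, -⟩ := h
  intro x y hxy
  by_contra hne
  have := h2 x y hne
  rw [hxy, sub_self] at this
  rcases mul_eq_zero.1 this with h | h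
  · exact Complex.exp_ne_zero _ h
  · exact hne (sub_eq_zero.1 h)

lemma OP.comp {f g : ℂ → ℂ} (hg : OP g) (hf : OP f) (hfc : Continuous f) : OP (g ∘ f) := by
  have hi := hf.inj
  obtain ⟨L, h1, h2, h3⟩ := hf
  obtain ⟨M, k1, k2, k3⟩ := hg
  refine ⟨fun x y => M (f x) (f y) + L x y, ?_, ?_, ?_⟩
  · refine ContinuousOn.add ?_ h1
    exact k1.comp (f := fun p : ℂ × ℂ => (f p.1, f p.2)) (by fun_prop)
      (fun p hp => hi.ne hp)
  · intro x y hxy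
    rw [Complex.exp_add, mul_assoc, h2 x y hxy, k2 _ _ (hi.ne hxy)]; rfl
  · intro x y hxy
    simp only
    rw [h3 x y hxy, k3 _ _ (hi.ne hxy)]

lemma OP.symm {f : ℂ ≃ₜ ℂ} (hf : OP f) : OP f.symm := by
  obtain ⟨L, h1, h2, h3⟩ := hf
  refine ⟨fun x y => - L (f.symm x) (f.symm y), ?_, ?_, ?_⟩
  · refine ContinuousOn.neg ?_
    exact h1.comp (f := fun p : ℂ × ℂ => (f.symm p.1, f.symm p.2)) (by fun_prop)
      (fun p hp => f.symm.injective.ne hp)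
  · intro x y hxy
    have := h2 _ _ (f.symm.injective.ne hxy)
    simp only [Homeomorph.apply_symm_apply] at this
    rw [← this, ← mul_assoc, ← Complex.exp_add]; simp
  · intro x y hxy
    simp only
    rw [h3 _ _ (f.symm.injective.ne hxy)]

lemma OP.of_near_id {f : ℂ → ℂ} (hf : Continuous f)
    (h : ∀ x y, x ≠ y → ‖(f x - x) - (f y - y)‖ < ‖x - y‖) : OP f := by
  have key : ∀ x y, x ≠ y → (f x - f y) / (x - y) ∈ Complex.slitPlane := by
    intro x y hxy
    have hne : x - y ≠ 0 := sub_ne_zero.2 hxy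
    have e : (f x - f y) / (x - y) = 1 + ((f x - x) - (f y - y)) / (x - y) := by
      field_simp; ring
    rw [e]
    apply Complex.mem_slitPlane_of_norm_lt_one
    rw [norm_div, div_lt_one (norm_pos_iff.2 hne)]
    exact h x y hxy
  refine ⟨fun x y => Complex.log ((f x - f y) / (x - y)), ?_, ?_, ?_⟩
  · refine ContinuousOn.clog ?_ (fun p hp => key _ _ hp)
    refine ContinuousOn.div (by fun_prop) (by fun_prop) (fun p hp => sub_ne_zero.2 hp)
  · intro x y hxy
    rw [Complex.exp_log (Complex.slitPlane_ne_zero (key x y hxy)),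
      div_mul_cancel₀ _ (sub_ne_zero.2 hxy)]
  · intro x y hxy
    simp only
    rw [← neg_sub (f y), ← neg_sub y, neg_div_neg_eq]

/-- pairs of distinct points -/
abbrev Conf : Type := {p : ℂ × ℂ // p.1 ≠ p.2}

lemma OP.of_isotopy (G : C(unitInterval × ℂ, ℂ)) (hinj : ∀ t, Function.Injective fun x => G (t, x))
    (h0 : ∀ x, G (0, x) = x) : OP (fun x => G (1, x)) := by
  classical
  have hv : Continuous fun q : unitInterval × Conf => (q.2.1 : ℂ × ℂ) :=
    continuous_subtype_val.comp continuous_snd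
  let F : C(unitInterval × Conf, ℂ) :=
    ⟨fun q => (G (q.1, q.2.1.1) - G (q.1, q.2.1.2)) / (q.2.1.1 - q.2.1.2), by
      refine Continuous.div ?_ (hv.fst.sub hv.snd) (fun q => sub_ne_zero.2 q.2.2)
      exact (G.continuous.comp (continuous_fst.prodMk hv.fst)).sub
        (G.continuous.comp (continuous_fst.prodMk hv.snd))⟩
  have hF : ∀ q, F q ≠ 0 := fun q =>
    div_ne_zero (sub_ne_zero.2 ((hinj q.1).ne q.2.2)) (sub_ne_zero.2 q.2.2)
  have hF0 : ∀ a : Conf, F (0, a) = 1 := by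
    intro a
    change (G (0, a.1.1) - G (0, a.1.2)) / (a.1.1 - a.1.2) = 1
    rw [h0, h0, div_self (sub_ne_zero.2 a.2)]
  obtain ⟨L, hL, hL0⟩ := exp_lift F hF (ContinuousMap.const _ 0) (by intro a; simp [hF0])
  let sw : Conf → Conf := fun a => ⟨(a.1.2, a.1.1), a.2.symm⟩
  have hsw : Continuous sw := by
    refine Continuous.subtype_mk (by fun_prop) _
  have hFs : ∀ t a, F (t, sw a) = F (t, a) := by
    intro t a
    change (G (t, a.1.2) - G (t, a.1.1)) / (a.1.2 - a.1.1) =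
      (G (t, a.1.1) - G (t, a.1.2)) / (a.1.1 - a.1.2)
    rw [← neg_sub (G (t, a.1.1)), ← neg_sub a.1.1, neg_div_neg_eq]
  have hLs : ∀ a, L (1, sw a) = L (1, a) := by
    intro a
    have := exp_const (A := unitInterval) (c := fun t => L (t, sw a) - L (t, a)) (by fun_prop)
      (by intro t; rw [Complex.exp_sub, hL, hL, hFs, div_self (hF _)]) 1 0
    simp only [hL0] at this
    simpa [sub_eq_zero] using this
  refine ⟨fun x y => if h : x ≠ y then L (1, ⟨(x, y), h⟩) else 0, ?_, ?_, ?_⟩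
  · rw [continuousOn_iff_continuous_domRestrict]
    have : Continuous fun a : Conf => L (1, a) := by fun_prop
    refine this.congr ?_
    intro a
    simp only [Set.domRestrict_apply]
    rw [dif_pos a.2]
  · intro x y hxy
    simp only
    rw [dif_pos hxy, hL]
    change (G (1, x) - G (1, y)) / (x - y) * (x - y) = _
    rw [div_mul_cancel₀ _ (sub_ne_zero.2 hxy)]
  · intro x y hxy
    simp only
    rw [dif_pos hxy, dif_pos hxy.symm]
    exact (hLs ⟨(x, y), hxy⟩).symm

/-- no point of period two without fixed points -/
lemma OP.no_period_two {f : ℂ → ℂ} (hf : OP f) (hc : Continuous f) (hfix : ∀ x, f x ≠ x)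
    (x : ℂ) : f (f x) ≠ x := by
  intro hx
  obtain ⟨L, h1, h2, h3⟩ := hf
  obtain ⟨θ, hθ, hθe⟩ := exists_log (fun x => f x - x) (by fun_prop)
    (fun x => sub_ne_zero.2 (hfix x))
  have hLc : Continuous fun x => L (f x) x := by
    rw [← continuousOn_univ]
    exact h1.comp (f := fun x => (f x, x)) (by fun_prop) (fun x _ => hfix x)
  have := exp_const (A := ℂ) (c := fun x => L (f x) x - θ (f x) + θ x)
    ((hLc.sub (hθ.comp hc)).add hθ)
    (by
      intro a
      rw [Complex.exp_add, Complex.exp_sub, hθe, hθe]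
      have e := h2 (f a) a (hfix a)
      have := sub_ne_zero.2 (hfix (f a))
      rw [← e]
      have h' := sub_ne_zero.2 (hfix a)
      have h'' := Complex.exp_ne_zero (L (f a) a)
      field_simp) x (f x)
  simp only [hx] at this
  rw [h3 x (f x) (hfix x).symm] at this
  have e : θ (f x) = θ x := by linear_combination (-1/2) * this
  have e2 := hθe (f x)
  rw [e, hθe, hx] at e2
  exact hfix x (by linear_combination (1/2) * e2)

/-- an orientation preserving map which is coercive is onto -/
lemma OP.surj {f : ℂ → ℂ} (hf : OP f) (hc : Continuous f)
    (hco : ∀ C : ℝ, ∃ R > 0, ∀ x, ‖x‖ = R → C < ‖f x - f 0‖) : Function.Surjective f := by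
  intro p
  by_contra hp
  push Not at hp
  obtain ⟨L, h1, h2, h3⟩ := hf
  obtain ⟨θ, hθ, hθe⟩ := exists_log (fun x => f x - p) (by fun_prop)
    (fun x => sub_ne_zero.2 (hp x))
  obtain ⟨R, hR, hRb⟩ := hco ‖f 0 - p‖
  let c : ℝ → ℂ := fun s => R * Complex.exp (s * Complex.I)
  have hcc : Continuous c := by fun_prop
  have hcn : ∀ s, ‖c s‖ = R := by
    intro s
    simp [c, Complex.norm_exp_ofReal_mul_I, abs_of_pos hR]
  have hc0 : ∀ s, c s ≠ 0 := by
    intro s h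
    have := hcn s
    rw [h, norm_zero] at this
    exact hR.ne this
  have hf0 : ∀ s, f (c s) - f 0 ≠ 0 := by
    intro s h
    have := hRb _ (hcn s)
    rw [h, norm_zero] at this
    exact (norm_nonneg _).not_gt this
  have hsl : ∀ s, 1 + (f 0 - p) / (f (c s) - f 0) ∈ Complex.slitPlane := by
    intro s
    apply Complex.mem_slitPlane_of_norm_lt_one
    rw [norm_div, div_lt_one (norm_pos_iff.2 (hf0 s))]
    exact hRb _ (hcn s)
  have hLc : Continuous fun s => L (c s) 0 := by
    rw [← continuousOn_univ]
    exact h1.comp (f := fun s => (c s, 0)) (by fun_prop) (fun x _ => hc0 x)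
  have hlog : Continuous fun s => Complex.log (1 + (f 0 - p) / (f (c s) - f 0)) := by
    refine Continuous.clog ?_ hsl
    exact continuous_const.add (continuous_const.div (by fun_prop) hf0)
  have := exp_const (A := ℝ) (c := fun s => L (c s) 0 + (Real.log R + s * Complex.I)
    + Complex.log (1 + (f 0 - p) / (f (c s) - f 0)) - θ (c s))
    (((hLc.add (by fun_prop)).add hlog).sub (hθ.comp hcc))
    (by
      intro s
      rw [Complex.exp_sub, Complex.exp_add, Complex.exp_add, Complex.exp_add, hθe,
        Complex.exp_log (Complex.slitPlane_ne_zero (hsl s)), ← Complex.ofReal_exp,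
        Real.exp_log hR]
      have e := h2 (c s) 0 (hc0 s)
      rw [sub_zero] at e
      change Complex.exp (L (c s) 0) * c s * _ / _ = 1
      rw [e]
      have h' := sub_ne_zero.2 (hp (c s))
      have := hf0 s
      field_simp
      ring) (2 * Real.pi) 0
  have hper : c (2 * Real.pi) = c 0 := by
    simp [c, Complex.exp_two_pi_mul_I]
  simp only [hper] at this
  have h' : ((2 * Real.pi : ℝ) : ℂ) * Complex.I = 0 := by
    push_cast at this ⊢
    linear_combination this
  simp [Real.pi_ne_zero] at h'

end PlaneBrouwer


namespace PlaneBrouwer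

lemma push_local (c : ℂ) (ρ : ℝ) (hρ : 0 < ρ) (v : ℂ) (hv : ‖v‖ < ρ) :
    ∃ h : ℂ ≃ₜ ℂ, OP h ∧ h c = c + v ∧ ∀ x ∉ Metric.ball c ρ, h x = x := by
  let b : ℂ → ℝ := fun x => max 0 (1 - ‖x - c‖ / ρ)
  have hb : ∀ x y, |b x - b y| ≤ ‖x - y‖ / ρ := by
    intro x y
    refine (abs_max_sub_max_le_max _ _ _ _).trans ?_
    simp only [sub_self, abs_zero]
    refine max_le (by positivity) ?_
    have : (1 - ‖x - c‖ / ρ) - (1 - ‖y - c‖ / ρ) = (‖y - c‖ - ‖x - c‖) / ρ := by ring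
    rw [this, abs_div, abs_of_pos hρ]
    gcongr
    refine (abs_norm_sub_norm_le _ _).trans ?_
    rw [sub_sub_sub_cancel_right, norm_sub_rev]
  let f : ℂ → ℂ := fun x => x + (b x : ℂ) * v
  have hfe : ∀ x y, (f x - x) - (f y - y) = ((b x - b y : ℝ) : ℂ) * v := by
    intro x y; simp only [f]; push_cast; ring
  have hfb : ∀ x y, ‖(f x - x) - (f y - y)‖ ≤ (‖v‖ / ρ) * ‖x - y‖ := by
    intro x y
    rw [hfe, norm_mul, Complex.norm_real, Real.norm_eq_abs]
    calc _ ≤ ‖x - y‖ / ρ * ‖v‖ := by gcongr; exact hb x y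
      _ = _ := by ring
  have hk : ‖v‖ / ρ < 1 := by rwa [div_lt_one hρ]
  have happ : ApproximatesLinearOn f ((ContinuousLinearEquiv.refl ℝ ℂ : ℂ ≃L[ℝ] ℂ) : ℂ →L[ℝ] ℂ)
      univ (NNReal.mk (‖v‖ / ρ) (by positivity)) := by
    intro x _ y _
    have : f x - f y - ((ContinuousLinearEquiv.refl ℝ ℂ : ℂ ≃L[ℝ] ℂ) : ℂ →L[ℝ] ℂ) (x - y)
        = (f x - x) - (f y - y) := by simp; ring
    rw [this]
    exact hfb x y
  let h : ℂ ≃ₜ ℂ := happ.toHomeomorph f (Or.inr (by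
    have : ‖((ContinuousLinearEquiv.refl ℝ ℂ).symm : ℂ →L[ℝ] ℂ)‖₊ = 1 := by
      apply NNReal.eq
      simp
    rw [this, inv_one]
    exact hk))
  have hh : ∀ x, h x = f x := fun x => rfl
  refine ⟨h, ?_, ?_, ?_⟩
  · apply OP.of_near_id h.continuous
    intro x y hxy
    rw [hh, hh]
    refine (hfb x y).trans_lt ?_
    have : 0 < ‖x - y‖ := norm_pos_iff.2 (sub_ne_zero.2 hxy)
    nlinarith
  · rw [hh]; simp [f, b]
  · intro x hx
    rw [Metric.mem_ball, not_lt, dist_eq_norm] at hx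
    have : b x = 0 := by
      apply max_eq_left
      rw [sub_nonpos, le_div_iff₀ hρ, one_mul]; exact hx
    rw [hh]; simp [f, this]

lemma push {U S : Set ℂ} (hU : IsOpen U) (hS : IsPreconnected S) (hSU : S ⊆ U) {a b : ℂ}
    (ha : a ∈ S) (hb : b ∈ S) :
    ∃ h : ℂ ≃ₜ ℂ, OP h ∧ h a = b ∧ ∀ x ∉ U, h x = x := by
  refine hS.induction₂ (fun a b => ∃ h : ℂ ≃ₜ ℂ, OP h ∧ h a = b ∧ ∀ x ∉ U, h x = x)
    ?_ ?_ ?_ ha hb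
  · intro x hx
    obtain ⟨ρ, hρ, hρU⟩ := Metric.isOpen_iff.1 hU x (hSU hx)
    filter_upwards [mem_nhdsWithin_of_mem_nhds (Metric.ball_mem_nhds x hρ)] with y hy
    obtain ⟨h, h1, h2, h3⟩ := push_local x ρ hρ (y - x) (by simpa [dist_eq_norm] using hy)
    exact ⟨h, h1, by rw [h2]; ring, fun z hz => h3 z (fun h' => hz (hρU h'))⟩
  · rintro x y z - - - ⟨h, h1, h2, h3⟩ ⟨k, k1, k2, k3⟩
    refine ⟨h.trans k, k1.comp h1 h.continuous, by simp [h2, k2], fun w hw => ?_⟩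
    simp [h3 w hw, k3 w hw]
  · rintro x y - - ⟨h, h1, h2, h3⟩
    refine ⟨h.symm, h1.symm, by rw [← h2]; simp, fun w hw => ?_⟩
    rw [Homeomorph.symm_apply_eq, h3 w hw]

/-- fixed point free orientation preserving homeomorphisms -/
def FF (f : ℂ ≃ₜ ℂ) : Prop := OP f ∧ ∀ x, f x ≠ x

lemma FF.perturb {f h : ℂ ≃ₜ ℂ} (hf : FF f) (hh : OP h) {U : Set ℂ}
    (hU : ∀ x ∈ U, f x ∉ U) (hid : ∀ x ∉ U, h x = x) : FF (f.trans h) := by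
  refine ⟨hh.comp hf.1 f.continuous, fun x hx => ?_⟩
  simp only [Homeomorph.trans_apply] at hx
  by_cases hfx : f x ∈ U
  · have hxU : x ∉ U := fun h' => hU x h' hfx
    have := hid x hxU
    exact hf.2 x (h.injective (hx.trans this.symm))
  · rw [hid _ hfx] at hx
    exact hf.2 x hx

lemma iter_agree {f g : ℂ → ℂ} {p : ℂ} {j : ℕ}
    (h : ∀ i < j, g (f^[i] p) = f^[i+1] p) : g^[j] p = f^[j] p := by
  induction j with
  | zero => rfl
  | succ j ih =>
    rw [Function.iterate_succ_apply', ih (fun i hi => h i (by omega)), h j (by omega)]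

/-- returning to a free connected set yields a periodic point of a perturbation -/
lemma FF.star {f : ℂ ≃ₜ ℂ} (hf : FF f) {S U : Set ℂ} (hS : IsPreconnected S) (hU : IsOpen U)
    (hSU : S ⊆ U) (hfree : ∀ x ∈ U, f x ∉ U) {j : ℕ} (hj : 1 ≤ j)
    (hp : ∃ p ∈ S, f^[j] p ∈ S) :
    ∃ g : ℂ ≃ₜ ℂ, FF g ∧ ∃ k, 1 ≤ k ∧ k ≤ j ∧ ∃ x, g^[k] x = x := by
  classical
  have hex : ∃ k, 1 ≤ k ∧ ∃ p ∈ S, f^[k] p ∈ S := ⟨j, hj, hp⟩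
  obtain ⟨hk1, p, hpS, hkS⟩ := Nat.find_spec hex
  have hkj : Nat.find hex ≤ j := Nat.find_min' hex ⟨hj, hp⟩
  have hmin : ∀ i, 1 ≤ i → i < Nat.find hex → f^[i] p ∉ S := by
    intro i hi hik hiS
    exact Nat.find_min hex hik ⟨hi, p, hpS, hiS⟩
  generalize Nat.find hex = k at *
  let E : Set ℂ := (fun i => f^[i] p) '' (Set.Ico 1 k)
  have hE : IsClosed E := ((Set.finite_Ico 1 k).image _).isClosed
  obtain ⟨h, h1, h2, h3⟩ := push (hU.sdiff hE) hS (fun x hx => ⟨hSU hx, by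
    rintro ⟨i, hi, rfl⟩
    exact hmin i hi.1 hi.2 hx⟩) hkS hpS
  refine ⟨f.trans h, hf.perturb h1 (U := U) hfree (fun x hx => h3 x (fun h' => hx h'.1)),
    k, hk1, hkj, p, ?_⟩
  obtain ⟨m, rfl⟩ : ∃ m, k = m + 1 := ⟨k - 1, by omega⟩
  have : (f.trans h)^[m] p = f^[m] p := by
    apply iter_agree
    intro i hi
    simp only [Homeomorph.trans_apply]
    rw [← Function.iterate_succ_apply' f]
    apply h3
    rintro ⟨-, h'⟩
    exact h' ⟨i + 1, ⟨by omega, by omega⟩, rfl⟩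
  rw [Function.iterate_succ_apply', this]
  simp only [Homeomorph.trans_apply]
  rw [← Function.iterate_succ_apply' f, h2]

lemma exists_free_nhd {f : ℂ ≃ₜ ℂ} {S : Set ℂ} (hS : IsCompact S) (h : ∀ x ∈ S, f x ∉ S) :
    ∃ U, IsOpen U ∧ S ⊆ U ∧ ∀ x ∈ U, f x ∉ U := by
  have hd : Disjoint S (f '' S) := by
    rw [Set.disjoint_left]
    rintro _ hx ⟨y, hy, rfl⟩
    exact h y hy hx
  obtain ⟨V1, V2, o1, o2, s1, s2, hV⟩ := SeparatedNhds.of_isCompact_isCompact hS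
    (hS.image f.continuous) hd
  refine ⟨V1 ∩ f ⁻¹' V2, o1.inter (o2.preimage f.continuous), fun x hx =>
    ⟨s1 hx, s2 ⟨x, hx, rfl⟩⟩, ?_⟩
  rintro x ⟨-, hx⟩ ⟨hx', -⟩
  exact Set.disjoint_left.1 hV hx' hx

/-- the critical disc -/
lemma FF.critical {f : ℂ ≃ₜ ℂ} (hf : FF f) (x : ℂ) :
    ∃ r > 0, ∃ z, dist z x = r ∧ dist (f z) x = r ∧
      ∀ y, dist y x ≤ r → dist (f y) x ≤ r → dist y x = r ∧ dist (f y) x = r := by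
  let F : ℂ → ℝ := fun y => max (dist y x) (dist (f y) x)
  have hF : Continuous F := by fun_prop
  obtain ⟨z, hz⟩ : ∃ z, ∀ y, F z ≤ F y := by
    apply hF.exists_forall_le
    refine tendsto_atTop_mono (fun y => le_max_left (dist y x) _) ?_
    exact tendsto_dist_right_cocompact_atTop x
  have hr : 0 < F z := by
    by_contra h
    have h' : F z ≤ 0 := not_lt.1 h
    have h1 : dist z x ≤ 0 := (le_max_left _ _).trans h'
    have h2 : dist (f z) x ≤ 0 := (le_max_right _ _).trans h'
    exact hf.2 z ((dist_le_zero.1 h2).trans (dist_le_zero.1 h1).symm)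
  have shrink : ∀ y, dist y x ≤ F z → ∀ V ∈ 𝓝 y, ∃ y' ∈ V, dist y' x < F z := by
    intro y hy V hV
    have hc : Continuous fun t : ℝ => x + ((1 - t : ℝ) : ℂ) * (y - x) := by fun_prop
    have h0 : x + ((1 - (0:ℝ) : ℝ) : ℂ) * (y - x) = y := by simp
    have hV' : ∀ᶠ t in 𝓝 (0:ℝ), x + ((1 - t : ℝ) : ℂ) * (y - x) ∈ V := by
      apply hc.continuousAt.eventually_mem
      rwa [h0]
    have h1 : ∀ᶠ t in 𝓝 (0:ℝ), t < 1 := eventually_lt_nhds one_pos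
    obtain ⟨t, ⟨ht1, ht2⟩, ht3⟩ := (((hV'.and h1).filter_mono (nhdsWithin_le_nhds
      (s := Set.Ioi 0))).and self_mem_nhdsWithin).exists
    refine ⟨_, ht1, ?_⟩
    rw [dist_eq_norm, add_sub_cancel_left, norm_mul, Complex.norm_real, Real.norm_eq_abs,
      abs_of_pos (by linarith)]
    rw [dist_eq_norm] at hy
    have : (0:ℝ) < t := ht3
    rcases (norm_nonneg (y - x)).eq_or_lt with h | h
    · rw [← h, mul_zero]; exact hr
    · nlinarith
  have key : ∀ y, dist y x ≤ F z → dist (f y) x ≤ F z → dist y x = F z ∧ dist (f y) x = F z := by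
    intro y h1 h2
    constructor
    · refine le_antisymm h1 (not_lt.1 fun h => ?_)
      have : ∀ᶠ w in 𝓝 (f y), dist (f.symm w) x < F z := by
        have hc : Continuous fun w => dist (f.symm w) x := by fun_prop
        apply hc.continuousAt.eventually_lt continuousAt_const
        simpa using h
      obtain ⟨w, hw1, hw2⟩ := shrink (f y) h2 _ this
      have := hz (f.symm w)
      simp only [F, le_max_iff] at this
      rcases this with h' | h'
      · exact absurd hw1 (not_lt.2 h')
      · rw [Homeomorph.apply_symm_apply] at h'
        exact absurd hw2 (not_lt.2 h')
    · refine le_antisymm h2 (not_lt.1 fun h => ?_)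
      have : ∀ᶠ w in 𝓝 y, dist (f w) x < F z := by
        have hc : Continuous fun w => dist (f w) x := by fun_prop
        exact hc.continuousAt.eventually_lt continuousAt_const h
      obtain ⟨w, hw1, hw2⟩ := shrink y h1 _ this
      have := hz w
      simp only [F, le_max_iff] at this
      rcases this with h' | h'
      · exact absurd hw2 (not_lt.2 h')
      · exact absurd hw1 (not_lt.2 h')
  obtain ⟨k1, k2⟩ := key z (le_max_left _ _) (le_max_right _ _)
  exact ⟨F z, hr, z, k1, k2, key⟩

lemma seg_far {x e y : ℂ} (h : y ∈ segment ℝ x e) (hd : dist e x ≤ dist y x) : y = e := by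
  obtain ⟨a, b, ha, hb, hab, rfl⟩ := h
  have e1 : a • x + b • e - x = b • (e - x) := by
    rw [show a = 1 - b by linarith]; simp only [sub_smul, smul_sub, one_smul]; ring
  rw [dist_eq_norm, dist_eq_norm, e1, norm_smul, Real.norm_eq_abs, abs_of_nonneg hb] at hd
  rcases (norm_nonneg (e - x)).eq_or_lt with h | h
  · have : e = x := sub_eq_zero.1 (norm_eq_zero.1 h.symm)
    subst this
    rw [← add_smul, hab, one_smul]
  · have hb1 : 1 ≤ b := by nlinarith
    have : b = 1 := by linarith
    have h0 : a = 0 := by linarith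
    simp [this, h0]

lemma seg_dist {x e y : ℂ} (h : y ∈ segment ℝ x e) : dist y x ≤ dist e x := by
  have : segment ℝ x e ⊆ Metric.closedBall x (dist e x) :=
    (convex_closedBall x _).segment_subset (by simp) (by simp)
  exact this h

lemma isPreconnected_segment' (x e : ℂ) : IsPreconnected (segment ℝ x e) :=
  (convex_segment x e).isPreconnected

lemma isCompact_segment' (x e : ℂ) : IsCompact (segment ℝ x e) := by
  rw [segment_eq_image_lineMap]
  exact isCompact_Icc.image (by fun_prop)

/-- no periodic points without fixed points -/
theorem FF.no_periodic : ∀ (n : ℕ), 1 ≤ n → ∀ f : ℂ ≃ₜ ℂ, FF f → ∀ x, f^[n] x ≠ x := by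
  intro n
  induction n using Nat.strong_induction_on with
  | _ n ih =>
  intro hn f hf x hx
  -- a return to a compact connected free set takes at least `n` steps
  have star : ∀ g : ℂ ≃ₜ ℂ, FF g → ∀ S : Set ℂ, IsCompact S → IsPreconnected S →
      (∀ x ∈ S, g x ∉ S) → ∀ j, 1 ≤ j → j < n → ∀ p ∈ S, g^[j] p ∉ S := by
    intro g hg S hS hS' hfree j hj hjn p hp hp'
    obtain ⟨U, hU1, hU2, hU3⟩ := exists_free_nhd hS hfree
    obtain ⟨k, hk, m, hm1, hm2, y, hy⟩ := hg.star hS' hU1 hU2 hU3 hj ⟨p, hp, hp'⟩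
    exact ih m (by omega) hm1 k hk y hy
  rcases (show n = 1 ∨ n = 2 ∨ 3 ≤ n by omega) with rfl | rfl | hn3
  · exact hf.2 x hx
  · exact hf.1.no_period_two f.continuous hf.2 x hx
  obtain ⟨r, hr, z, hz1, hz2, hcrit⟩ := hf.critical x
  have hA : ∀ y ∈ segment ℝ x z, dist y x ≤ r := fun y hy => hz1 ▸ seg_dist hy
  have hB : ∀ y ∈ segment ℝ x (f z), dist y x ≤ r := fun y hy => hz2 ▸ seg_dist hy
  have hA' : ∀ y ∈ segment ℝ x z, dist y x = r → y = z := fun y hy h =>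
    seg_far hy (by rw [h, hz1])
  have hB' : ∀ y ∈ segment ℝ x (f z), dist y x = r → y = f z := fun y hy h =>
    seg_far hy (by rw [h, hz2])
  have freeB : ∀ y ∈ segment ℝ x (f z), f y ∉ segment ℝ x (f z) := by
    intro y hy hfy
    obtain ⟨k1, k2⟩ := hcrit y (hB _ hy) (hB _ hfy)
    have := hB' _ hy k1
    have h2 := hB' _ hfy k2
    exact hf.2 y (h2.trans this.symm)
  have freeA : ∀ y ∈ segment ℝ x z, f y ∉ segment ℝ x z := by
    intro y hy hfy
    obtain ⟨k1, k2⟩ := hcrit y (hA _ hy) (hA _ hfy)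
    have := hA' _ hy k1
    have h2 := hA' _ hfy k2
    exact hf.2 y (h2.trans this.symm)
  have hAB : ∀ a ∈ segment ℝ x z, f (f a) ∉ segment ℝ x (f z) := by
    intro a ha hp
    let S : Set ℂ := segment ℝ x (f (f a)) ∪ segment ℝ x a
    have sub1 : segment ℝ x (f (f a)) ⊆ segment ℝ x (f z) :=
      (convex_segment _ _).segment_subset (left_mem_segment _ _ _) hp
    have sub2 : segment ℝ x a ⊆ segment ℝ x z :=
      (convex_segment _ _).segment_subset (left_mem_segment _ _ _) ha
    have hSd : ∀ y ∈ S, dist y x ≤ r := by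
      rintro y (hy | hy)
      · exact hB y (sub1 hy)
      · exact hA y (sub2 hy)
    have hSr : ∀ y ∈ S, dist y x = r → (y = f z ∧ f (f a) = f z) ∨ (y = z ∧ a = z) := by
      rintro y (hy | hy) h
      · left
        refine ⟨hB' y (sub1 hy) h, hB' _ hp (le_antisymm (hB _ hp) ?_)⟩
        rw [← h]; exact seg_dist hy
      · right
        refine ⟨hA' y (sub2 hy) h, hA' _ ha (le_antisymm (hA _ ha) ?_)⟩
        rw [← h]; exact seg_dist hy
    have hfree : ∀ y ∈ S, f y ∉ S := by
      intro y hy hfy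
      obtain ⟨k1, k2⟩ := hcrit y (hSd _ hy) (hSd _ hfy)
      rcases hSr _ hy k1 with ⟨e1, e2⟩ | ⟨e1, e2⟩ <;> rcases hSr _ hfy k2 with ⟨e3, e4⟩ | ⟨e3, e4⟩
      · exact hf.2 y (e3.trans e1.symm)
      · rw [e4] at e2
        exact hf.2 z (f.injective e2)
      · rw [e2] at e4
        exact hf.2 z (f.injective e4)
      · exact hf.2 y (e3.trans e1.symm)
    refine star f hf S ((isCompact_segment' _ _).union (isCompact_segment' _ _))
      (IsPreconnected.union x (left_mem_segment _ _ _) (left_mem_segment _ _ _)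
        (isPreconnected_segment' _ _) (isPreconnected_segment' _ _)) hfree 2 (by norm_num)
        (by omega) a (Or.inr (right_mem_segment _ _ _)) (Or.inl (right_mem_segment _ _ _))
  -- push `x` to `f z`
  obtain ⟨U, hU1, hU2, hU3⟩ := exists_free_nhd (isCompact_segment' x (f z)) freeB
  let E : Set ℂ := (fun i => f^[i] x) '' (Set.Ico 1 n) ∪ (fun a => f (f a)) '' (segment ℝ x z)
  have hE : IsClosed E := ((Set.finite_Ico 1 n).image _).isClosed.union
    ((isCompact_segment' _ _).image (by fun_prop)).isClosed
  obtain ⟨h, h1, h2, h3⟩ := push (hU1.sdiff hE) (isPreconnected_segment' x (f z))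
    (fun y hy => ⟨hU2 hy, by
      rintro (⟨i, hi, rfl⟩ | ⟨a, ha, rfl⟩)
      · exact star f hf _ (isCompact_segment' x (f z)) (isPreconnected_segment' x (f z)) freeB
          i hi.1 hi.2 x (left_mem_segment _ _ _) hy
      · exact hAB a ha hy⟩) (left_mem_segment _ _ _) (right_mem_segment _ _ _)
  have hg1 : FF (f.trans h) :=
    hf.perturb h1 (U := U) hU3 (fun x hx => h3 x (fun h' => hx h'.1))
  let g2 : ℂ ≃ₜ ℂ := (f.trans (f.trans h)).trans f.symm
  have hg2a : ∀ y, g2 y = f.symm (h (f (f y))) := fun y => rfl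
  have hg2 : FF g2 := by
    have h12 : OP ((f.trans h) ∘ f) := OP.comp hg1.1 hf.1 f.continuous
    have h13 : OP (f.symm ∘ ((f.trans h) ∘ f)) := OP.comp hf.1.symm h12
      ((f.trans h).continuous.comp f.continuous)
    refine ⟨h13, fun y hy => ?_⟩
    rw [hg2a, Homeomorph.symm_apply_eq] at hy
    exact hg1.2 (f y) hy
  have hfree2 : ∀ y ∈ segment ℝ x z, g2 y ∉ segment ℝ x z := by
    intro y hy
    have : g2 y = f y := by
      rw [hg2a, h3 (f (f y)) (fun h' => h'.2 (Or.inr ⟨y, hy, rfl⟩)), Homeomorph.symm_apply_apply]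
    rw [this]
    exact freeA y hy
  obtain ⟨m, rfl⟩ : ∃ m, n = m + 2 := ⟨n - 2, by omega⟩
  have hit : g2^[m] x = f^[m] x := by
    apply iter_agree
    intro i hi
    rw [hg2a, ← Function.iterate_succ_apply' f, ← Function.iterate_succ_apply' f, h3,
      Function.iterate_succ_apply' f, Homeomorph.symm_apply_apply]
    rintro ⟨-, h'⟩
    exact h' (Or.inl ⟨i + 2, ⟨by omega, by omega⟩, rfl⟩)
  have hlast : g2^[m+1] x = z := by
    rw [Function.iterate_succ_apply', hit, hg2a, ← Function.iterate_succ_apply' f,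
      ← Function.iterate_succ_apply' f, hx, h2, Homeomorph.symm_apply_apply]
  refine star g2 hg2 _ (isCompact_segment' x z) (isPreconnected_segment' x z) hfree2 (m+1)
    (by omega) (by omega) x (left_mem_segment _ _ _) ?_
  rw [hlast]
  exact right_mem_segment _ _ _

/-- Brouwer: a bounded orbit of an orientation preserving plane homeomorphism forces a
fixed point. -/
theorem brouwer (f : ℂ ≃ₜ ℂ) (hf : OP f) (p : ℂ)
    (hb : IsBounded (Set.range fun k : ℕ => f^[k] p)) : ∃ x, f x = x := by
  by_contra hne
  push Not at hne
  have hF : FF f := ⟨hf, hne⟩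
  obtain ⟨c, -, φ, hφ, hlim⟩ := tendsto_subseq_of_bounded hb
    (x := fun k : ℕ => f^[k] p) (fun n => mem_range_self n)
  obtain ⟨U, hU1, hU2, hU3⟩ := exists_free_nhd (f := f) (S := {c}) isCompact_singleton
    (by rintro x rfl; exact hne x)
  obtain ⟨ρ, hρ, hρU⟩ := Metric.isOpen_iff.1 hU1 c (hU2 rfl)
  obtain ⟨N, hN⟩ := eventually_atTop.1 (hlim.eventually_mem (Metric.ball_mem_nhds c hρ))
  have a1 := hN N le_rfl
  have a2 := hN (N + 1) (by omega)
  have hlt := hφ (Nat.lt_succ_self N)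
  simp only [Function.comp] at a1 a2
  obtain ⟨g, hg, k, hk1, -, x, hx⟩ := hF.star (S := Metric.ball c ρ) (U := U)
    (convex_ball c ρ).isPreconnected hU1 hρU hU3 (j := φ (N+1) - φ N) (by
      simp only [Nat.succ_eq_add_one] at hlt; omega)
    ⟨f^[φ N] p, a1, by
      rw [← Function.iterate_add_apply, Nat.sub_add_cancel hlt.le]; exact a2⟩
  exact FF.no_periodic k hk1 g hg x hx

end PlaneBrouwer


namespace Massera

/-- Abstract periodic process with a two-dimensional quadratic cone structure. -/
structure Sys (H : Type*) [NormedAddCommGroup H] [InnerProductSpace ℝ H] where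
  σ : ℝ
  ν : ℝ
  δ : ℝ
  K : ℝ
  c : ℝ
  U : ℝ → ℝ → H → H
  P : H →L[ℝ] H
  pr : H →L[ℝ] ℂ
  inc : ℂ →L[ℝ] H
  σ_pos : 0 < σ
  ν_pos : 0 < ν
  δ_pos : 0 < δ
  K_pos : 0 < K
  c_pos : 0 < c
  pr_inc : ∀ z, pr (inc z) = z
  V_inc : ∀ z, ⟪P (inc z), inc z⟫ ≤ -c * ‖z‖ ^ 2
  V_ge : ∀ d, -K * ‖pr d‖ ^ 2 ≤ ⟪P d, d⟫
  V_le : ∀ d, ⟪P d, d⟫ ≤ K * ‖d‖ ^ 2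
  U_self : ∀ s x, U s s x = x
  U_comp : ∀ s r t x, s ≤ r → r ≤ t → U t r (U r s x) = U t s x
  U_per : ∀ s t x, s ≤ t → U (t + σ) (s + σ) x = U t s x
  U_cont : ∀ s, ContinuousOn (fun p : ℝ × H => U p.1 s p.2) {p : ℝ × H | s ≤ p.1}
  mono : ∀ s l r x y, s ≤ l → l ≤ r →
    Real.exp (2 * ν * r) * ⟪P (U r s x - U r s y), U r s x - U r s y⟫
      + δ * (∫ t in l..r, Real.exp (2 * ν * t) * ‖U t s x - U t s y‖ ^ 2)
      ≤ Real.exp (2 * ν * l) * ⟪P (U l s x - U l s y), U l s x - U l s y⟫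
  com : IsCompactOperator (⇑P) ∨
    ∃ tc : ℝ, 0 < tc ∧ ∀ (s : ℝ) (B : Set H), IsBounded B → IsCompact (closure (U (s + tc) s '' B))

variable {H : Type*} [NormedAddCommGroup H] [InnerProductSpace ℝ H]

namespace Sys
variable (S : Sys H)

/-- Trajectory starting at time `τ`. -/
def Traj (τ : ℝ) (w : ℝ → H) : Prop := ∀ s t, τ ≤ s → s ≤ t → w t = S.U t s (w s)

/-- Complete trajectory. -/
def CTraj (w : ℝ → H) : Prop := ∀ s t, s ≤ t → w t = S.U t s (w s)

/-- Amenability. -/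
def Amen (w : ℝ → H) : Prop :=
  IntegrableOn (fun s : ℝ => Real.exp (2 * S.ν * s) * ‖w s‖ ^ 2) (Set.Iic (0:ℝ))

/-- The quadratic form. -/
def V (d : H) : ℝ := ⟪S.P d, d⟫

variable {S}

lemma CTraj.traj {w : ℝ → H} (h : S.CTraj w) (τ : ℝ) : S.Traj τ w := fun s t _ hst => h s t hst

lemma Traj.mono {w : ℝ → H} {τ τ' : ℝ} (h : S.Traj τ w) (hτ : τ ≤ τ') : S.Traj τ' w :=
  fun s t hs hst => h s t (hτ.trans hs) hst

lemma traj_orbit (S : Sys H) (τ : ℝ) (x : H) : S.Traj τ (fun t => S.U t τ x) :=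
  fun s t hs hst => (S.U_comp τ s t x hs hst).symm

lemma cont_fixed (S : Sys H) {s t : ℝ} (h : s ≤ t) : Continuous (S.U t s) := by
  have := (S.U_cont s).comp_continuous (f := fun x : H => (t, x)) (by fun_prop) (fun x => h)
  exact this

lemma Traj.continuousOn {w : ℝ → H} {τ : ℝ} (h : S.Traj τ w) : ContinuousOn w (Ici τ) := by
  have h1 : ContinuousOn (fun t => S.U t τ (w τ)) (Ici τ) :=
    (S.U_cont τ).comp (f := fun t : ℝ => (t, w τ)) (by fun_prop) (fun t ht => ht)
  exact h1.congr fun t ht => h τ t le_rfl ht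

lemma CTraj.continuous {w : ℝ → H} (h : S.CTraj w) : Continuous w := by
  rw [continuous_iff_continuousAt]
  intro t
  exact ((h.traj (t - 1)).continuousOn).continuousAt (Ici_mem_nhds (by linarith))

lemma Traj.ineq {w v : ℝ → H} {τ : ℝ} (hw : S.Traj τ w) (hv : S.Traj τ v) {l r : ℝ}
    (hl : τ ≤ l) (hr : l ≤ r) :
    Real.exp (2 * S.ν * r) * S.V (w r - v r)
      + S.δ * (∫ t in l..r, Real.exp (2 * S.ν * t) * ‖w t - v t‖ ^ 2)
      ≤ Real.exp (2 * S.ν * l) * S.V (w l - v l) := by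
  have := S.mono l l r (w l) (v l) le_rfl hr
  have e : (∫ t in l..r, Real.exp (2 * S.ν * t) * ‖w t - v t‖ ^ 2)
      = ∫ t in l..r, Real.exp (2 * S.ν * t) * ‖S.U t l (w l) - S.U t l (v l)‖ ^ 2 := by
    apply intervalIntegral.integral_congr
    intro t ht
    rw [uIcc_of_le hr] at ht
    simp only [← hw l t hl ht.1, ← hv l t hl ht.1]
  rw [← hw l r hl hr, ← hv l r hl hr, ← hw l l hl le_rfl, ← hv l l hl le_rfl] at this
  rw [e]
  exact this

lemma V_ge_norm (S : Sys H) (d : H) : -S.K * ‖S.pr d‖ ^ 2 ≤ S.V d := S.V_ge d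

lemma Traj.intvl {w v : ℝ → H} {τ : ℝ} (hw : S.Traj τ w) (hv : S.Traj τ v) {l r : ℝ}
    (hl : τ ≤ l) (hr : l ≤ r) :
    IntervalIntegrable (fun t => Real.exp (2 * S.ν * t) * ‖w t - v t‖ ^ 2) volume l r := by
  apply ContinuousOn.intervalIntegrable
  rw [uIcc_of_le hr]
  have h1 := hw.continuousOn.mono (fun t (ht : t ∈ Icc l r) => hl.trans ht.1)
  have h2 := hv.continuousOn.mono (fun t (ht : t ∈ Icc l r) => hl.trans ht.1)
  exact (Continuous.continuousOn (by fun_prop)).mul ((h1.sub h2).norm.pow 2)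

lemma int_nonneg (w : ℝ → H) (a : ℝ) {l r : ℝ} (hr : l ≤ r) :
    0 ≤ ∫ t in l..r, Real.exp (2 * a * t) * ‖w t‖ ^ 2 :=
  intervalIntegral.integral_nonneg hr fun t _ => by positivity

lemma Amen.sub {w v : ℝ → H} (hw : S.CTraj w) (hv : S.CTraj v) (aw : S.Amen w) (av : S.Amen v) :
    S.Amen (fun t => w t - v t) := by
  have cw := hw.continuous
  have cv := hv.continuous
  refine Integrable.mono' ((aw.const_mul 2).add (av.const_mul 2))
    (Continuous.aestronglyMeasurable (by fun_prop)) (Eventually.of_forall fun t => ?_)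
  rw [Real.norm_of_nonneg (by positivity)]
  have h : ‖w t - v t‖ ^ 2 ≤ 2 * ‖w t‖ ^ 2 + 2 * ‖v t‖ ^ 2 := by
    have h1 := norm_sub_le (w t) (v t)
    have h2 : ‖w t - v t‖ ^ 2 ≤ (‖w t‖ + ‖v t‖) ^ 2 := by gcongr
    nlinarith [sq_nonneg (‖w t‖ - ‖v t‖)]
  have h3 := Real.exp_pos (2 * S.ν * t)
  simp only [Pi.add_apply]
  nlinarith [mul_le_mul_of_nonneg_left h h3.le]

lemma Amen.small {d : ℝ → H} (a : S.Amen d) (l : ℝ) {ε : ℝ} (hε : 0 < ε) :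
    ∃ l' ≤ l, Real.exp (2 * S.ν * l') * ‖d l'‖ ^ 2 < ε := by
  by_contra! hcon
  have h1 : IntegrableOn (fun s : ℝ => Real.exp (2 * S.ν * s) * ‖d s‖ ^ 2) (Iic (min l 0)) :=
    a.mono_set (Iic_subset_Iic.2 (min_le_right _ _))
  have h2 : IntegrableOn (fun _ : ℝ => ε) (Iic (min l 0)) := by
    refine Integrable.mono' h1 aestronglyMeasurable_const ?_
    refine (ae_restrict_iff' measurableSet_Iic).2 (Eventually.of_forall fun t ht => ?_)
    rw [Real.norm_of_nonneg hε.le]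
    exact hcon t (ht.trans (min_le_left _ _))
  rw [integrableOn_const_iff] at h2
  rcases h2 with h2 | h2
  · exact hε.ne' (enorm_eq_zero.1 h2)
  · simp at h2

lemma D2 {w v : ℝ → H} (hw : S.CTraj w) (hv : S.CTraj v) (aw : S.Amen w) (av : S.Amen v)
    {l t : ℝ} (hl : l ≤ t) :
    Real.exp (2 * S.ν * t) * S.V (w t - v t)
      + S.δ * (∫ s in l..t, Real.exp (2 * S.ν * s) * ‖w s - v s‖ ^ 2) ≤ 0 := by
  apply le_of_forall_pos_le_add
  intro ε hε
  obtain ⟨l', hl', h⟩ := (aw.sub hw hv av).small l (div_pos hε S.K_pos)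
  have h1 := Traj.ineq (hw.traj l') (hv.traj l') le_rfl (hl'.trans hl)
  have h2 : Real.exp (2 * S.ν * l') * S.V (w l' - v l') ≤ ε := by
    have := S.V_le (w l' - v l')
    have h3 := Real.exp_pos (2 * S.ν * l')
    have h4 : Real.exp (2 * S.ν * l') * S.V (w l' - v l') ≤
      Real.exp (2 * S.ν * l') * (S.K * ‖w l' - v l'‖ ^ 2) := mul_le_mul_of_nonneg_left this h3.le
    rw [lt_div_iff₀ S.K_pos] at h
    nlinarith
  have h3 := intervalIntegral.integral_add_adjacent_intervals
    (Traj.intvl (hw.traj l') (hv.traj l') le_rfl hl')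
    (Traj.intvl (hw.traj l') (hv.traj l') hl' hl)
  have h4 := int_nonneg (fun t => w t - v t) S.ν hl'
  have := S.δ_pos
  rw [← h3] at h1
  nlinarith [mul_nonneg this.le h4]

/-- A trajectory difference with zero L2 integral vanishes. -/
lemma eq_of_int_zero {d : ℝ → H} (hd : Continuous d) {l r : ℝ} (hr : l < r)
    (h : (∫ s in l..r, Real.exp (2 * S.ν * s) * ‖d s‖ ^ 2) ≤ 0) : ∀ t ∈ Icc l r, d t = 0 := by
  intro t ht
  by_contra hne
  have : 0 < ∫ s in l..r, Real.exp (2 * S.ν * s) * ‖d s‖ ^ 2 := by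
    refine intervalIntegral.integral_pos hr (by fun_prop) (fun x _ => by positivity) ⟨t, ht, ?_⟩
    have := norm_pos_iff.2 hne
    positivity
  linarith

lemma amen_eq {w v : ℝ → H} (hw : S.CTraj w) (hv : S.CTraj v) (aw : S.Amen w) (av : S.Amen v)
    {t : ℝ} (h : S.pr (w t) = S.pr (v t)) : w = v := by
  have key : ∀ l, l ≤ t → w l = v l := by
    intro l hl
    have h1 := D2 hw hv aw av (l := l - 1) (t := t) (by linarith)
    have h2 := S.V_ge_norm (w t - v t)
    rw [map_sub, h, sub_self, norm_zero] at h2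
    have h3 : 0 ≤ Real.exp (2 * S.ν * t) * S.V (w t - v t) :=
      mul_nonneg (Real.exp_pos _).le (by nlinarith)
    have h4 : S.δ * (∫ s in (l-1)..t, Real.exp (2 * S.ν * s) * ‖w s - v s‖ ^ 2) ≤ 0 := by linarith
    have h5 := nonpos_of_mul_nonpos_right h4 S.δ_pos
    exact sub_eq_zero.1 (eq_of_int_zero (S := S) (hw.continuous.sub hv.continuous)
      (by linarith) h5 l ⟨by linarith, hl⟩)
  funext s
  rcases le_total s t with hs | hs
  · exact key s hs
  · rw [hw t s hs, hv t s hs, key t le_rfl]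

lemma D2_int {w v : ℝ → H} (hw : S.CTraj w) (hv : S.CTraj v) (aw : S.Amen w) (av : S.Amen v)
    {l : ℝ} (hl : l ≤ 0) :
    S.δ * (∫ s in l..0, Real.exp (2 * S.ν * s) * ‖w s - v s‖ ^ 2)
      ≤ S.K * ‖S.pr (w 0) - S.pr (v 0)‖ ^ 2 := by
  have h1 := D2 hw hv aw av hl
  have h2 := S.V_ge_norm (w 0 - v 0)
  rw [map_sub] at h2
  simp only [mul_zero, Real.exp_zero, one_mul] at h1
  linarith

end Sys
end Massera


namespace Massera
variable {H : Type*} [NormedAddCommGroup H] [InnerProductSpace ℝ H]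
namespace Sys

/-- A sequence of trajectories with initial times going to `-∞` and uniform bounds. -/
structure BddSeq (S : Sys H) (τ : ℕ → ℝ) (w : ℕ → ℝ → H) (M : ℝ) : Prop where
  traj : ∀ n, S.Traj (τ n) (w n)
  neg : ∀ n, τ n ≤ 0
  lim : Tendsto τ atTop atBot
  int : ∀ n, (∫ s in (τ n)..0, Real.exp (2 * S.ν * s) * ‖w n s‖ ^ 2) ≤ M
  bd : ∀ n, ‖S.pr (w n 0)‖ ≤ M

variable {S : Sys H} {τ : ℕ → ℝ} {w : ℕ → ℝ → H} {M : ℝ}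

lemma BddSeq.subseq (h : S.BddSeq τ w M) {φ : ℕ → ℕ} (hφ : StrictMono φ) :
    S.BddSeq (τ ∘ φ) (w ∘ φ) M :=
  ⟨fun _ => h.traj _, fun _ => h.neg _, h.lim.comp hφ.tendsto_atTop, fun _ => h.int _,
    fun _ => h.bd _⟩

lemma Traj.cont_wt {w : ℝ → H} {τ : ℝ} (h : S.Traj τ w) {r : ℝ} :
    ContinuousOn (fun s => Real.exp (2 * S.ν * s) * ‖w s‖ ^ 2) (Icc τ r) :=
  (Continuous.continuousOn (by fun_prop)).mul
    ((h.continuousOn.mono (fun _ ht => ht.1)).norm.pow 2)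

/-- Fatou functions. -/
noncomputable def fat (S : Sys H) (τ : ℕ → ℝ) (w : ℕ → ℝ → H) (n : ℕ) : ℝ → ENNReal :=
  (Icc (τ n) 0).indicator fun s => ENNReal.ofReal (Real.exp (2 * S.ν * s) * ‖w n s‖ ^ 2)

lemma BddSeq.fat_meas (h : S.BddSeq τ w M) (n : ℕ) : AEMeasurable (S.fat τ w n) volume := by
  unfold fat
  rw [aemeasurable_indicator_iff measurableSet_Icc]
  exact ((h.traj n).cont_wt.aemeasurable measurableSet_Icc).ennreal_ofReal

lemma BddSeq.fat_int (h : S.BddSeq τ w M) (n : ℕ) :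
    ∫⁻ t, S.fat τ w n t ≤ ENNReal.ofReal M := by
  unfold fat
  rw [lintegral_indicator measurableSet_Icc, ← ofReal_integral_eq_lintegral_ofReal]
  · apply ENNReal.ofReal_le_ofReal
    rw [integral_Icc_eq_integral_Ioc, ← intervalIntegral.integral_of_le (h.neg n)]
    exact h.int n
  · exact (h.traj n).cont_wt.integrableOn_Icc
  · exact Eventually.of_forall fun t => by positivity

lemma BddSeq.liminf_int (h : S.BddSeq τ w M) :
    ∫⁻ t, liminf (fun n => S.fat τ w n t) atTop ≤ ENNReal.ofReal M := by
  refine (lintegral_liminf_le' h.fat_meas).trans ?_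
  refine (liminf_le_liminf (v := fun _ => ENNReal.ofReal M)
    (Eventually.of_forall fun n => h.fat_int n)).trans ?_
  simp

lemma BddSeq.pick (h : S.BddSeq τ w M) {a b : ℝ} (hab : a < b) (hb : b ≤ 0) :
    ∃ s ∈ Ioo a b, ∃ R : ℝ, ∃ φ : ℕ → ℕ, StrictMono φ ∧
      ∀ n, τ (φ n) ≤ a ∧ ‖w (φ n) s‖ ≤ R := by
  have h1 : ∀ᵐ t : ℝ, liminf (fun n => S.fat τ w n t) atTop < ⊤ :=
    ae_lt_top' (by
      simp only [liminf_eq_iSup_iInf_of_nat]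
      exact AEMeasurable.iSup fun n => AEMeasurable.iInf fun i => AEMeasurable.iInf fun _ => h.fat_meas i)
      (h.liminf_int.trans_lt ENNReal.ofReal_lt_top).ne
  obtain ⟨s, hs, hlim⟩ : ∃ s ∈ Ioo a b, liminf (fun n => S.fat τ w n s) atTop < ⊤ := by
    by_contra! hcon
    have : volume (Ioo a b) = 0 := measure_mono_null (fun t ht => by simpa using hcon t ht) h1
    rw [Real.volume_Ioo] at this
    simp at this
    linarith
  obtain ⟨R, hR1, hR2⟩ := exists_between hlim
  have h2 := (frequently_lt_of_liminf_lt (by isBoundedDefault) hR1).and_eventually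
    (h.lim.eventually_le_atBot a)
  obtain ⟨φ, hφ, hh⟩ := extraction_of_frequently_atTop h2
  refine ⟨s, hs, √(R.toReal / Real.exp (2 * S.ν * s)), φ, hφ, fun n => ⟨(hh n).2, ?_⟩⟩
  obtain ⟨h3, h4⟩ := hh n
  unfold fat at h3
  rw [indicator_of_mem (show s ∈ Icc (τ (φ n)) 0 from ⟨h4.trans hs.1.le, hs.2.le.trans hb⟩)] at h3
  rw [ENNReal.ofReal_lt_iff_lt_toReal (by positivity) hR2.ne] at h3
  apply Real.le_sqrt_of_sq_le
  rw [le_div_iff₀ (Real.exp_pos _)]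
  linarith

/-- Propagating convergence forward. -/
lemma BddSeq.fwd (h : S.BddSeq τ w M) {s T : ℝ} (hst : s ≤ T) {y : H}
    (hy : Tendsto (fun n => w n s) atTop (𝓝 y)) :
    Tendsto (fun n => w n T) atTop (𝓝 (S.U T s y)) := by
  have h1 := ((S.cont_fixed hst).tendsto y).comp hy
  refine h1.congr' ?_
  filter_upwards [h.lim.eventually_le_atBot s] with n hn
  exact (h.traj n s T hn hst).symm

lemma BddSeq.conv_com2 (h : S.BddSeq τ w M)
    (hc : ∃ tc : ℝ, 0 < tc ∧ ∀ (s : ℝ) (B : Set H), IsBounded B →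
      IsCompact (closure (S.U (s + tc) s '' B))) {T : ℝ} (hT : T ≤ 0) :
    ∃ φ : ℕ → ℕ, StrictMono φ ∧ ∃ y, Tendsto (fun n => w (φ n) T) atTop (𝓝 y) := by
  obtain ⟨tc, htc, hc⟩ := hc
  obtain ⟨s, hs, R, φ, hφ, hh⟩ := h.pick (a := T - tc - 1) (b := T - tc) (by linarith)
    (by linarith)
  obtain ⟨y, -, χ, hχ, hy⟩ := (hc s _ (Metric.isBounded_closedBall (x := (0:H)) (r := R))).tendsto_subseq
    (x := fun n => w (φ n) (s + tc)) (fun n => subset_closure ⟨w (φ n) s, by simpa using (hh n).2,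
      (h.traj (φ n) s (s + tc) ((hh n).1.trans hs.1.le) (by linarith)).symm⟩)
  refine ⟨φ ∘ χ, hφ.comp hχ, _, (h.subseq (hφ.comp hχ)).fwd (s := s + tc) ?_ hy⟩
  linarith [hs.2]

lemma BddSeq.conv_com1 [CompleteSpace H] (h : S.BddSeq τ w M)
    (hc : IsCompactOperator (⇑S.P)) {T : ℝ} (hT : T ≤ 0) :
    ∃ φ : ℕ → ℕ, StrictMono φ ∧ ∃ y, Tendsto (fun n => w (φ n) T) atTop (𝓝 y) := by
  obtain ⟨s, hs, R, φ, hφ, hh⟩ := h.pick (a := T - 1) (b := T) (by linarith) hT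
  have hR0 : 0 ≤ R := (norm_nonneg _).trans (hh 0).2
  have hcc : IsCompact (closure (S.P '' Metric.closedBall 0 R)) :=
    IsCompactOperator.isCompact_closure_image_closedBall (f := (S.P : H →ₗ[ℝ] H)) hc R
  obtain ⟨⟨y, z⟩, -, χ, hχ, hyz⟩ := (hcc.prod (isCompact_closedBall (0:ℂ) M)).tendsto_subseq
    (x := fun n => (S.P (w (φ n) s), S.pr (w (φ n) 0)))
    (fun n => ⟨subset_closure ⟨w (φ n) s, by simpa using (hh n).2, rfl⟩,
      by simpa using h.bd (φ n)⟩)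
  have hV : ∀ k : ℕ, {p : (H × ℂ) × (H × ℂ) | dist p.1 p.2 < (1/8 : ℝ) ^ k} ∈
      uniformity (H × ℂ) := fun k => Metric.dist_mem_uniformity (by positivity)
  obtain ⟨κ, hκ, hκ2⟩ := hyz.cauchySeq.subseq_mem hV
  set θ : ℕ → ℕ := fun n => φ (χ (κ n)) with hθ
  have hθm : StrictMono θ := hφ.comp (hχ.comp hκ)
  have ht : ∀ n, S.Traj s (w (θ n)) := fun n => (h.traj _).mono ((hh _).1.trans hs.1.le)
  have hRn : ∀ n, ‖w (θ n) s‖ ≤ R := fun n => (hh _).2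
  have hs0 : s ≤ 0 := hs.2.le.trans hT
  have hP : ∀ k, ‖S.P (w (θ (k+1)) s - w (θ k) s)‖ ≤ (1/8 : ℝ) ^ k ∧
      ‖S.pr (w (θ (k+1)) 0 - w (θ k) 0)‖ ≤ (1/8 : ℝ) ^ k := by
    intro k
    have := hκ2 k
    simp only [mem_ofPred_eq, Function.comp, Prod.dist_eq, max_lt_iff] at this
    rw [dist_eq_norm, dist_eq_norm, ← map_sub, ← map_sub] at this
    exact ⟨this.1.le, this.2.le⟩
  -- the integral bound
  set C : ℝ := (Real.exp (2 * S.ν * s) * (2 * R) + S.K) / S.δ with hC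
  have hI : ∀ k, (∫ t in s..0, Real.exp (2 * S.ν * t) * ‖w (θ (k+1)) t - w (θ k) t‖ ^ 2)
      ≤ C * (1/8 : ℝ) ^ k := by
    intro k
    have h1 := Traj.ineq (ht (k+1)) (ht k) le_rfl hs0
    have h2 := S.V_ge_norm (w (θ (k+1)) 0 - w (θ k) 0)
    have h3 : S.V (w (θ (k+1)) s - w (θ k) s) ≤ (1/8 : ℝ) ^ k * (2 * R) := by
      refine (real_inner_le_norm _ _).trans ?_
      have : ‖w (θ (k+1)) s - w (θ k) s‖ ≤ 2 * R :=
        (norm_sub_le _ _).trans (by linarith [hRn (k+1), hRn k])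
      exact mul_le_mul (hP k).1 this (norm_nonneg _) (by positivity)
    have h4 : ‖S.pr (w (θ (k+1)) 0 - w (θ k) 0)‖ ^ 2 ≤ (1/8 : ℝ) ^ k := by
      have h5 : (1/8 : ℝ) ^ k ≤ 1 := pow_le_one₀ (by norm_num) (by norm_num)
      have h6 := (hP k).2
      nlinarith [norm_nonneg (S.pr (w (θ (k+1)) 0 - w (θ k) 0))]
    simp only [mul_zero, Real.exp_zero, one_mul] at h1
    rw [hC, div_mul_eq_mul_div, le_div_iff₀ S.δ_pos]
    have h7 := mul_le_mul_of_nonneg_left h3 (Real.exp_pos (2 * S.ν * s)).le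
    have h8 := mul_le_mul_of_nonneg_left h4 S.K_pos.le
    linarith
  -- a.e. convergence
  set g : ℕ → ℝ → ENNReal := fun k t => ENNReal.ofReal ((4:ℝ) ^ k *
    (Real.exp (2 * S.ν * t) * ‖w (θ (k+1)) t - w (θ k) t‖ ^ 2)) with hg
  have hgi : ∀ k, IntegrableOn (fun t => (4:ℝ) ^ k *
    (Real.exp (2 * S.ν * t) * ‖w (θ (k+1)) t - w (θ k) t‖ ^ 2)) (Ioc s 0) := fun k =>
    ((intervalIntegrable_iff_integrableOn_Ioc_of_le hs0).1
      (Traj.intvl (ht (k+1)) (ht k) le_rfl hs0)).const_mul _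
  have hgm : ∀ k, AEMeasurable (g k) (volume.restrict (Ioc s 0)) := fun k =>
    (hgi k).aemeasurable.ennreal_ofReal
  have hgint : ∀ k, ∫⁻ t in Ioc s 0, g k t ≤ ENNReal.ofReal (C * (1/2 : ℝ) ^ k) := by
    intro k
    rw [hg, ← ofReal_integral_eq_lintegral_ofReal (hgi k)
      (Eventually.of_forall fun t => by positivity)]
    apply ENNReal.ofReal_le_ofReal
    rw [← intervalIntegral.integral_of_le hs0, intervalIntegral.integral_const_mul]
    calc _ ≤ (4:ℝ) ^ k * (C * (1/8 : ℝ) ^ k) := mul_le_mul_of_nonneg_left (hI k) (by positivity)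
      _ = C * ((4:ℝ) * (1/8)) ^ k := by rw [mul_pow]; ring
      _ = _ := by norm_num
  have hC0 : 0 ≤ C := by
    have := S.K_pos
    have := S.δ_pos
    positivity
  have hsum : ∫⁻ t in Ioc s 0, ∑' k, g k t ≠ ⊤ := by
    rw [lintegral_tsum hgm]
    refine ((ENNReal.tsum_le_tsum hgint).trans_lt ?_).ne
    rw [← ENNReal.ofReal_tsum_of_nonneg (fun k => by positivity)
      ((summable_geometric_of_lt_one (by norm_num) (by norm_num)).mul_left C)]
    exact ENNReal.ofReal_lt_top
  have hae := ae_lt_top' (AEMeasurable.ennreal_tsum hgm) hsum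
  obtain ⟨t, htm, htt⟩ : ∃ t ∈ Ioo s T, ∑' k, g k t < ⊤ := by
    by_contra! hcon
    rw [ae_restrict_iff' measurableSet_Ioc] at hae
    have : volume (Ioo s T) = 0 := measure_mono_null (fun t ht => by
      simp only [mem_compl_iff, mem_ofPred_eq, not_forall]
      exact ⟨⟨ht.1, ht.2.le.trans hT⟩, not_lt.2 (hcon t ht)⟩) hae
    rw [Real.volume_Ioo] at this
    simp at this
    linarith [hs.2]
  set B := (∑' k, g k t).toReal with hB
  have hterm : ∀ k, (4:ℝ) ^ k * (Real.exp (2 * S.ν * t) * ‖w (θ (k+1)) t - w (θ k) t‖ ^ 2)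
      ≤ B := by
    intro k
    have := ENNReal.le_tsum (f := fun k => g k t) k
    have h2 := ENNReal.toReal_mono htt.ne this
    rwa [hg, ENNReal.toReal_ofReal (by positivity)] at h2
  have hcs : CauchySeq (fun n => w (θ n) t) := by
    apply cauchySeq_of_le_geometric (1/2) (√(B / Real.exp (2 * S.ν * t))) (by norm_num)
    intro k
    rw [dist_comm, dist_eq_norm]
    have e : √(B / Real.exp (2 * S.ν * t)) * (1 / 2) ^ k
        = √(B / Real.exp (2 * S.ν * t) * ((1/4) ^ k)) := by
      have hB0 : 0 ≤ B := ENNReal.toReal_nonneg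
      rw [Real.sqrt_mul (by positivity)]
      congr 1
      rw [show (1/4 : ℝ) ^ k = ((1/2) ^ k) ^ 2 by rw [← pow_mul, mul_comm, pow_mul]; norm_num,
        Real.sqrt_sq (by positivity)]
    rw [e]
    apply Real.le_sqrt_of_sq_le
    rw [div_mul_eq_mul_div, le_div_iff₀ (Real.exp_pos _), one_div, inv_pow, ← div_eq_mul_inv,
      le_div_iff₀ (by positivity)]
    linarith [hterm k]
  obtain ⟨y', hy'⟩ := cauchySeq_tendsto_of_complete hcs
  exact ⟨θ, hθm, _, (h.subseq hθm).fwd htm.2.le hy'⟩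

lemma BddSeq.conv1 [CompleteSpace H] (h : S.BddSeq τ w M) {T : ℝ} (hT : T ≤ 0) :
    ∃ φ : ℕ → ℕ, StrictMono φ ∧ ∃ y, Tendsto (fun n => w (φ n) T) atTop (𝓝 y) :=
  S.com.elim (fun hc => h.conv_com1 hc hT) (fun hc => h.conv_com2 hc hT)

/-- Diagonal extraction. -/
lemma diag {X : Type*} [TopologicalSpace X] (x : ℕ → ℕ → X)
    (h : ∀ k, ∀ φ : ℕ → ℕ, StrictMono φ → ∃ χ : ℕ → ℕ, StrictMono χ ∧
      ∃ y, Tendsto (fun n => x k (φ (χ n))) atTop (𝓝 y)) :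
    ∃ φ : ℕ → ℕ, StrictMono φ ∧ ∀ k, ∃ y, Tendsto (fun n => x k (φ n)) atTop (𝓝 y) := by
  choose! χ hχ y hy using h
  let Φ : ℕ → ℕ → ℕ := fun k => Nat.rec id (fun k f => f ∘ χ k f) k
  have hs : ∀ k, Φ (k+1) = Φ k ∘ χ k (Φ k) := fun k => rfl
  have hm : ∀ k, StrictMono (Φ k) := by
    intro k
    induction k with
    | zero => exact strictMono_id
    | succ k ih => rw [hs]; exact ih.comp (hχ k _ ih)
  have hfac : ∀ k j, ∃ ρ : ℕ → ℕ, StrictMono ρ ∧ Φ (k + j) = Φ k ∘ ρ := by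
    intro k j
    induction j with
    | zero => exact ⟨id, strictMono_id, rfl⟩
    | succ j ih =>
      obtain ⟨ρ, h1, h2⟩ := ih
      refine ⟨ρ ∘ χ (k + j) (Φ (k + j)), h1.comp (hχ _ _ (hm _)), ?_⟩
      rw [← add_assoc, hs, ← Function.comp_assoc, ← h2]
  refine ⟨fun n => Φ n n, ?_, ?_⟩
  · apply strictMono_nat_of_lt_succ
    intro n
    rw [hs]
    exact hm n (lt_of_lt_of_le (Nat.lt_succ_self n) ((hχ n _ (hm n)).id_le (n+1)))
  · intro k
    refine ⟨y k (Φ k) (hm k), ?_⟩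
    have h1 : Tendsto (fun n => x k (Φ (k+1) n)) atTop (𝓝 (y k (Φ k) (hm k))) := hy k _ (hm k)
    have h2 : ∀ n, ∃ m, n ≤ m ∧ (k + 1 ≤ n → Φ n n = Φ (k+1) m) := by
      intro n
      by_cases hn : k + 1 ≤ n
      · obtain ⟨j, rfl⟩ := Nat.exists_eq_add_of_le hn
        obtain ⟨ρ, h3, h4⟩ := hfac (k+1) j
        exact ⟨ρ (k+1+j), h3.id_le _, fun _ => by rw [h4]; rfl⟩
      · exact ⟨n, le_rfl, fun h => absurd h hn⟩
    choose m hm1 hm2 using h2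
    refine (h1.comp (tendsto_atTop_mono hm1 tendsto_id)).congr' ?_
    filter_upwards [eventually_ge_atTop (k+1)] with n hn
    simp only [Function.comp, hm2 n hn]

/-- Compactness lemma. -/
lemma BddSeq.limit [CompleteSpace H] (h : S.BddSeq τ w M) :
    ∃ φ : ℕ → ℕ, StrictMono φ ∧ ∃ v : ℝ → H, S.CTraj v ∧ S.Amen v ∧
      ∀ t, Tendsto (fun n => w (φ n) t) atTop (𝓝 (v t)) := by
  obtain ⟨φ, hφ, hy⟩ := diag (fun k n => w n (-(k:ℝ))) (fun k φ hφ => by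
    obtain ⟨χ, hχ, hy⟩ := (h.subseq hφ).conv1 (T := -(k:ℝ)) (by simp)
    exact ⟨χ, hχ, hy⟩)
  have h' := h.subseq hφ
  have hall : ∀ t, ∃ y, Tendsto (fun n => w (φ n) t) atTop (𝓝 y) := by
    intro t
    obtain ⟨k, hk⟩ := exists_nat_ge (-t)
    obtain ⟨y, hy⟩ := hy k
    exact ⟨_, h'.fwd (s := -(k:ℝ)) (by linarith) hy⟩
  choose v hv using hall
  have hct : S.CTraj v := fun s t hst => tendsto_nhds_unique (hv t) (h'.fwd hst (hv s))
  refine ⟨φ, hφ, v, hct, ?_, hv⟩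
  have hc := hct.continuous
  refine ⟨Continuous.aestronglyMeasurable (by fun_prop), ?_⟩
  rw [hasFiniteIntegral_iff_ofReal (Eventually.of_forall fun t => by positivity)]
  refine lt_of_le_of_lt ?_ (h'.liminf_int.trans_lt ENNReal.ofReal_lt_top)
  rw [← lintegral_indicator measurableSet_Iic]
  apply lintegral_mono
  intro t
  by_cases ht : t ∈ Iic (0:ℝ)
  · rw [indicator_of_mem ht]
    apply le_of_eq
    symm
    apply Tendsto.liminf_eq
    have h1 : Tendsto (fun n => ENNReal.ofReal (Real.exp (2 * S.ν * t) * ‖w (φ n) t‖ ^ 2)) atTop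
        (𝓝 (ENNReal.ofReal (Real.exp (2 * S.ν * t) * ‖v t‖ ^ 2))) :=
      ENNReal.tendsto_ofReal (((hv t).norm.pow 2).const_mul _)
    refine h1.congr' ?_
    filter_upwards [h'.lim.eventually_le_atBot t] with n hn
    unfold fat
    rw [indicator_of_mem (show t ∈ Icc ((τ ∘ φ) n) 0 from ⟨hn, ht⟩)]
    rfl
  · rw [indicator_of_notMem ht]
    exact bot_le

end Sys
end Massera


namespace Massera
variable {H : Type*} [NormedAddCommGroup H] [InnerProductSpace ℝ H]
namespace Sys
variable {S : Sys H}

lemma U_per_nat (S : Sys H) (n : ℕ) {s t : ℝ} (x : H) (h : s ≤ t) :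
    S.U (t + n * S.σ) (s + n * S.σ) x = S.U t s x := by
  induction n with
  | zero => simp
  | succ n ih =>
    have := S.U_per (s + n * S.σ) (t + n * S.σ) x (by linarith)
    rw [← ih, ← this]
    push_cast
    congr 1 <;> ring

lemma int_exp_le {a : ℝ} (ha : 0 < a) (A : ℝ) (hA : 0 ≤ A) (l : ℝ) :
    (∫ s in l..0, Real.exp (2 * a * s) * A) ≤ A / (2 * a) := by
  rw [intervalIntegral.integral_mul_const, intervalIntegral.integral_comp_mul_left
    (f := Real.exp) (by positivity), integral_exp]
  simp only [mul_zero, Real.exp_zero, smul_eq_mul]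
  rw [div_eq_inv_mul]
  have h1 := Real.exp_pos (2 * a * l)
  have h2 : 0 < (2 * a)⁻¹ := by positivity
  apply mul_le_mul_of_nonneg_right _ hA
  nlinarith

lemma Traj.intvl0 {w : ℝ → H} {τ : ℝ} (hw : S.Traj τ w) {r : ℝ} (hr : τ ≤ r) :
    IntervalIntegrable (fun t => Real.exp (2 * S.ν * t) * ‖w t‖ ^ 2) volume τ r := by
  apply ContinuousOn.intervalIntegrable
  rw [uIcc_of_le hr]
  exact hw.cont_wt

lemma Traj.int_sum {w v : ℝ → H} {τ : ℝ} (hw : S.Traj τ w) (hv : S.Traj τ v) (hτ : τ ≤ 0) :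
    (∫ s in τ..0, Real.exp (2 * S.ν * s) * ‖w s‖ ^ 2) ≤
      2 * (∫ s in τ..0, Real.exp (2 * S.ν * s) * ‖w s - v s‖ ^ 2)
      + 2 * (∫ s in τ..0, Real.exp (2 * S.ν * s) * ‖v s‖ ^ 2) := by
  have i1 := Traj.intvl hw hv le_rfl hτ
  have i2 := hv.intvl0 hτ
  rw [← intervalIntegral.integral_const_mul, ← intervalIntegral.integral_const_mul,
    ← intervalIntegral.integral_add (i1.const_mul 2) (i2.const_mul 2)]
  apply intervalIntegral.integral_mono_on hτ (hw.intvl0 hτ) ((i1.const_mul 2).add (i2.const_mul 2))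
  intro t _
  have h : ‖w t‖ ^ 2 ≤ 2 * ‖w t - v t‖ ^ 2 + 2 * ‖v t‖ ^ 2 := by
    have h1 := norm_add_le (w t - v t) (v t)
    rw [sub_add_cancel] at h1
    have h2 : ‖w t‖ ^ 2 ≤ (‖w t - v t‖ + ‖v t‖) ^ 2 := by gcongr
    nlinarith [sq_nonneg (‖w t - v t‖ - ‖v t‖)]
  nlinarith [mul_le_mul_of_nonneg_left h (Real.exp_pos (2 * S.ν * t)).le]

/-- Bounded semi-trajectory shifted to the past. -/
lemma past_bound {u₀ : H} {R : ℝ} (hb : ∀ t, 0 ≤ t → ‖S.U t 0 u₀‖ ≤ R) (n : ℕ) {t : ℝ}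
    (ht : -(n * S.σ) ≤ t) : ‖S.U t (-(n * S.σ)) u₀‖ ≤ R := by
  have := S.U_per_nat n u₀ ht
  rw [neg_add_cancel] at this
  rw [← this]
  exact hb _ (by linarith)

lemma past_lim (S : Sys H) : Tendsto (fun n : ℕ => -(n * S.σ)) atTop atBot :=
  tendsto_neg_atTop_atBot.comp (tendsto_natCast_atTop_atTop.atTop_mul_const S.σ_pos)

lemma past_int {u₀ : H} {R : ℝ} (hb : ∀ t, 0 ≤ t → ‖S.U t 0 u₀‖ ≤ R) (n : ℕ) :
    (∫ s in (-(n * S.σ))..0, Real.exp (2 * S.ν * s) * ‖S.U s (-(n * S.σ)) u₀‖ ^ 2)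
      ≤ R ^ 2 / (2 * S.ν) := by
  have hn : -(n * S.σ) ≤ 0 := by have := S.σ_pos; simp; positivity
  refine le_trans ?_ (int_exp_le S.ν_pos (R ^ 2) (sq_nonneg R) (-(n * S.σ)))
  apply intervalIntegral.integral_mono_on hn ((S.traj_orbit _ u₀).intvl0 hn)
    (Continuous.intervalIntegrable (by fun_prop) _ _)
  intro t ht
  have := past_bound hb n ht.1
  gcongr

lemma bounded_complete [CompleteSpace H] {u₀ : H} {R : ℝ}
    (hb : ∀ t, 0 ≤ t → ‖S.U t 0 u₀‖ ≤ R) :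
    ∃ v, S.CTraj v ∧ S.Amen v ∧ ∀ t, ‖v t‖ ≤ R := by
  have hn : ∀ n : ℕ, -(n * S.σ) ≤ 0 := fun n => by have := S.σ_pos; simp; positivity
  have B : S.BddSeq (fun n : ℕ => -(n * S.σ)) (fun n t => S.U t (-(n * S.σ)) u₀)
      (max (R ^ 2 / (2 * S.ν)) (‖S.pr‖ * R)) :=
    { traj := fun n => S.traj_orbit _ u₀
      neg := hn
      lim := S.past_lim
      int := fun n => (past_int hb n).trans (le_max_left _ _)
      bd := fun n => ((S.pr.le_opNorm _).trans (mul_le_mul_of_nonneg_left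
        (past_bound hb n (hn n)) (norm_nonneg _))).trans (le_max_right _ _) }
  obtain ⟨φ, hφ, v, hv, av, hl⟩ := B.limit
  refine ⟨v, hv, av, fun t => le_of_tendsto (hl t).norm ?_⟩
  filter_upwards [(S.past_lim.comp hφ.tendsto_atTop).eventually_le_atBot t] with n h
  exact past_bound hb (φ n) h

lemma expand (S : Sys H) (u₀ : H) {s r : ℝ} (hsr : s ≤ r) (x y : ℂ) :
    Real.exp (2 * S.ν * s) * S.c * ‖x - y‖ ^ 2 ≤ Real.exp (2 * S.ν * r) * S.K *
      ‖S.pr (S.U r s (u₀ + S.inc x)) - S.pr (S.U r s (u₀ + S.inc y))‖ ^ 2 := by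
  have h1 := S.mono s s r (u₀ + S.inc x) (u₀ + S.inc y) le_rfl hsr
  have h2 := S.V_ge (S.U r s (u₀ + S.inc x) - S.U r s (u₀ + S.inc y))
  have h3 := S.V_inc (x - y)
  have h4 := int_nonneg (fun t => S.U t s (u₀ + S.inc x) - S.U t s (u₀ + S.inc y)) S.ν hsr
  rw [S.U_self, S.U_self, add_sub_add_left_eq_sub, ← map_sub] at h1
  rw [map_sub] at h2
  have h5 := mul_le_mul_of_nonneg_left h2 (Real.exp_pos (2 * S.ν * r)).le
  have h6 := mul_le_mul_of_nonneg_left h3 (Real.exp_pos (2 * S.ν * s)).le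
  have h7 := mul_nonneg S.δ_pos.le h4
  linarith

lemma pr_surj (S : Sys H) (u₀ : H) {s r : ℝ} (hsr : s ≤ r) (a : ℂ) :
    ∃ ξ, S.pr (S.U r s (u₀ + S.inc ξ)) = a := by
  have hle : ∀ t : unitInterval, s ≤ s + t * (r - s) := fun t => by
    have := mul_nonneg t.2.1 (sub_nonneg.2 hsr)
    linarith
  have hcont : Continuous fun p : unitInterval × ℂ =>
      S.pr (S.U (s + p.1 * (r - s)) s (u₀ + S.inc p.2)) - S.pr u₀ := by
    refine Continuous.sub (S.pr.continuous.comp ?_) continuous_const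
    exact (S.U_cont s).comp_continuous
      (f := fun p : unitInterval × ℂ => ((s + p.1 * (r - s) : ℝ), u₀ + S.inc p.2))
      (by fun_prop) (fun p => hle p.1)
  let G : C(unitInterval × ℂ, ℂ) := ⟨_, hcont⟩
  have hOP := PlaneBrouwer.OP.of_isotopy G (fun t x y hxy => by
      have h1 : S.pr (S.U (s + t * (r - s)) s (u₀ + S.inc x)) - S.pr u₀
        = S.pr (S.U (s + t * (r - s)) s (u₀ + S.inc y)) - S.pr u₀ := hxy
      have h2 := S.expand u₀ (hle t) x y
      rw [sub_left_inj.1 h1, sub_self, norm_zero] at h2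
      have h3 : 0 < Real.exp (2 * S.ν * s) * S.c := mul_pos (Real.exp_pos _) S.c_pos
      have h4 : ‖x - y‖ ^ 2 ≤ 0 := by
        by_contra! hcon
        have := mul_pos h3 hcon
        linarith
      have h5 : ‖x - y‖ = 0 := by nlinarith [norm_nonneg (x - y)]
      exact sub_eq_zero.1 (norm_eq_zero.1 h5)) (fun x => by
      change S.pr (S.U (s + ((0 : unitInterval) : ℝ) * (r - s)) s (u₀ + S.inc x)) - S.pr u₀ = x
      simp [S.U_self, S.pr_inc])
  set m := Real.exp (2 * S.ν * s) * S.c with hm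
  set k := Real.exp (2 * S.ν * r) * S.K with hk
  have hm0 : 0 < m := mul_pos (Real.exp_pos _) S.c_pos
  have hk0 : 0 < k := mul_pos (Real.exp_pos _) S.K_pos
  have hs := hOP.surj (G.continuous.comp (by fun_prop)) (fun C => by
    refine ⟨(|C| + 1) * √(k / m), by positivity, fun x hx => ?_⟩
    change C < ‖(S.pr (S.U (s + ((1 : unitInterval) : ℝ) * (r - s)) s (u₀ + S.inc x)) - S.pr u₀) -
      (S.pr (S.U (s + ((1 : unitInterval) : ℝ) * (r - s)) s (u₀ + S.inc 0)) - S.pr u₀)‖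
    rw [sub_sub_sub_cancel_right, Set.Icc.coe_one, one_mul, add_sub_cancel]
    have h2 := S.expand u₀ hsr x 0
    rw [sub_zero, hx, mul_pow, Real.sq_sqrt (by positivity), ← hm, ← hk] at h2
    have h3 : m * ((|C| + 1) ^ 2 * (k / m)) = k * (|C| + 1) ^ 2 := by
      field_simp
    rw [h3] at h2
    have h4 := le_of_mul_le_mul_left h2 hk0
    have h5 := abs_le_of_sq_le_sq' h4 (norm_nonneg _)
    linarith [le_abs_self C, h5.2])
  obtain ⟨ξ, hξ⟩ := hs (a - S.pr u₀)
  refine ⟨ξ, ?_⟩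
  have : S.pr (S.U (s + ((1 : unitInterval) : ℝ) * (r - s)) s (u₀ + S.inc ξ)) - S.pr u₀
    = a - S.pr u₀ := hξ
  rw [Set.Icc.coe_one, one_mul, add_sub_cancel] at this
  exact sub_left_inj.1 this

lemma exists_amen [CompleteSpace H] {u₀ : H} {R : ℝ}
    (hb : ∀ t, 0 ≤ t → ‖S.U t 0 u₀‖ ≤ R) (a : ℂ) :
    ∃ v, S.CTraj v ∧ S.Amen v ∧ S.pr (v 0) = a := by
  have hn : ∀ n : ℕ, -(n * S.σ) ≤ 0 := fun n => by have := S.σ_pos; simp; positivity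
  choose ξ hξ using fun n : ℕ => S.pr_surj u₀ (hn n) a
  have hd : ∀ n : ℕ, (∫ s in (-(n * S.σ))..0, Real.exp (2 * S.ν * s) *
      ‖S.U s (-(n * S.σ)) (u₀ + S.inc (ξ n)) - S.U s (-(n * S.σ)) u₀‖ ^ 2)
      ≤ S.K * (‖a‖ + ‖S.pr‖ * R) ^ 2 / S.δ := by
    intro n
    rw [le_div_iff₀ S.δ_pos]
    have h1 := S.mono _ _ 0 (u₀ + S.inc (ξ n)) u₀ (le_refl (-(n * S.σ))) (hn n)
    have h2 := S.V_ge (S.U 0 (-(n * S.σ)) (u₀ + S.inc (ξ n)) - S.U 0 (-(n * S.σ)) u₀)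
    have h3 := S.V_inc (ξ n)
    rw [S.U_self, S.U_self, add_sub_cancel_left] at h1
    rw [map_sub, hξ] at h2
    have h4 : ‖a - S.pr (S.U 0 (-(n * S.σ)) u₀)‖ ^ 2 ≤ (‖a‖ + ‖S.pr‖ * R) ^ 2 := by
      gcongr
      refine (norm_sub_le _ _).trans (add_le_add le_rfl ((S.pr.le_opNorm _).trans ?_))
      exact mul_le_mul_of_nonneg_left (past_bound hb n (hn n)) (norm_nonneg _)
    have h5 := mul_le_mul_of_nonneg_left h4 S.K_pos.le
    have h6 : Real.exp (2 * S.ν * (-(n * S.σ))) * ⟪S.P (S.inc (ξ n)), S.inc (ξ n)⟫ ≤ 0 := by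
      apply mul_nonpos_of_nonneg_of_nonpos (Real.exp_pos _).le
      refine h3.trans ?_
      have := S.c_pos
      nlinarith [sq_nonneg ‖ξ n‖]
    simp only [mul_zero, Real.exp_zero, one_mul] at h1
    linarith
  have B : S.BddSeq (fun n : ℕ => -(n * S.σ))
      (fun n t => S.U t (-(n * S.σ)) (u₀ + S.inc (ξ n)))
      (max (2 * (S.K * (‖a‖ + ‖S.pr‖ * R) ^ 2 / S.δ) + 2 * (R ^ 2 / (2 * S.ν))) ‖a‖) :=
    { traj := fun n => S.traj_orbit _ _
      neg := hn
      lim := S.past_lim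
      int := fun n => by
        refine le_trans ?_ (le_max_left _ _)
        have h1 := Traj.int_sum (S.traj_orbit (-(n * S.σ)) (u₀ + S.inc (ξ n)))
          (S.traj_orbit (-(n * S.σ)) u₀) (hn n)
        linarith [hd n, past_int hb n]
      bd := fun n => by
        simp only [hξ]
        exact le_max_right _ _ }
  obtain ⟨φ, hφ, v, hv, av, hl⟩ := B.limit
  refine ⟨v, hv, av, ?_⟩
  have h1 := (S.pr.continuous.tendsto _).comp (hl 0)
  refine tendsto_nhds_unique h1 (tendsto_const_nhds.congr fun n => ?_)
  simp only [Function.comp, hξ]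

lemma amen_int_le {v : ℝ → H} (av : S.Amen v) {l : ℝ} (hl : l ≤ 0) :
    (∫ s in l..0, Real.exp (2 * S.ν * s) * ‖v s‖ ^ 2) ≤
      ∫ s in Iic (0:ℝ), Real.exp (2 * S.ν * s) * ‖v s‖ ^ 2 := by
  rw [intervalIntegral.integral_of_le hl]
  exact setIntegral_mono_set av (Eventually.of_forall fun t => by positivity)
    (Eventually.of_forall fun t ht => ht.2)

lemma W_cont [CompleteSpace H] {W : ℂ → ℝ → H} (hW : ∀ a, S.CTraj (W a)) (aW : ∀ a, S.Amen (W a))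
    (pW : ∀ a, S.pr (W a 0) = a) (t : ℝ) : Continuous fun a => W a t := by
  rw [continuous_iff_seqContinuous]
  intro x a hx
  apply tendsto_of_subseq_tendsto
  intro ns hns
  obtain ⟨χ, hχ, hχ2⟩ := strictMono_subseq_of_tendsto_atTop hns
  have hx' : Tendsto (fun n => x (ns (χ n))) atTop (𝓝 a) := hx.comp hχ2.tendsto_atTop
  obtain ⟨C, hC⟩ := (Metric.isBounded_range_of_tendsto _ hx').exists_norm_le
  have hC' : ∀ n, ‖x (ns (χ n))‖ ≤ C := fun n => hC _ ⟨n, rfl⟩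
  have B : S.BddSeq (fun n : ℕ => -(n:ℝ)) (fun n => W (x (ns (χ n))))
      (max (2 * (S.K * (C + ‖a‖) ^ 2 / S.δ) +
        2 * ∫ s in Iic (0:ℝ), Real.exp (2 * S.ν * s) * ‖W a s‖ ^ 2) C) :=
    { traj := fun n => (hW _).traj _
      neg := fun n => by simp
      lim := tendsto_neg_atTop_atBot.comp tendsto_natCast_atTop_atTop
      int := fun n => by
        refine le_trans ?_ (le_max_left _ _)
        have hn : -(n:ℝ) ≤ 0 := by simp
        have h1 := Traj.int_sum ((hW (x (ns (χ n)))).traj (-(n:ℝ))) ((hW a).traj _) hn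
        have h2 := D2_int (hW (x (ns (χ n)))) (hW a) (aW _) (aW _) hn
        rw [pW, pW] at h2
        have h3 : ‖x (ns (χ n)) - a‖ ^ 2 ≤ (C + ‖a‖) ^ 2 := by
          gcongr
          exact (norm_sub_le _ _).trans (by linarith [hC' n])
        have h4 := mul_le_mul_of_nonneg_left h3 S.K_pos.le
        have h5 : (∫ s in (-(n:ℝ))..0, Real.exp (2 * S.ν * s) * ‖W (x (ns (χ n))) s - W a s‖ ^ 2)
            ≤ S.K * (C + ‖a‖) ^ 2 / S.δ := by
          rw [le_div_iff₀ S.δ_pos]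
          linarith
        linarith [amen_int_le (aW a) hn]
      bd := fun n => by
        simp only [pW]
        exact (hC' n).trans (le_max_right _ _) }
  obtain ⟨φ, hφ, v, hv, av, hl⟩ := B.limit
  refine ⟨χ ∘ φ, ?_⟩
  have h1 : S.pr (v 0) = a := by
    have h1 := (S.pr.continuous.tendsto _).comp (hl 0)
    simp only [Function.comp_def, pW] at h1
    exact tendsto_nhds_unique h1 (hx'.comp hφ.tendsto_atTop)
  have h2 : v = W a := amen_eq hv (hW a) av (aW a) (t := 0) (by rw [h1, pW])
  rw [h2] at hl
  exact hl t

lemma Amen.shift {w : ℝ → H} (hw : Continuous w) (aw : S.Amen w) (h : ℝ) :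
    S.Amen (fun t => w (t + h)) := by
  have h1 : IntegrableOn (fun s : ℝ => Real.exp (2 * S.ν * s) * ‖w s‖ ^ 2) (Iic h) := by
    refine IntegrableOn.mono_set (IntegrableOn.union aw (t := Icc 0 h)
      (Continuous.integrableOn_Icc (by fun_prop))) ?_
    intro t ht
    rcases le_total t 0 with h0 | h0
    · exact Or.inl h0
    · exact Or.inr ⟨h0, ht⟩
  have h2 := ((measurePreserving_add_right volume h).integrableOn_comp_preimage
    (measurableEmbedding_addRight h)).2 h1
  have h3 : (fun x : ℝ => x + h) ⁻¹' Iic h = Iic 0 := by ext; simp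
  rw [h3] at h2
  unfold Amen
  refine (h2.const_mul (Real.exp (-(2 * S.ν * h)))).congr (Eventually.of_forall fun t => ?_)
  simp only [Function.comp]
  rw [← mul_assoc, ← Real.exp_add]
  congr 2
  ring

lemma CTraj.shift {w : ℝ → H} (hw : S.CTraj w) : S.CTraj (fun t => w (t + S.σ)) := by
  intro s t hst
  simp only
  rw [hw (s + S.σ) (t + S.σ) (by linarith), S.U_per s t _ hst]

lemma CTraj.shift_neg {w : ℝ → H} (hw : S.CTraj w) : S.CTraj (fun t => w (t + -S.σ)) := by
  intro s t hst
  simp only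
  rw [hw (s + -S.σ) (t + -S.σ) (by linarith), ← S.U_per (s + -S.σ) (t + -S.σ) _ (by linarith)]
  simp

theorem periodic [CompleteSpace H] {u₀ : H} {R : ℝ}
    (hb : ∀ t, 0 ≤ t → ‖S.U t 0 u₀‖ ≤ R) :
    ∃ v, S.CTraj v ∧ ∀ t, v (t + S.σ) = v t := by
  choose W hW aW pW using exists_amen hb
  have hc := W_cont hW aW pW
  have huniq : ∀ a v, S.CTraj v → S.Amen v → S.pr (v 0) = a → W a = v := fun a v hv av h =>
    amen_eq (hW a) hv (aW a) av (t := 0) (by rw [pW, h])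
  have hf : ∀ a, W (S.pr (W a S.σ)) = fun t => W a (t + S.σ) := fun a =>
    huniq _ _ (hW a).shift ((aW a).shift (hW a).continuous _) (by simp)
  have hg : ∀ a, W (S.pr (W a (-S.σ))) = fun t => W a (t + -S.σ) := fun a =>
    huniq _ _ (hW a).shift_neg ((aW a).shift (hW a).continuous _) (by simp)
  let f : ℂ ≃ₜ ℂ :=
    { toFun := fun a => S.pr (W a S.σ)
      invFun := fun a => S.pr (W a (-S.σ))
      left_inv := fun a => by simp [hf, pW]
      right_inv := fun a => by simp [hg, pW]
      continuous_toFun := S.pr.continuous.comp (hc _)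
      continuous_invFun := S.pr.continuous.comp (hc _) }
  have hfa : ∀ a, f a = S.pr (W a S.σ) := fun a => rfl
  have hle : ∀ t : unitInterval, (0:ℝ) ≤ t * S.σ := fun t => mul_nonneg t.2.1 S.σ_pos.le
  have hcont : Continuous fun p : unitInterval × ℂ => S.pr (S.U (p.1 * S.σ) 0 (W p.2 0)) := by
    refine S.pr.continuous.comp ?_
    have h0 := hc 0
    exact (S.U_cont 0).comp_continuous
      (f := fun p : unitInterval × ℂ => ((p.1 * S.σ : ℝ), W p.2 0))
      (by fun_prop) (fun p => hle p.1)
  let G : C(unitInterval × ℂ, ℂ) := ⟨_, hcont⟩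
  have hOP := PlaneBrouwer.OP.of_isotopy G (fun t x y hxy => by
      have h1 : S.pr (S.U (t * S.σ) 0 (W x 0)) = S.pr (S.U (t * S.σ) 0 (W y 0)) := hxy
      rw [← hW x 0 _ (hle t), ← hW y 0 _ (hle t)] at h1
      have := amen_eq (hW x) (hW y) (aW x) (aW y) h1
      rw [← pW x, this, pW]) (fun x => by
      change S.pr (S.U (((0 : unitInterval) : ℝ) * S.σ) 0 (W x 0)) = x
      simp [S.U_self, pW])
  have hOPf : PlaneBrouwer.OP f := by
    have : (fun x => G (1, x)) = f := by
      funext x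
      change S.pr (S.U (((1 : unitInterval) : ℝ) * S.σ) 0 (W x 0)) = S.pr (W x S.σ)
      rw [Set.Icc.coe_one, one_mul, ← hW x 0 _ S.σ_pos.le]
    rwa [this] at hOP
  obtain ⟨v, hv, av, hvb⟩ := bounded_complete hb
  have horb : ∀ k : ℕ, W (f^[k] (S.pr (v 0))) = fun t => v (t + k * S.σ) := by
    intro k
    induction k with
    | zero => simpa using huniq _ v hv av rfl
    | succ k ih =>
      rw [Function.iterate_succ_apply', hfa, hf, ih]
      funext t
      push_cast
      congr 1
      ring
  obtain ⟨a, ha⟩ := PlaneBrouwer.brouwer f hOPf (S.pr (v 0)) (by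
    rw [isBounded_iff_forall_norm_le]
    refine ⟨‖S.pr‖ * R, ?_⟩
    rintro _ ⟨k, rfl⟩
    simp only
    rw [← pW (f^[k] (S.pr (v 0))), horb]
    exact (S.pr.le_opNorm _).trans (mul_le_mul_of_nonneg_left (hvb _) (norm_nonneg _)))
  refine ⟨W a, hW a, fun t => ?_⟩
  have := hf a
  rw [← hfa, ha] at this
  exact (congrFun this t).symm

end Sys
end Massera


namespace Massera
variable {H : Type*} [NormedAddCommGroup H] [InnerProductSpace ℝ H]

/-- Coordinates on the negative subspace. -/
lemma exists_coords [CompleteSpace H] {P : H →L[ℝ] H} {Hplus Hminus : Submodule ℝ H}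
    (h1 : HypH1 P Hplus Hminus) (h2 : HypH2 Hminus 2) :
    ∃ (pr : H →L[ℝ] ℂ) (inc : ℂ →L[ℝ] H) (K c : ℝ), 0 < K ∧ 0 < c ∧
      (∀ z, pr (inc z) = z) ∧ (∀ z, ⟪P (inc z), inc z⟫ ≤ -c * ‖z‖ ^ 2) ∧
      (∀ d, -K * ‖pr d‖ ^ 2 ≤ ⟪P d, d⟫) ∧ (∀ d, ⟪P d, d⟫ ≤ K * ‖d‖ ^ 2) := by
  obtain ⟨hfd, hdim⟩ := h2
  have hplus : Hminusᗮ = Hplus := by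
    have : CompleteSpace Hplus := h1.closed_plus.completeSpace_coe
    rw [h1.orth, Submodule.orthogonal_orthogonal]
  let e : Hminus ≃L[ℝ] ℂ := ContinuousLinearEquiv.ofFinrankEq
    (by rw [hdim, Complex.finrank_real_complex])
  let inc : ℂ →L[ℝ] H := Hminus.subtypeL.comp (e.symm : ℂ →L[ℝ] Hminus)
  let pr : H →L[ℝ] ℂ := (e : Hminus →L[ℝ] ℂ).comp Hminus.orthogonalProjectionOnto
  have hinc : ∀ z, inc z = (e.symm z : H) := fun z => rfl
  have hpr : ∀ d, pr d = e (Hminus.orthogonalProjectionOnto d) := fun d => rfl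
  have hmem : ∀ z, inc z ∈ Hminus := fun z => (e.symm z).2
  have hincpr : ∀ d, inc (pr d) = (Hminus.orthogonalProjectionOnto d : H) := fun d => by
    rw [hinc, hpr, ContinuousLinearEquiv.symm_apply_apply]
  have hVb : ∀ d, |⟪P d, d⟫| ≤ ‖P‖ * ‖d‖ ^ 2 := fun d => by
    refine (abs_real_inner_le_norm _ _).trans ?_
    have := mul_le_mul_of_nonneg_right (P.le_opNorm d) (norm_nonneg d)
    nlinarith
  -- negative definiteness constant
  obtain ⟨c, hc, hcV⟩ : ∃ c > 0, ∀ z, ⟪P (inc z), inc z⟫ ≤ -c * ‖z‖ ^ 2 := by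
    have hcont : Continuous fun z => ⟪P (inc z), inc z⟫ := by fun_prop
    obtain ⟨z0, hz0, hmax⟩ := (isCompact_sphere (0:ℂ) 1).exists_isMaxOn ⟨1, by simp⟩
      hcont.continuousOn
    have hz0n : ‖z0‖ = 1 := by simpa using hz0
    have hz00 : z0 ≠ 0 := by
      rintro rfl
      simp at hz0n
    have hne : inc z0 ≠ 0 := by
      rw [hinc]
      simpa using hz00
    refine ⟨-⟪P (inc z0), inc z0⟫, by linarith [h1.neg _ (hmem z0) hne], fun z => ?_⟩
    by_cases hz : z = 0
    · simp [hz]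
    have hzn : 0 < ‖z‖ := norm_pos_iff.2 hz
    have h3 := hmax (a := (‖z‖⁻¹ : ℝ) • z) (by simp [norm_smul, hzn.ne'])
    simp only [mem_ofPred_eq, map_smul, inner_smul_left, inner_smul_right] at h3
    simp only [conj_trivial] at h3
    rw [neg_neg]
    have h4 := mul_le_mul_of_nonneg_right h3 (sq_nonneg ‖z‖)
    have h5 : ‖z‖⁻¹ * (‖z‖⁻¹ * ⟪P (inc z), inc z⟫) * ‖z‖ ^ 2 = ⟪P (inc z), inc z⟫ := by
      field_simp
    linarith
  refine ⟨pr, inc, ‖P‖ * ‖inc‖ ^ 2 + ‖P‖ + 1, c, by positivity, hc, fun z => ?_, hcV,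
    fun d => ?_, fun d => ?_⟩
  · rw [hpr, hinc, Submodule.orthogonalProjectionOnto_mem_subspace_eq_self]
    simp
  · set x := inc (pr d) with hx
    set y := d - x with hy
    have hxm : x ∈ Hminus := hmem _
    have hym : y ∈ Hminusᗮ := by
      rw [hy, hx, hincpr]
      exact Submodule.sub_starProjection_mem_orthogonal d
    have hd : d = x + y := by rw [hy]; abel
    have hxy : ⟪P x, y⟫ = 0 := hym _ (h1.inv_minus _ hxm)
    have hyx : ⟪P y, x⟫ = 0 := by
      have := h1.inv_plus y (hplus ▸ hym)
      rw [← hplus] at this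
      rw [real_inner_comm]
      exact this _ hxm
    have hyy : 0 ≤ ⟪P y, y⟫ := by
      by_cases h0 : y = 0
      · simp [h0]
      · exact (h1.pos y (hplus ▸ hym) h0).le
    have hV : ⟪P d, d⟫ = ⟪P x, x⟫ + ⟪P y, y⟫ := by
      rw [hd, map_add, inner_add_left, inner_add_right, inner_add_right, hxy, hyx]
      ring
    have h5 : ‖x‖ ^ 2 ≤ ‖inc‖ ^ 2 * ‖pr d‖ ^ 2 := by
      rw [← mul_pow]
      gcongr
      exact inc.le_opNorm _
    have h6 := (abs_le.1 (hVb x)).1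
    have h7 := mul_le_mul_of_nonneg_left h5 (norm_nonneg P)
    have h8 : 0 ≤ (‖P‖ + 1) * ‖pr d‖ ^ 2 := by positivity
    rw [hV]
    linarith
  · have h6 := (abs_le.1 (hVb d)).2
    have h8 : 0 ≤ (‖P‖ * ‖inc‖ ^ 2 + 1) * ‖d‖ ^ 2 := by positivity
    linarith

lemma flow_zero (σ : ℝ) (q : AddCircle σ) : circleFlow σ 0 q = q := by simp [circleFlow]

lemma flow_add (σ : ℝ) (q : AddCircle σ) (s t : ℝ) :
    circleFlow σ t (circleFlow σ s q) = circleFlow σ (s + t) q := by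
  simp [circleFlow, add_assoc]

lemma flow_per (σ : ℝ) (q : AddCircle σ) (s : ℝ) :
    circleFlow σ (s + σ) q = circleFlow σ s q := by
  simp [circleFlow]

theorem main [CompleteSpace H] (σ : ℝ) (hσ : 0 < σ)
    (ψ : ℝ → AddCircle σ → H → H)
    (hcoc : IsCocycle (circleFlow σ) ψ)
    (P : H →L[ℝ] H) (Hplus Hminus : Submodule ℝ H)
    (h1 : HypH1 P Hplus Hminus)
    (h2 : HypH2 Hminus 2)
    (δ ν : ℝ) (h3 : HypH3 ψ P δ ν)
    (hcom : IsCompactOperator (⇑P) ∨ HypCOM2 ψ)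
    (hbounded : ∃ (q : AddCircle σ) (u₀ : H),
      IsBounded ((fun t => ψ t q u₀) '' Set.Ici (0:ℝ))) :
    ∃ (q : AddCircle σ) (v : ℝ → H), IsCompleteTraj (circleFlow σ) ψ q v ∧
      ∀ t : ℝ, v (t + σ) = v t := by
  obtain ⟨q, u₀, hb⟩ := hbounded
  obtain ⟨pr, inc, K, c, hK, hc, h4, h5, h6, h7⟩ := exists_coords h1 h2
  obtain ⟨hc0, hcs, hcc⟩ := hcoc
  obtain ⟨hδ, hν, h3⟩ := h3
  let S : Sys H :=
    { σ := σ, ν := ν, δ := δ, K := K, c := c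
      U := fun t s x => ψ (t - s) (circleFlow σ s q) x
      P := P, pr := pr, inc := inc
      σ_pos := hσ, ν_pos := hν, δ_pos := hδ, K_pos := hK, c_pos := hc
      pr_inc := h4, V_inc := h5, V_ge := h6, V_le := h7
      U_self := fun s x => by simp only [sub_self, hc0]
      U_comp := fun s r t x hsr hrt => by
        have := hcs (t - r) (r - s) (by linarith) (by linarith) (circleFlow σ s q) x
        rw [flow_add] at this
        rw [show t - s = t - r + (r - s) by ring, this]
        congr 2
        ring
      U_per := fun s t x _ => by
        simp only [flow_per]
        congr 1
        ring
      U_cont := fun s =>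
        hcc.comp (f := fun p : ℝ × H => ((p.1 - s : ℝ), circleFlow σ s q, p.2))
          (by fun_prop) (fun p hp => by
            have : s ≤ p.1 := hp
            simpa using this)
      mono := fun s l r x y hsl hlr => by
        have h := h3 (circleFlow σ s q) x y (l - s) (r - s) (by linarith) (by linarith)
        have e : (∫ t in l..r, Real.exp (2 * ν * t) *
            ‖ψ (t - s) (circleFlow σ s q) x - ψ (t - s) (circleFlow σ s q) y‖ ^ 2)
            = Real.exp (2 * ν * s) * ∫ t in (l - s)..(r - s), Real.exp (2 * ν * t) *
            ‖ψ t (circleFlow σ s q) x - ψ t (circleFlow σ s q) y‖ ^ 2 := by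
          rw [← intervalIntegral.integral_comp_sub_right (fun t => Real.exp (2 * ν * t) *
            ‖ψ t (circleFlow σ s q) x - ψ t (circleFlow σ s q) y‖ ^ 2),
            ← intervalIntegral.integral_const_mul]
          congr 1
          funext t
          rw [← mul_assoc, ← Real.exp_add]
          congr 2
          ring
        rw [e]
        have h' := mul_le_mul_of_nonneg_left h (Real.exp_pos (2 * ν * s)).le
        rw [mul_sub, ← mul_assoc, ← mul_assoc, ← Real.exp_add, ← Real.exp_add,
          show 2 * ν * s + 2 * ν * (r - s) = 2 * ν * r by ring,
          show 2 * ν * s + 2 * ν * (l - s) = 2 * ν * l by ring] at h'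
        linarith
      com := hcom.imp id (fun ⟨tc, htc, h⟩ => ⟨tc, htc, fun s B hB => by
        have := h (circleFlow σ s q) B hB
        simpa using this⟩) }
  have hU : ∀ t s x, S.U t s x = ψ (t - s) (circleFlow σ s q) x := fun _ _ _ => rfl
  obtain ⟨R, hR⟩ := hb.exists_norm_le
  obtain ⟨v, hv, hper⟩ := Sys.periodic (S := S) (u₀ := u₀) (R := R) (fun t ht => by
    rw [hU, sub_zero, flow_zero]
    exact hR _ ⟨t, ht, rfl⟩)
  refine ⟨q, v, ⟨hv.continuous, fun t s ht => ?_⟩, hper⟩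
  rw [hv s (t + s) (by linarith), hU, add_sub_cancel_right]

end Massera


/-- Theorem 4 (Massera-type theorem): for a σ-periodic cocycle satisfying (H1), (H2) with
`j = 2`, (H3) and one of (COM1) or (COM2), the existence of a bounded semi-trajectory
implies the existence of a σ-periodic trajectory. -/
theorem massera_second_theorem
    {H : Type*} [NormedAddCommGroup H] [InnerProductSpace ℝ H]
    [CompleteSpace H] [TopologicalSpace.SeparableSpace H]
    (σ : ℝ) (hσ : 0 < σ)
    (ψ : ℝ → AddCircle σ → H → H)
    (hcoc : IsCocycle (circleFlow σ) ψ)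
    (P : H →L[ℝ] H) (Hplus Hminus : Submodule ℝ H)
    (h1 : HypH1 P Hplus Hminus)
    (h2 : HypH2 Hminus 2)
    (δ ν : ℝ) (h3 : HypH3 ψ P δ ν)
    (hcom : IsCompactOperator (⇑P) ∨ HypCOM2 ψ)
    (hbounded : ∃ (q : AddCircle σ) (u₀ : H),
      IsBounded ((fun t => ψ t q u₀) '' Set.Ici (0:ℝ))) :
    ∃ (q : AddCircle σ) (v : ℝ → H), IsCompleteTraj (circleFlow σ) ψ q v ∧
      ∀ t : ℝ, v (t + σ) = v t := by
  exact Massera.main σ hσ ψ hcoc P Hplus Hminus h1 h2 δ ν h3 hcom hbounded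
end
end

section
/- Assume (H1), (H2) with some integer j > 0, and (H3). Fix q ∈ Q, v ∈ H and real numbers T₁ < T₂, and define G : H⁻ → H⁻ by G(ζ) := Π ψ^{T₂−T₁}(ϑ^{T₁}(q), v + ζ). Then G is a homeomorphism of H⁻ onto H⁻. -/
open MeasureTheory Set Bornology Filter Topology RealInnerProductSpace

noncomputable section

variable {Q H : Type*}

section Brouwer
variable {E : Type*} [NormedAddCommGroup E] [InnerProductSpace ℝ E] [FiniteDimensional ℝ E]

/-- `det (1 + t A)` is a polynomial in `t` of degree at most `dim E`. -/
lemma exists_det_poly (A : E →ₗ[ℝ] E) : ∃ p : Polynomial ℝ,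
    p.natDegree ≤ Module.finrank ℝ E ∧
      ∀ t : ℝ, p.eval t = LinearMap.det (LinearMap.id + t • A) := by
  classical
  let b := Module.finBasis ℝ E
  let M := LinearMap.toMatrix b b A
  refine ⟨Matrix.det ((Polynomial.X : Polynomial ℝ) • M.map Polynomial.C +
    (1 : Matrix _ _ ℝ).map Polynomial.C), ?_, ?_⟩
  · simpa using Polynomial.natDegree_det_X_add_C_le M 1
  · intro t
    rw [← LinearMap.det_toMatrix b, ← Polynomial.coe_evalRingHom, RingHom.map_det]
    congr 1
    ext i k
    by_cases h : i = k
    · subst h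
      simp [M]; ring
    · simp [M, h]; ring

lemma det_pos_of_small (A : E →ₗ[ℝ] E) (t : ℝ) (ht : 0 ≤ t)
    (hA : ∀ v, t * ‖A v‖ ≤ 2⁻¹ * ‖v‖) : 0 < LinearMap.det (LinearMap.id + t • A) := by
  obtain ⟨p, -, hp⟩ := exists_det_poly A
  have hne : ∀ s ∈ Icc 0 t, p.eval s ≠ 0 := by
    intro s hs h0
    rw [hp] at h0
    obtain ⟨v, hv, hv0⟩ := (Submodule.ne_bot_iff _).1 (LinearMap.bot_lt_ker_of_det_eq_zero h0).ne'
    rw [LinearMap.mem_ker] at hv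
    simp only [LinearMap.add_apply, LinearMap.id_apply, LinearMap.smul_apply] at hv
    have h1 : ‖v‖ = s * ‖A v‖ := by
      have h3 := congrArg norm (eq_neg_of_add_eq_zero_left hv)
      rwa [norm_neg, norm_smul, Real.norm_of_nonneg hs.1] at h3
    have h2 : s * ‖A v‖ ≤ t * ‖A v‖ := by gcongr; exact hs.2
    have := hA v
    have := norm_pos_iff.2 hv0
    linarith
  rw [← hp]
  by_contra hcon
  push Not at hcon
  have h0 : p.eval 0 = 1 := by rw [hp]; simp
  have := intermediate_value_Icc' ht (f := fun s => p.eval s) p.continuous.continuousOn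
  obtain ⟨s, hs, hs0⟩ := this ⟨hcon, by simp [h0]⟩
  exact hne s hs hs0

lemma no_retraction (r : E → E) (hr : ContDiff ℝ 1 r) (R : ℝ) (hR : 0 < R)
    (hn : ∀ x, ‖r x‖ = R) (hid : ∀ x, ‖x‖ = R → r x = x) : False := by
  classical
  borelize E
  set μ : Measure E := Measure.addHaar
  -- Lipschitz on the closed ball
  have hφ1 : ContDiff ℝ 1 (fun x => r x - x) := hr.sub contDiff_id
  obtain ⟨K, hK⟩ : ∃ K, LipschitzOnWith K (fun x => r x - x) (Metric.closedBall 0 R) :=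
    hφ1.locallyLipschitz.locallyLipschitzOn.exists_lipschitzOnWith_of_compact
      (isCompact_closedBall _ _)
  set φ : E → E := fun x => if ‖x‖ ≤ R then r x - x else 0 with hφ
  have hφout : ∀ x, R ≤ ‖x‖ → φ x = 0 := by
    intro x hx
    simp only [hφ]
    split_ifs with h
    · rw [hid x (le_antisymm h hx), sub_self]
    · rfl
  have key : ∀ x y, ‖x‖ ≤ R → R < ‖y‖ → ‖φ x‖ ≤ 2 * K * ‖x - y‖ := by
    intro x y hx hy
    have hy0 : 0 < ‖y‖ := hR.trans hy
    set z : E := (R / ‖y‖) • y with hz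
    have hzn : ‖z‖ = R := by
      rw [hz, norm_smul, Real.norm_of_nonneg (by positivity)]; field_simp
    have hyz : ‖y - z‖ = ‖y‖ - R := by
      have : y - z = (1 - R / ‖y‖) • y := by rw [hz]; module
      rw [this, norm_smul, Real.norm_of_nonneg]
      · field_simp
      · rw [sub_nonneg, div_le_one hy0]; exact hy.le
    have h1 : ‖φ x‖ ≤ K * ‖x - z‖ := by
      have := hK.dist_le_mul x (by simpa using hx) z (by simpa using hzn.le)
      rw [dist_eq_norm, dist_eq_norm, hid z hzn, sub_self, sub_zero] at this
      simpa [hφ, hx] using this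
    have h2 : ‖x - z‖ ≤ 2 * ‖x - y‖ := by
      have a1 : ‖x - z‖ ≤ ‖x - y‖ + ‖y - z‖ := norm_sub_le_norm_sub_add_norm_sub _ _ _
      have a2 : ‖y‖ - ‖x‖ ≤ ‖x - y‖ := by rw [norm_sub_rev]; exact norm_sub_norm_le _ _
      linarith
    calc ‖φ x‖ ≤ K * ‖x - z‖ := h1
      _ ≤ K * (2 * ‖x - y‖) := by gcongr
      _ = _ := by ring
  have hφL : ∀ x y, ‖φ x - φ y‖ ≤ 2 * K * ‖x - y‖ := by
    intro x y
    rcases le_or_gt ‖x‖ R with hx | hx <;> rcases le_or_gt ‖y‖ R with hy | hy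
    · have := hK.dist_le_mul x (by simpa using hx) y (by simpa using hy)
      rw [dist_eq_norm, dist_eq_norm] at this
      simp only [hφ, hx, hy, if_true]
      refine this.trans ?_
      have : 0 ≤ (K:ℝ) * ‖x - y‖ := by positivity
      linarith
    · rw [hφout y hy.le, sub_zero]; exact key x y hx hy
    · rw [hφout x hx.le, zero_sub, norm_neg, norm_sub_rev]; exact key y x hy hx
    · rw [hφout y hy.le, hφout x hx.le]; simp; positivity
  set L : ℝ := 2 * K with hL
  have hL0 : 0 ≤ L := by positivity
  set A : E → E →L[ℝ] E := fun x => fderiv ℝ r x - ContinuousLinearMap.id ℝ E with hA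
  have hAd : ∀ x ∈ Metric.ball (0:E) R, HasFDerivAt φ (A x) x := by
    intro x hx
    have h1 : HasFDerivAt (fun x => r x - x) (A x) x :=
      (hr.differentiable one_ne_zero x).hasFDerivAt.sub (hasFDerivAt_id x)
    refine h1.congr_of_eventuallyEq ?_
    filter_upwards [Metric.isOpen_ball.mem_nhds hx] with y hy
    have : ‖y‖ ≤ R := by simpa using (Metric.mem_ball.1 hy).le
    simp [hφ, this]
  have hAn : ∀ x ∈ Metric.ball (0:E) R, ‖A x‖ ≤ L := by
    intro x hx
    exact (hAd x hx).le_of_lip' hL0 (Eventually.of_forall fun y => by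
      simpa using hφL y x)
  -- the integral of the determinant for small t
  set D : ℝ → E → ℝ := fun t x => LinearMap.det (LinearMap.id + t • (A x : E →ₗ[ℝ] E)) with hD
  have hDc : ∀ t, Continuous (D t) := by
    intro t
    have : D t = fun x => (ContinuousLinearMap.id ℝ E + t • A x).det := by
      ext x; rfl
    rw [this]
    have hc : Continuous A := (hr.continuous_fderiv one_ne_zero).sub continuous_const
    exact ContinuousLinearMap.continuous_det.comp (by fun_prop)
  have hDi : ∀ t, IntegrableOn (D t) (Metric.ball 0 R) μ := fun t =>
    ((hDc t).continuousOn.integrableOn_compact (isCompact_closedBall (0:E) R)).mono_set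
      Metric.ball_subset_closedBall
  have small : ∀ t : ℝ, 0 ≤ t → t * L ≤ 2⁻¹ →
      ∫ x in Metric.ball 0 R, D t x ∂μ = μ.real (Metric.ball 0 R) := by
    intro t ht htL
    set f : E → E := fun x => x + t • φ x with hf
    have hlip : ∀ x y, ‖t • φ x - t • φ y‖ ≤ 2⁻¹ * ‖x - y‖ := by
      intro x y
      rw [← smul_sub, norm_smul, Real.norm_of_nonneg ht]
      calc t * ‖φ x - φ y‖ ≤ t * (L * ‖x - y‖) := by gcongr; exact hφL x y
        _ = (t * L) * ‖x - y‖ := by ring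
        _ ≤ _ := by gcongr
    have hinj : Function.Injective f := by
      intro x y hxy
      have h1 : x - y = -(t • φ x - t • φ y) := by
        simp only [hf] at hxy
        rw [neg_sub, sub_eq_sub_iff_add_eq_add, hxy, add_comm]
      have h2 := hlip x y
      rw [← norm_neg, ← h1] at h2
      have : ‖x - y‖ = 0 := by linarith [norm_nonneg (x - y)]
      exact sub_eq_zero.1 (norm_eq_zero.1 this)
    have hsurj : Function.Surjective f := by
      intro y
      have hc : ContractingWith (2⁻¹ : NNReal) (fun x => y - t • φ x) := by
        refine ⟨by norm_num, LipschitzWith.of_dist_le_mul fun a b => ?_⟩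
        rw [dist_eq_norm, dist_eq_norm, sub_sub_sub_cancel_left, norm_sub_rev]
        simpa using hlip a b
      refine ⟨hc.fixedPoint, ?_⟩
      have := hc.fixedPoint_isFixedPt
      have h' : y - t • φ (hc.fixedPoint) = hc.fixedPoint := this
      simp only [hf]
      exact (sub_eq_iff_eq_add.1 h').symm
    have himg : f '' (Metric.ball 0 R) = Metric.ball 0 R := by
      have hc : f '' (Metric.ball (0:E) R)ᶜ = (Metric.ball 0 R)ᶜ := by
        have : EqOn f id (Metric.ball (0:E) R)ᶜ := by
          intro x hx
          simp at hx
          simp [hf, hφout x hx]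
        rw [this.image_eq, image_id]
      rw [image_compl_eq ⟨hinj, hsurj⟩] at hc
      exact compl_injective hc
    have hd : ∀ x ∈ Metric.ball (0:E) R,
        HasFDerivWithinAt f (ContinuousLinearMap.id ℝ E + t • A x) (Metric.ball (0:E) R) x :=
      fun x hx => ((hasFDerivAt_id x).add ((hAd x hx).const_smul t)).hasFDerivWithinAt
    have h := integral_image_eq_integral_abs_det_fderiv_smul μ measurableSet_ball hd
      hinj.injOn (fun _ => (1:ℝ))
    rw [himg] at h
    simp only [integral_const, smul_eq_mul, mul_one, measureReal_restrict_apply_univ] at h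
    rw [h]
    refine setIntegral_congr_fun measurableSet_ball fun x hx => ?_
    have hpos : 0 < D t x := by
      refine det_pos_of_small _ t ht fun v => ?_
      calc t * ‖A x v‖ ≤ t * (L * ‖v‖) := by
            gcongr; exact (A x).le_of_opNorm_le (hAn x hx) v
        _ = (t * L) * ‖v‖ := by ring
        _ ≤ _ := by gcongr
    change D t x = |D t x|
    rw [abs_of_pos hpos]
  -- interpolation
  set n := Module.finrank ℝ E
  set a : ℝ := (2 * (n + 1) * (L + 1))⁻¹ with ha
  have ha0 : 0 < a := by positivity
  set T : ℕ → ℝ := fun i => i * a with hT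
  have hTinj : InjOn T (Finset.range (n+1)) := by
    intro i _ k _ h
    simpa [hT, ha0.ne'] using h
  have hTs : ∀ i ∈ Finset.range (n+1), 0 ≤ T i ∧ T i * L ≤ 2⁻¹ := by
    intro i hi
    refine ⟨by positivity, ?_⟩
    have hi' : (i:ℝ) ≤ n + 1 := by
      have := Finset.mem_range.1 hi
      exact_mod_cast this.le
    calc T i * L ≤ (n + 1) * a * (L + 1) := by
          simp only [hT]; gcongr; linarith
      _ = 2⁻¹ := by rw [ha]; field_simp
  have hinterp : ∀ x, D 1 x = ∑ i ∈ Finset.range (n+1),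
      (Lagrange.basis (Finset.range (n+1)) T i).eval 1 * D (T i) x := by
    intro x
    obtain ⟨p, hpd, hp⟩ := exists_det_poly (A x : E →ₗ[ℝ] E)
    have hdeg : p.degree < (Finset.range (n+1)).card := by
      rw [Finset.card_range]
      exact (Polynomial.degree_le_natDegree).trans_lt (by exact_mod_cast Nat.lt_succ_of_le hpd)
    have := Lagrange.eq_interpolate hTinj hdeg
    have h1 := congrArg (Polynomial.eval 1) this
    rw [Lagrange.interpolate_apply, Polynomial.eval_finsetSum] at h1
    simp only [Polynomial.eval_mul, Polynomial.eval_C, hp] at h1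
    simp only [hD, h1]
    exact Finset.sum_congr rfl fun i _ => mul_comm _ _
  have hsum : ∑ i ∈ Finset.range (n+1),
      (Lagrange.basis (Finset.range (n+1)) T i).eval 1 = 1 := by
    have := Lagrange.sum_basis hTinj (by simp)
    rw [← Polynomial.eval_finsetSum, this, Polynomial.eval_one]
  have hone : ∫ x in Metric.ball 0 R, D 1 x ∂μ = μ.real (Metric.ball 0 R) := by
    simp_rw [hinterp]
    rw [integral_finsetSum _ fun i _ => (hDi (T i)).const_mul _]
    calc _ = ∑ i ∈ Finset.range (n+1),
          (Lagrange.basis (Finset.range (n+1)) T i).eval 1 * μ.real (Metric.ball 0 R) := by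
          refine Finset.sum_congr rfl fun i hi => ?_
          rw [integral_const_mul, small _ (hTs i hi).1 (hTs i hi).2]
      _ = _ := by rw [← Finset.sum_mul, hsum, one_mul]
  have hzero : ∀ x, D 1 x = 0 := by
    intro x
    by_contra hne
    have h1 : LinearMap.id + (1:ℝ) • (A x : E →ₗ[ℝ] E) = (fderiv ℝ r x : E →ₗ[ℝ] E) := by
      ext v; simp [hA]
    simp only [hD, h1] at hne
    have hs : Function.Surjective (fderiv ℝ r x : E →ₗ[ℝ] E) :=
      (LinearEquiv.ofIsUnitDet (f := (fderiv ℝ r x : E →ₗ[ℝ] E)) (v := Module.finBasis ℝ E)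
        (v' := Module.finBasis ℝ E) (by
          rw [LinearMap.det_toMatrix]; exact isUnit_iff_ne_zero.2 hne)).surjective
    obtain ⟨v, hv⟩ := hs (r x)
    have hd := (hr.differentiable one_ne_zero x).hasFDerivAt
    have h2 := hd.norm_sq
    have h3 : (fun y => ‖r y‖ ^ 2) = fun _ => R ^ 2 := by ext y; rw [hn]
    rw [h3] at h2
    have h4 := congrArg (fun l : E →L[ℝ] ℝ => l v) (h2.unique (hasFDerivAt_const _ _))
    have hv' : fderiv ℝ r x v = r x := hv
    simp [hv', hn, hR.ne'] at h4
  simp [hzero] at hone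
  have hpos : 0 < μ.real (Metric.ball (0:E) R) :=
    ENNReal.toReal_pos (Metric.measure_ball_pos μ _ hR).ne' measure_ball_lt_top.ne
  linarith

lemma exists_zero_smooth (h : E → E) (hh : ContDiff ℝ 1 h) (R : ℝ) (hR : 0 < R)
    (hid : ∀ x, R ≤ ‖x‖ → h x = x) : ∃ x, h x = 0 := by
  by_contra hcon
  push Not at hcon
  refine no_retraction (fun x => (R / ‖h x‖) • h x) ?_ R hR ?_ ?_
  · exact (contDiff_const.div (hh.norm ℝ hcon) fun x => norm_ne_zero_iff.2 (hcon x)).smul hh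
  · intro x
    have : 0 < ‖h x‖ := norm_pos_iff.2 (hcon x)
    rw [norm_smul, Real.norm_of_nonneg (by positivity)]
    field_simp
  · intro x hx
    simp only [hid x hx.ge, hx]
    rw [div_self hR.ne', one_smul]

/-- A continuous map at bounded distance from the identity has a zero. -/
lemma exists_zero_of_bounded (h : E → E) (hh : Continuous h) (M : ℝ)
    (hM : ∀ x, ‖h x - x‖ ≤ M) : ∃ x, h x = 0 := by
  by_contra hcon
  push Not at hcon
  have hM0 : 0 ≤ M := (norm_nonneg _).trans (hM 0)
  -- lower bound on a big ball
  obtain ⟨ε, hε, hεh⟩ : ∃ ε > 0, ∀ x, ‖x‖ ≤ M + 2 → ε ≤ ‖h x‖ := by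
    obtain ⟨x₀, -, hx₀⟩ := (isCompact_closedBall (0:E) (M+2)).exists_isMinOn
      ⟨0, by simp; linarith⟩ hh.norm.continuousOn
    exact ⟨‖h x₀‖, norm_pos_iff.2 (hcon x₀), fun x hx => hx₀ (by simpa using hx)⟩
  let χ : ContDiffBump (0 : E) := ⟨M + 2, M + 3, by linarith, by linarith⟩
  have huc : UniformContinuous (fun x => χ x • (h x - x)) := by
    refine Continuous.uniformContinuous_of_tendsto_cocompact (x := 0) ?_ (HasCompactSupport.is_zero_at_infty ?_)
    · exact χ.continuous.smul (hh.sub continuous_id)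
    · exact χ.hasCompactSupport.smul_right
  obtain ⟨g, hg, hgd⟩ := huc.exists_contDiff_dist_le (ε := min ε 1) (by positivity)
  obtain ⟨x, hx⟩ := exists_zero_smooth (fun x => x + χ x • g x)
    (contDiff_id.add (χ.contDiff.smul (hg.of_le (by exact_mod_cast le_top)))) (M + 3)
    (by linarith) (by
      intro x hx
      have : χ x = 0 := χ.zero_of_le_dist (by simpa [χ] using hx)
      simp [this])
  have hgx := hgd x
  rw [dist_eq_norm] at hgx
  have hχ0 : 0 ≤ χ x := χ.nonneg
  have hχ1 : χ x ≤ 1 := χ.le_one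
  have hgn : ‖g x‖ ≤ M + 1 := by
    have h1 : ‖χ x • (h x - x)‖ ≤ M := by
      rw [norm_smul, Real.norm_of_nonneg hχ0]
      calc χ x * ‖h x - x‖ ≤ 1 * M := by gcongr; exact hM x
        _ = M := one_mul _
    have h2 : ‖g x‖ ≤ ‖g x - χ x • (h x - x)‖ + ‖χ x • (h x - x)‖ := by
      simpa using norm_add_le (g x - χ x • (h x - x)) (χ x • (h x - x))
    have := min_le_right ε 1
    linarith
  have hxn : ‖x‖ ≤ M + 1 := by
    rw [eq_neg_of_add_eq_zero_left hx, norm_neg, norm_smul, Real.norm_of_nonneg hχ0]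
    calc χ x * ‖g x‖ ≤ 1 * (M + 1) := by gcongr
      _ = _ := one_mul _
  have hone : χ x = 1 := χ.one_of_mem_closedBall (by simp [χ]; linarith)
  rw [hone, one_smul] at hgx hx
  have h3 : g x - (h x - x) = - h x := by
    rw [← neg_eq_of_add_eq_zero_right hx]; abel
  rw [h3, norm_neg] at hgx
  have := min_le_left ε 1
  have := hεh x (by linarith)
  linarith

/-- A continuous expanding self-map of a finite-dimensional space is surjective. -/
lemma surjective_of_antilipschitz (F : E → E) (hF : Continuous F) (K : NNReal)
    (hK : AntilipschitzWith K F) : Function.Surjective F := by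
  intro c
  by_contra hc
  push Not at hc
  have hinj := hK.injective
  obtain ⟨g, hgL, hg⟩ : ∃ g : E → E, LipschitzWith (lipschitzExtensionConstant E * K) g ∧
      EqOn (Function.invFun F) g (range F) := by
    refine LipschitzOnWith.extend_finite_dimension ?_
    refine LipschitzOnWith.of_dist_le_mul ?_
    rintro _ ⟨x, rfl⟩ _ ⟨y, rfl⟩
    rw [Function.leftInverse_invFun hinj, Function.leftInverse_invFun hinj]
    exact hK.le_mul_dist x y
  have hgF : ∀ x, g (F x) = x := fun x => by
    rw [← hg ⟨x, rfl⟩, Function.leftInverse_invFun hinj]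
  set L := lipschitzExtensionConstant E * K
  set ε : ℝ := ‖F 0 - c‖ + 1 with hεd
  have hε : 0 < ε := by positivity
  borelize E
  have hnull : (Measure.hausdorffMeasure (Module.finrank ℝ E : ℝ) : Measure E)
      (g '' Metric.sphere c ε) = 0 := by
    have h1 := hgL.hausdorffMeasure_image_le (d := (Module.finrank ℝ E : ℝ)) (by positivity)
      (Metric.sphere c ε)
    rw [Measure.addHaar_sphere_of_ne_zero _ c hε.ne', mul_zero] at h1
    exact le_antisymm h1 bot_le
  have hpos : ∀ x, 0 < ‖F x - c‖ := fun x => norm_pos_iff.2 (sub_ne_zero.2 (hc x))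
  have hmain : ∀ w, w ∉ g '' Metric.sphere c ε → ε ≤ ‖F w - c‖ := by
    intro w hw
    set Φ : E → E := fun x => c + max (ε / ‖F x - c‖) 1 • (F x - c) with hΦ
    have hΦc : Continuous Φ := by
      refine continuous_const.add (Continuous.smul (Continuous.max ?_ continuous_const)
        (hF.sub continuous_const))
      exact continuous_const.div (hF.sub continuous_const).norm fun x => (hpos x).ne'
    have hΦ1 : ∀ x, ‖F x - c‖ ≤ ε → ‖Φ x - c‖ = ε := by
      intro x hx
      have := hpos x
      have h1 : max (ε / ‖F x - c‖) 1 = ε / ‖F x - c‖ := max_eq_left ((one_le_div this).2 hx)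
      simp only [hΦ, h1]
      rw [add_sub_cancel_left, norm_smul, Real.norm_of_nonneg (by positivity)]
      field_simp
    have hΦ2 : ∀ x, ε ≤ ‖F x - c‖ → Φ x = F x := by
      intro x hx
      have h1 : max (ε / ‖F x - c‖) 1 = 1 := max_eq_right ((div_le_one (hpos x)).2 hx)
      simp only [hΦ, h1]
      simp
    have hΦd : ∀ x, ‖Φ x - F x‖ ≤ 2 * ε := by
      intro x
      rcases le_total ‖F x - c‖ ε with hx | hx
      · have h1 : ‖Φ x - F x‖ ≤ ‖Φ x - c‖ + ‖c - F x‖ := norm_sub_le_norm_sub_add_norm_sub _ _ _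
        rw [norm_sub_rev c, hΦ1 x hx] at h1
        linarith
      · rw [hΦ2 x hx]; simp; positivity
    obtain ⟨x, hx⟩ := exists_zero_of_bounded (fun x => g (Φ x) - w)
      ((hgL.continuous.comp hΦc).sub continuous_const) (L * (2 * ε) + ‖w‖) (by
        intro x
        have h1 : ‖g (Φ x) - x‖ ≤ L * (2 * ε) := by
          have := hgL.dist_le_mul (Φ x) (F x)
          rw [hgF, dist_eq_norm, dist_eq_norm] at this
          exact this.trans (by gcongr; exact hΦd x)
        calc ‖g (Φ x) - w - x‖ = ‖(g (Φ x) - x) - w‖ := by congr 1; abel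
          _ ≤ ‖g (Φ x) - x‖ + ‖w‖ := norm_sub_le _ _
          _ ≤ _ := by gcongr)
    have hx' : g (Φ x) = w := sub_eq_zero.1 hx
    rcases le_total ‖F x - c‖ ε with hxe | hxe
    · exact absurd ⟨Φ x, by simpa [dist_eq_norm] using hΦ1 x hxe, hx'⟩ hw
    · rw [hΦ2 x hxe, hgF] at hx'
      rwa [← hx']
  -- density of the complement of a null set
  have hdense : Dense (g '' Metric.sphere c ε)ᶜ := by
    rw [← interior_eq_empty_iff_dense_compl]
    exact Measure.interior_eq_empty_of_null hnull
  have hclosed : IsClosed {w | ε ≤ ‖F w - c‖} :=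
    isClosed_le continuous_const (hF.sub continuous_const).norm
  have hall : (0:E) ∈ {w | ε ≤ ‖F w - c‖} :=
    hclosed.closure_subset_iff.2 (fun w hw => hmain w hw) (hdense 0)
  have : ε ≤ ‖F 0 - c‖ := hall
  linarith

end Brouwer

/-- Lemma 3: under (H1), (H2) with `j > 0` and (H3), for fixed `q ∈ Q`, `v ∈ H` and
`T₁ < T₂`, the map `G(ζ) := Π ψ^{T₂−T₁}(ϑ^{T₁}(q), v + ζ)` is a homeomorphism of `H⁻`
onto itself. -/
theorem operator_G_homeomorphism
    {Q H : Type*} [MetricSpace Q] [NormedAddCommGroup H] [InnerProductSpace ℝ H]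
    [CompleteSpace H] [TopologicalSpace.SeparableSpace H]
    (ϑ : ℝ → Q → Q) (ψ : ℝ → Q → H → H)
    (hflow : IsFlow ϑ) (hcoc : IsCocycle ϑ ψ)
    (P : H →L[ℝ] H) (Hplus Hminus : Submodule ℝ H)
    (h1 : HypH1 P Hplus Hminus)
    (j : ℕ) (hj : 0 < j) (h2 : HypH2 Hminus j)
    (δ ν : ℝ) (h3 : HypH3 ψ P δ ν)
    (Pi : H →L[ℝ] H) (hPi : IsOrthProjOnto Hminus Pi)
    (q : Q) (v : H) (T₁ T₂ : ℝ) (hT : T₁ < T₂) :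
    ∃ e : ↥Hminus ≃ₜ ↥Hminus,
      ∀ ζ : ↥Hminus, (e ζ : H) = Pi (ψ (T₂ - T₁) (ϑ T₁ q) (v + (ζ : H))) := by
  have := h2.1
  set T := T₂ - T₁ with hTd
  have hT0 : 0 ≤ T := by linarith
  set p := ϑ T₁ q
  -- the orthogonal complement of `Hminus` is `Hplus`
  have horth : Hminusᗮ = Hplus := by
    have : CompleteSpace Hplus := h1.closed_plus.completeSpace_coe
    rw [h1.orth, Submodule.orthogonal_orthogonal]
  have hV : ∀ d : H, -(‖P‖ * ‖Pi d‖ ^ 2) ≤ ⟪P d, d⟫ := by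
    intro d
    have hm := hPi.1 d
    have hp : d - Pi d ∈ Hplus := horth ▸ hPi.2 d
    set m := Pi d
    set k := d - m with hk
    have hd : d = m + k := by rw [hk]; abel
    have hmk : ∀ x ∈ Hplus, ∀ y ∈ Hminus, ⟪x, y⟫ = 0 := by
      intro x hx y hy
      rw [h1.orth] at hy
      exact Submodule.inner_right_of_mem_orthogonal hx hy
    have e1 : ⟪P k, m⟫ = 0 := hmk _ (h1.inv_plus k hp) _ hm
    have e2 : ⟪P m, k⟫ = 0 := by
      rw [real_inner_comm]; exact hmk _ hp _ (h1.inv_minus m hm)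
    have e3 : 0 ≤ ⟪P k, k⟫ := by
      by_cases h0 : k = 0
      · simp [h0]
      · exact (h1.pos k hp h0).le
    have e4 : -(‖P‖ * ‖m‖ ^ 2) ≤ ⟪P m, m⟫ := by
      have a1 := abs_real_inner_le_norm (P m) m
      have a2 : ‖P m‖ * ‖m‖ ≤ ‖P‖ * ‖m‖ * ‖m‖ := by gcongr; exact P.le_opNorm m
      have a3 := neg_abs_le ⟪P m, m⟫
      nlinarith
    have e5 : ⟪P d, d⟫ = ⟪P m, m⟫ + ⟪P k, k⟫ := by
      rw [hd, map_add, inner_add_left, inner_add_right, inner_add_right, e1, e2]; ring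
    linarith
  -- coercivity on `Hminus`
  obtain ⟨c, hc, hcV⟩ : ∃ c > 0, ∀ ζ : Hminus, ⟪P ζ, (ζ:H)⟫ ≤ -(c * ‖ζ‖ ^ 2) := by
    have : Nontrivial Hminus := Module.nontrivial_of_finrank_pos (R := ℝ) (by rw [h2.2]; exact hj)
    have hcont : Continuous fun ζ : Hminus => ⟪P ζ, (ζ:H)⟫ := by fun_prop
    obtain ⟨z, hz, hzm⟩ := (isCompact_sphere (0:Hminus) 1).exists_isMaxOn
      (NormedSpace.sphere_nonempty.2 zero_le_one) hcont.continuousOn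
    have hz1 : ‖z‖ = 1 := by simpa using hz
    have hz0 : (z:H) ≠ 0 := by
      intro h
      have : z = 0 := by exact_mod_cast h
      rw [this] at hz1; simp at hz1
    refine ⟨-⟪P z, (z:H)⟫, neg_pos.2 (h1.neg z z.2 hz0), fun ζ => ?_⟩
    by_cases h0 : ζ = 0
    · simp [h0]
    · have hn : 0 < ‖ζ‖ := norm_pos_iff.2 h0
      have := hzm (show ‖ζ‖⁻¹ • ζ ∈ Metric.sphere (0:Hminus) 1 by
        rw [mem_sphere_zero_iff_norm, norm_smul, norm_inv, norm_norm, inv_mul_cancel₀ hn.ne'])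
      simp only [mem_ofPred_eq, Submodule.coe_smul, map_smul, real_inner_smul_left,
        real_inner_smul_right] at this
      have h4 : ⟪P ζ, (ζ:H)⟫ = ‖ζ‖ ^ 2 * (‖ζ‖⁻¹ * (‖ζ‖⁻¹ * ⟪P ζ, (ζ:H)⟫)) := by
        field_simp
      rw [h4]
      have := mul_le_mul_of_nonneg_left this (sq_nonneg ‖ζ‖)
      linarith
  let G : Hminus → Hminus := fun ζ => ⟨Pi (ψ T p (v + ζ)), hPi.1 _⟩
  have hGc : Continuous G := by
    refine Continuous.subtype_mk (Pi.continuous.comp ?_) _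
    have := hcoc.2.2.comp_continuous (f := fun ζ : Hminus => (T, p, v + (ζ:H)))
      (by fun_prop) (fun _ => hT0)
    exact this
  set B : ℝ := Real.exp (2 * ν * T) * ‖P‖ with hB
  have hB0 : 0 ≤ B := by positivity
  have hexp : ∀ ζ η : Hminus, c * ‖ζ - η‖ ^ 2 ≤ B * ‖G ζ - G η‖ ^ 2 := by
    intro ζ η
    have h := h3.2.2 p (v + ζ) (v + η) 0 T le_rfl hT0
    have hint : 0 ≤ ∫ s in (0:ℝ)..T, Real.exp (2 * ν * s) *
        ‖ψ s p (v + ζ) - ψ s p (v + η)‖ ^ 2 :=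
      intervalIntegral.integral_nonneg hT0 fun s _ => by positivity
    have hδ := mul_nonneg h3.1.le hint
    rw [hcoc.1, hcoc.1, add_sub_add_left_eq_sub, mul_zero, Real.exp_zero, one_mul] at h
    have h5 := hcV (ζ - η)
    have h6 := hV (ψ T p (v + ζ) - ψ T p (v + η))
    have h7 : ‖Pi (ψ T p (v + ζ) - ψ T p (v + η))‖ = ‖G ζ - G η‖ := by
      rw [map_sub]; rfl
    rw [h7] at h6
    have h8 := mul_le_mul_of_nonneg_left h6 (Real.exp_pos (2 * ν * T)).le
    rw [Submodule.coe_sub] at h5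
    rw [hB]
    linarith
  have hanti : AntilipschitzWith (Real.toNNReal (Real.sqrt (B / c))) G := by
    refine AntilipschitzWith.of_le_mul_dist fun ζ η => ?_
    rw [Real.coe_toNNReal _ (Real.sqrt_nonneg _), dist_eq_norm, dist_eq_norm]
    refine le_of_sq_le_sq ?_ (by positivity)
    rw [mul_pow, Real.sq_sqrt (by positivity), div_mul_eq_mul_div, le_div_iff₀ hc]
    linarith [hexp ζ η]
  have hsurj := surjective_of_antilipschitz G hGc _ hanti
  let e := Equiv.ofBijective G ⟨hanti.injective, hsurj⟩
  refine ⟨⟨e, hGc, ?_⟩, fun ζ => rfl⟩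
  exact (hanti.to_rightInverse (g := e.symm) fun x => e.apply_symm_apply x).continuous
end
end
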